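/- Let $d\ge 5$ and let $\psi\in\mathcal{S}(\mathbb{R}^d)$ be a Schwartz function with $1_{Q}\le\widetilde{\psi}\le 1_{2Q}$, $Q=[-1/2,1/2]^d$. For $k\in\mathbb{N}$ let $J_k=\lfloor\log_2 k\rfloor-2$, $\Psi_{j,k}=\psi_{q_j,2^{k-j}}$, $\Delta\Psi_{j,k}=\Psi_{j+1,k}-\Psi_{j,k}$, and $M_k f=\sup_{2^k\le\lambda\le 2^{k+1},\ \lambda^2\in\mathbb{N}}|A_\lambda f|$. Then there is a constant $C$ (depending on $d$ and $\psi$) such that for all $f\in\ell^2(\mathbb{Z}^d)$, $\bigl\|\sup_{k\ge 8}\sum_{j=0}^{J_k-1}M_k(f*\Delta\Psi_{j,k})\bigr\|_{\ell^2(\mathbb{Z}^d)}\le C\,\|f\|_{\ell^2(\mathbb{Z}^d)}$. -/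

import Mathlib

open scoped BigOperators ENNReal Real

noncomputable section

/-- Squared Euclidean norm of a lattice point, as a real number. -/
def nsq {d : ℕ} (m : Fin d → ℤ) : ℝ := ∑ i, ((m i : ℝ)) ^ 2

/-- The discrete sphere of radius `lam` in `ℤ^d`. -/
def sph (d : ℕ) (lam : ℝ) : Set (Fin d → ℤ) := {m | nsq m = lam ^ 2}

/-- `N_lam`: the number of lattice points on the sphere of radius `lam`. -/
def Nlam (d : ℕ) (lam : ℝ) : ℕ := Nat.card (sph d lam)

/-- The discrete spherical average. -/
def Avg {d : ℕ} (lam : ℝ) (f : (Fin d → ℤ) → ℝ) (n : Fin d → ℤ) : ℝ :=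
  (Nlam d lam : ℝ)⁻¹ * ∑' m : sph d lam, f (n - (m : Fin d → ℤ))

/-- The `ℓ²(ℤ^d)` norm, valued in `ℝ≥0∞`. -/
def l2norm {d : ℕ} (f : (Fin d → ℤ) → ℝ) : ℝ≥0∞ :=
  (∑' n : Fin d → ℤ, (‖f n‖₊ : ℝ≥0∞) ^ 2) ^ ((1 : ℝ) / 2)

/-- The dyadic-scale maximal operator `M_k f = sup_{2^k ≤ λ ≤ 2^{k+1}, λ²∈ℕ} |A_λ f|`,
valued in `ℝ≥0∞`. -/
def Mk {d : ℕ} (k : ℕ) (f : (Fin d → ℤ) → ℝ) (n : Fin d → ℤ) : ℝ≥0∞ :=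
  ⨆ (lam : ℝ) (_ : (2 : ℝ) ^ k ≤ lam ∧ lam ≤ (2 : ℝ) ^ (k + 1) ∧
      ∃ N : ℕ, (N : ℝ) = lam ^ 2),
    (‖Avg lam f n‖₊ : ℝ≥0∞)

/-- Convolution on `ℤ^d`. -/
def conv {d : ℕ} (f g : (Fin d → ℤ) → ℝ) (n : Fin d → ℤ) : ℝ :=
  ∑' m : Fin d → ℤ, f (n - m) * g m

/-- The Fourier transform on `ℝ^d` with kernel `e^{-2πi x·ξ}`. -/
def ftR {d : ℕ} (ψ : (Fin d → ℝ) → ℝ) (ξ : Fin d → ℝ) : ℂ :=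
  ∫ x : Fin d → ℝ, (ψ x : ℂ) * Complex.exp (-(2 * (π : ℂ) * Complex.I) * (∑ i, x i * ξ i))

/-- The sampling function `ψ_{q,L}(m) = (q/L)^d ψ(m/L)` for `m ∈ (qℤ)^d`, `0` otherwise. -/
def psiQL {d : ℕ} (ψ : (Fin d → ℝ) → ℝ) (q : ℕ) (L : ℝ) : (Fin d → ℤ) → ℝ :=
  Set.indicator {m : Fin d → ℤ | ∀ i, (q : ℤ) ∣ m i}
    (fun m => ((q : ℝ) / L) ^ d * ψ (fun i => (m i : ℝ) / L))

/-- `q_j = lcm{1,2,…,2^j}`. -/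
def qlcm (j : ℕ) : ℕ := (Finset.Icc 1 (2 ^ j)).lcm id

/-- `Ψ_{j,k} = ψ_{q_j, 2^{k-j}}`. -/
def PsiJK {d : ℕ} (ψ : (Fin d → ℝ) → ℝ) (j k : ℕ) : (Fin d → ℤ) → ℝ :=
  psiQL ψ (qlcm j) ((2 : ℝ) ^ ((k : ℤ) - (j : ℤ)))

/-- `ΔΨ_{j,k} = Ψ_{j+1,k} - Ψ_{j,k}`. -/
def DeltaPsiJK {d : ℕ} (ψ : (Fin d → ℝ) → ℝ) (j k : ℕ) : (Fin d → ℤ) → ℝ :=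
  fun m => PsiJK ψ (j + 1) k m - PsiJK ψ j k m

/-- The cube `Q = [-1/2,1/2]^d`. -/
def cubeQ (d : ℕ) : Set (Fin d → ℝ) := {ξ | ∀ i, |ξ i| ≤ 1 / 2}

/-- The cube `2Q = [-1,1]^d`. -/
def cube2Q (d : ℕ) : Set (Fin d → ℝ) := {ξ | ∀ i, |ξ i| ≤ 1}

def GB (u : ℕ) : Set (Associates GaussianInt) :=
  {c | ∃ z : GaussianInt, Associates.mk z = c ∧ z.norm = u}

theorem gauss_fin (u : ℕ) : {z : GaussianInt | z.norm = u}.Finite := by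
  have h : Set.Finite ((Set.Icc (-(u:ℤ)) u) ×ˢ (Set.Icc (-(u:ℤ)) u)) :=
    (Set.finite_Icc _ _).prod (Set.finite_Icc _ _)
  refine (h.image (fun p : ℤ × ℤ => (⟨p.1, p.2⟩ : GaussianInt))).subset ?_
  rintro ⟨x, y⟩ hz
  simp only [Set.mem_ofPred_eq, Zsqrtd.norm_def] at hz
  refine ⟨(x, y), ⟨?_, ?_⟩, rfl⟩ <;> constructor <;> nlinarith [sq_nonneg x, sq_nonneg y,
    sq_nonneg (x-1), sq_nonneg (x+1), sq_nonneg (y-1), sq_nonneg (y+1), Int.le_self_sq x, Int.le_self_sq y, Int.le_self_sq (-x), Int.le_self_sq (-y)]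

theorem GB_fin (u : ℕ) : (GB u).Finite := by
  refine ((gauss_fin u).image Associates.mk).subset ?_
  rintro c ⟨z, rfl, hz⟩
  exact ⟨z, hz, rfl⟩

theorem gcop {m n : ℕ} (h : m.Coprime n) {z w : GaussianInt} (hz : z.norm = m) (hw : w.norm = n) :
    IsCoprime z w := by
  have h1 : IsCoprime (m : ℤ) (n : ℤ) := Nat.isCoprime_iff_coprime.2 h
  have h2 : IsCoprime ((m : ℤ) : GaussianInt) ((n : ℤ) : GaussianInt) := by
    simpa using h1.map (Int.castRingHom GaussianInt)
  rw [← hz, ← hw, Zsqrtd.norm_eq_mul_conj, Zsqrtd.norm_eq_mul_conj] at h2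
  exact h2.of_mul_left_left.of_mul_right_left

theorem gnorm_assoc {z w : GaussianInt} (hd : z ∣ w) (h : z.norm = w.norm) : Associated z w := by
  obtain ⟨c, rfl⟩ := hd
  by_cases hz : z = 0
  · subst hz; simp
  have hz' : z.norm ≠ 0 := fun h => hz (GaussianInt.norm_eq_zero.1 h)
  rw [Zsqrtd.norm_mul] at h
  have : c.norm = 1 := by
    have : z.norm * 1 = z.norm * c.norm := by simpa using h
    exact (mul_left_cancel₀ hz' this).symm
  have hc : IsUnit c := Zsqrtd.norm_eq_one_iff.1 (by rw [this]; rfl)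
  obtain ⟨u, rfl⟩ := hc
  exact ⟨u, rfl⟩

theorem GB_mul {m n : ℕ} (h : m.Coprime n) :
    (GB m).ncard * (GB n).ncard ≤ (GB (m * n)).ncard := by
  rw [← Set.ncard_prod]
  refine Set.ncard_le_ncard_of_injOn (fun p => p.1 * p.2) ?_ ?_ (GB_fin _)
  · rintro ⟨_, _⟩ ⟨⟨z, rfl, hz⟩, ⟨w, rfl, hw⟩⟩
    exact ⟨z * w, by simp [Associates.mk_mul_mk], by rw [Zsqrtd.norm_mul, hz, hw]; push_cast; rfl⟩
  · rintro ⟨_, _⟩ ⟨⟨z, rfl, hz⟩, ⟨w, rfl, hw⟩⟩ ⟨_, _⟩ ⟨⟨z', rfl, hz'⟩, ⟨w', rfl, hw'⟩⟩ he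
    simp only [Associates.mk_mul_mk, Associates.mk_eq_mk_iff_associated] at he
    have d1 : z ∣ z' := (gcop h hz hw').dvd_of_dvd_mul_right ((dvd_mul_right z w).trans he.dvd)
    have d2 : w ∣ w' := (gcop h.symm hw hz').dvd_of_dvd_mul_left ((dvd_mul_left w z).trans he.dvd)
    have e1 := gnorm_assoc d1 (by rw [hz, hz'])
    have e2 := gnorm_assoc d2 (by rw [hw, hw'])
    simp [Associates.mk_eq_mk_iff_associated, e1, e2]

theorem GB_pp1 {p : ℕ} (hp : p.Prime) (h1 : p % 4 = 1) (k : ℕ) : k + 1 ≤ (GB (p ^ k)).ncard := by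
  haveI := Fact.mk hp
  obtain ⟨a, b, hab⟩ := Nat.Prime.sq_add_sq (p := p) (by omega)
  set ϖ : GaussianInt := ⟨a, b⟩ with hϖ
  have hn : ϖ.norm = p := by
    simp only [hϖ, Zsqrtd.norm_def]; push_cast [← hab]; ring
  have hns : (star ϖ).norm = p := by
    simp only [hϖ, Zsqrtd.norm_def, Zsqrtd.star_mk]; push_cast [← hab]; ring
  have hirr : Irreducible ϖ := by
    refine ⟨fun hu => ?_, ?_⟩
    · have := Zsqrtd.norm_eq_one_iff.2 hu
      rw [hn] at this; simp at this; exact hp.one_lt.ne' this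
    · intro x y hxy
      have : x.norm.natAbs * y.norm.natAbs = p := by
        rw [← Int.natAbs_mul, ← Zsqrtd.norm_mul, ← hxy, hn]; simp
      rw [← Zsqrtd.norm_eq_one_iff, ← Zsqrtd.norm_eq_one_iff]
      rcases (Nat.prime_mul_iff.1 (this ▸ hp)) with h | h
      · right; exact h.2
      · left; exact h.2
  have hpr : Prime ϖ := irreducible_iff_prime.1 hirr
  have hnd : ¬ ϖ ∣ star ϖ := by
    intro hd
    have h2 : ϖ ∣ ϖ + star ϖ := dvd_add dvd_rfl hd
    have h3 : ϖ + star ϖ = ((2 * a : ℕ) : GaussianInt) := by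
      rw [hϖ]; ext <;> simp; ring
    rw [h3] at h2
    obtain ⟨c, hc⟩ := h2
    have h4 := congrArg Zsqrtd.norm hc
    rw [Zsqrtd.norm_mul, hn, Zsqrtd.norm_natCast] at h4
    have h5 : (p : ℤ) ∣ ((2 * a * (2 * a) : ℕ) : ℤ) := ⟨c.norm, by push_cast at h4 ⊢; exact h4⟩
    have h6 : p ∣ 2 * a * (2 * a) := by exact_mod_cast h5
    have h7 : p ∣ 2 * a := by rcases (hp.dvd_mul).1 h6 with h | h <;> exact h
    have hap : p ∣ a := by
      rcases (hp.dvd_mul).1 h7 with h | h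
      · have := Nat.le_of_dvd (by norm_num) h
        have := hp.two_le
        have : p = 2 := by omega
        omega
      · exact h
    rcases Nat.eq_zero_or_pos a with h0 | h0
    · subst h0
      have : p ∣ b := hp.dvd_of_dvd_pow (n := 2) ⟨1, by simpa using hab⟩
      rcases Nat.eq_zero_or_pos b with h0 | h0
      · subst h0; simp at hab; exact hp.ne_zero hab.symm
      · have := Nat.le_of_dvd h0 this; have := hp.two_le; nlinarith
    · have := Nat.le_of_dvd h0 hap; have := hp.two_le; nlinarith
  have hinj : ∀ i j, i < j → j ≤ k → ¬ Associated (ϖ ^ i * (star ϖ) ^ (k - i)) (ϖ ^ j * (star ϖ) ^ (k - j)) := by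
    intro i j hij hjk ha
    have h1 : ϖ ^ (i + 1) ∣ ϖ ^ i * (star ϖ) ^ (k - i) :=
      ((pow_dvd_pow ϖ hij).trans (dvd_mul_right _ _)).trans ha.symm.dvd
    rw [pow_succ] at h1
    have h2 : ϖ ∣ (star ϖ) ^ (k - i) := (mul_dvd_mul_iff_left (pow_ne_zero _ hpr.ne_zero)).1 h1
    exact hnd (hpr.dvd_of_dvd_pow h2)
  have : (Set.Iic k).ncard ≤ (GB (p ^ k)).ncard := by
    refine Set.ncard_le_ncard_of_injOn (fun i => Associates.mk (ϖ ^ i * (star ϖ) ^ (k - i))) ?_ ?_ (GB_fin _)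
    · intro i hi
      refine ⟨_, rfl, ?_⟩
      have hf : ∀ (x : GaussianInt) (n : ℕ), (x ^ n).norm = x.norm ^ n := fun x n =>
        map_pow Zsqrtd.normMonoidHom x n
      rw [Zsqrtd.norm_mul, hf, hf, hn, hns, ← pow_add, Nat.add_sub_cancel' hi]; push_cast; rfl
    · intro i hi j hj hij
      simp only [Associates.mk_eq_mk_iff_associated] at hij
      by_contra hne
      rcases lt_or_gt_of_ne hne with h | h
      · exact hinj i j h hj hij
      · exact hinj j i h hi hij.symm
  simpa [Set.ncard_eq_toFinset_card'] using this

def DD (u : ℕ) : ℤ := ∑ d ∈ u.divisors, ZMod.χ₄ d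

theorem DD_mul {m n : ℕ} (h : m.Coprime n) : DD (m * n) = DD m * DD n := by
  let f : ArithmeticFunction ℤ := ⟨fun n => if n = 0 then 0 else ZMod.χ₄ n, by simp⟩
  have hf : f.IsMultiplicative := by
    refine ⟨by simp [f], fun {m n} _ => ?_⟩
    by_cases hm : m = 0
    · simp [f, hm]
    by_cases hn : n = 0
    · simp [f, hn]
    have hmn : m * n ≠ 0 := Nat.mul_ne_zero hm hn
    show (if m * n = 0 then (0:ℤ) else ZMod.χ₄ ((m * n : ℕ) : ZMod 4)) = (if m = 0 then (0:ℤ) else ZMod.χ₄ (m : ZMod 4)) * (if n = 0 then (0:ℤ) else ZMod.χ₄ (n : ZMod 4))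
    rw [if_neg hmn, if_neg hm, if_neg hn, Nat.cast_mul, map_mul]
  have hD : ∀ u, DD u = (f * (ArithmeticFunction.zeta : ArithmeticFunction ℤ)) u := by
    intro u
    rw [ArithmeticFunction.coe_mul_zeta_apply, DD]
    refine Finset.sum_congr rfl fun d hd => ?_
    have : d ≠ 0 := (Nat.pos_of_mem_divisors hd).ne'
    show _ = (if d = 0 then (0:ℤ) else ZMod.χ₄ (d : ZMod 4))
    rw [if_neg this]
  rw [hD, hD, hD]
  exact (hf.mul ArithmeticFunction.isMultiplicative_zeta.natCast).map_mul_of_coprime h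

theorem DD_le {u : ℕ} (hu : u % 2 = 1) : 0 ≤ DD u ∧ DD u ≤ (GB u).ncard := by
  induction u using Nat.recOnPosPrimePosCoprime with
  | prime_pow p k hp hk =>
    have hp2 : p % 2 = 1 := by
      rcases hp.eq_two_or_odd with h | h
      · subst h
        have : 2 ∣ 2 ^ k := dvd_pow_self 2 (by omega)
        omega
      · exact h
    rw [DD, Nat.sum_divisors_prime_pow hp]
    have h4 : p % 4 = 1 ∨ p % 4 = 3 := by omega
    rcases h4 with h | h
    · have : ∀ x ∈ Finset.range (k+1), ZMod.χ₄ ((p ^ x : ℕ) : ZMod 4) = 1 := by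
        intro x _
        push_cast
        rw [map_pow, ZMod.χ₄_nat_one_mod_four h, one_pow]
      rw [Finset.sum_congr rfl this]
      simp only [Finset.sum_const, Finset.card_range, nsmul_eq_mul, mul_one]
      exact ⟨by positivity, by exact_mod_cast GB_pp1 hp h k⟩
    · have : ∀ x ∈ Finset.range (k+1), ZMod.χ₄ ((p ^ x : ℕ) : ZMod 4) = (-1) ^ x := by
        intro x _
        push_cast
        rw [map_pow, ZMod.χ₄_nat_three_mod_four h]
      rw [Finset.sum_congr rfl this, neg_one_geom_sum]
      split_ifs with he
      · exact ⟨le_rfl, by positivity⟩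
      · have : Even k := by
          rcases Nat.even_or_odd k with h | h
          · exact h
          · exact absurd (h.add_one) he
        obtain ⟨l, rfl⟩ := this
        have : 0 < (GB (p ^ (l + l))).ncard := by
          rw [Set.ncard_pos (GB_fin _)]
          refine ⟨_, ((p ^ l : ℕ) : GaussianInt), rfl, ?_⟩
          rw [Zsqrtd.norm_natCast]; push_cast; rw [pow_add]
        omega
  | zero => simp at hu
  | one =>
    have : 0 < (GB 1).ncard := by
      rw [Set.ncard_pos (GB_fin _)]
      exact ⟨_, 1, rfl, by simp⟩
    have h1 : DD 1 = 1 := by simp [DD]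
    omega
  | coprime a b ha hb hab iha ihb =>
    have ha2 : a % 2 = 1 ∧ b % 2 = 1 := by
      have := Nat.odd_mul.1 (Nat.odd_iff.2 hu)
      simpa [Nat.odd_iff] using this
    rw [DD_mul hab]
    have h1 := iha ha2.1
    have h2 := ihb ha2.2
    have h3 := GB_mul hab
    have : DD a * DD b ≤ ((GB a).ncard : ℤ) * (GB b).ncard :=
      mul_le_mul h1.2 h2.2 h2.1 (by positivity)
    exact ⟨mul_nonneg h1.1 h2.1, this.trans (by exact_mod_cast h3)⟩

theorem GB_le (u : ℕ) (hu : 0 < u) : 4 * (GB u).ncard ≤ {z : GaussianInt | z.norm = u}.ncard := by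
  have h : (({(⟨1,0⟩ : GaussianInt), ⟨-1,0⟩, ⟨0,1⟩, ⟨0,-1⟩} : Finset GaussianInt) : Set GaussianInt).ncard = 4 := by
    rw [Set.ncard_coe_finset]; rfl
  rw [← h, ← Set.ncard_prod]
  choose! g hg using fun (c : Associates GaussianInt) (hc : c ∈ GB u) => hc
  have hun : ∀ e ∈ ({(⟨1,0⟩ : GaussianInt), ⟨-1,0⟩, ⟨0,1⟩, ⟨0,-1⟩} : Finset GaussianInt), e.norm = 1 := by
    decide
  refine Set.ncard_le_ncard_of_injOn (fun p => p.1 * g p.2) ?_ ?_ (gauss_fin _)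
  · rintro ⟨e, c⟩ ⟨he, hc⟩
    simp only [Set.mem_ofPred_eq, Zsqrtd.norm_mul]
    rw [(hg c hc).2, hun e he, one_mul]
  · rintro ⟨e, c⟩ ⟨he, hc⟩ ⟨e', c'⟩ ⟨he', hc'⟩ heq
    simp only at heq he he' hc hc'
    have hU : ∀ e ∈ ({(⟨1,0⟩ : GaussianInt), ⟨-1,0⟩, ⟨0,1⟩, ⟨0,-1⟩} : Finset GaussianInt), IsUnit e := by
      intro e he
      exact Zsqrtd.norm_eq_one_iff.1 (by rw [hun e he]; rfl)
    have hc2 : c = c' := by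
      rw [← (hg c hc).1, ← (hg c' hc').1, Associates.mk_eq_mk_iff_associated]
      have h1 := associated_unit_mul_left (g c) e (hU e he)
      have h2 := associated_unit_mul_left (g c') e' (hU e' he')
      exact h1.symm.trans ((Associated.of_eq heq).trans h2)
    subst hc2
    have hne : g c ≠ 0 := by
      intro h0
      have := (hg c hc).2
      rw [h0] at this; simp at this; omega
    have := mul_right_cancel₀ hne heq
    rw [this]

def XX (m : ℤ) : Finset (ℤ × ℤ × ℤ × ℤ) :=
  (Finset.Icc 1 (2*m) ×ˢ Finset.Icc 1 (2*m) ×ˢ Finset.Icc 1 (2*m) ×ˢ Finset.Icc 1 (2*m)).filter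
    (fun p => p.1 % 2 = 1 ∧ p.2.1 % 2 = 1 ∧ p.2.2.1 % 2 = 1 ∧ p.2.2.2 % 2 = 1 ∧
      p.1 * p.2.1 + p.2.2.1 * p.2.2.2 = 2 * m)

theorem mem_XX {m a b c d : ℤ} : (a, b, c, d) ∈ XX m ↔
    (0 < a ∧ 0 < b ∧ 0 < c ∧ 0 < d) ∧ (a % 2 = 1 ∧ b % 2 = 1 ∧ c % 2 = 1 ∧ d % 2 = 1) ∧
      a * b + c * d = 2 * m := by
  simp only [XX, Finset.mem_filter, Finset.mem_product, Finset.mem_Icc]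
  constructor
  · rintro ⟨⟨h1, h2, h3, h4⟩, h5, h6, h7, h8, h9⟩
    exact ⟨⟨by omega, by omega, by omega, by omega⟩, ⟨h5, h6, h7, h8⟩, h9⟩
  · rintro ⟨⟨h1, h2, h3, h4⟩, ⟨h5, h6, h7, h8⟩, h9⟩
    have := mul_pos h1 h2
    have := mul_pos h3 h4
    refine ⟨⟨⟨by omega, by nlinarith⟩, ⟨by omega, by nlinarith⟩, ⟨by omega, by nlinarith⟩, ⟨by omega, by nlinarith⟩⟩, h5, h6, h7, h8, h9⟩

def sg (p : ℤ × ℤ × ℤ × ℤ) : ℤ := ZMod.χ₄ (p.1 : ZMod 4) * ZMod.χ₄ (p.2.2.1 : ZMod 4)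

theorem sg_eq {a b c d : ℤ} (ha : a % 2 = 1) (hc : c % 2 = 1) :
    sg (a, b, c, d) = if (a - c) % 4 = 0 then 1 else -1 := by
  simp only [sg, ZMod.χ₄_int_eq_if_mod_four]
  have h1 : a % 4 = 1 ∨ a % 4 = 3 := by omega
  have h2 : c % 4 = 1 ∨ c % 4 = 3 := by omega
  rcases h1 with h1 | h1 <;> rcases h2 with h2 | h2 <;> split_ifs <;> first | rfl | omega

def gg (p : ℤ × ℤ × ℤ × ℤ) : ℤ × ℤ × ℤ × ℤ :=
  let v := p.1 / (p.1 - p.2.2.1)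
  let w := p.1 - p.2.2.1
  let s := p.2.1 + p.2.2.2
  (v * s + p.2.1, p.1 - v * w, v * s - p.2.2.2, v * w - p.2.2.1)

theorem parity_key {a b c d m : ℤ} (ha : a % 2 = 1) (hb : b % 2 = 1) (hc : c % 2 = 1) (hd : d % 2 = 1)
    (hm : m % 2 = 1) (h : a * b + c * d = 2 * m) :
    ¬ (((b + d) % 4 = 0) ↔ ((a - c) % 4 = 0)) := by
  have h1 : a % 4 = 1 ∨ a % 4 = 3 := by omega
  have h2 : c % 4 = 1 ∨ c % 4 = 3 := by omega
  have h3 : b % 4 = 1 ∨ b % 4 = 3 := by omega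
  have h4 : d % 4 = 1 ∨ d % 4 = 3 := by omega
  have h5 : (a * b + c * d) % 4 = 2 := by omega
  rw [Int.add_emod, Int.mul_emod, Int.mul_emod c] at h5
  rcases h1 with h1 | h1 <;> rcases h2 with h2 | h2 <;> rcases h3 with h3 | h3 <;>
    rcases h4 with h4 | h4 <;> simp [h1, h2, h3, h4] at h5 <;> omega

theorem gg_facts {m a b c d : ℤ} (hm : m % 2 = 1) (h : (a, b, c, d) ∈ XX m) (hac : c < a) :
    gg (a, b, c, d) ∈ XX m ∧ (gg (a,b,c,d)).2.2.1 < (gg (a,b,c,d)).1 ∧ gg (gg (a, b, c, d)) = (a, b, c, d)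
      ∧ sg (a, b, c, d) + sg (gg (a, b, c, d)) = 0 := by
  rw [mem_XX] at h
  obtain ⟨⟨h1, h2, h3, h4⟩, ⟨h5, h6, h7, h8⟩, h9⟩ := h
  obtain ⟨w, hw⟩ : ∃ w, w = a - c := ⟨_, rfl⟩
  obtain ⟨s, hs⟩ : ∃ s, s = b + d := ⟨_, rfl⟩
  obtain ⟨v, hv⟩ : ∃ v, v = a / w := ⟨_, rfl⟩
  have hw0 : 0 < w := by omega
  have hg : gg (a, b, c, d) = (v * s + b, a - v * w, v * s - d, v * w - c) := by
    simp only [gg, hv, hw, hs]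
  have e1 : 0 ≤ a - v * w := by
    have := Int.ediv_mul_le a hw0.ne'; rw [← hv] at this; linarith
  have e2 : a - v * w < w := by
    have := Int.lt_ediv_add_one_mul_self a hw0; rw [← hv] at this; linarith
  have hv1 : 1 ≤ v := by
    by_contra hcon
    have : v ≤ 0 := by omega
    nlinarith
  have hwe : w % 2 = 0 := by omega
  have hse : s % 2 = 0 := by omega
  have hvw : (v * w) % 2 = 0 := by rw [Int.mul_emod, hwe]; simp
  have hvs : (v * s) % 2 = 0 := by rw [Int.mul_emod, hse]; simp
  have hvs2 : s ≤ v * s := by nlinarith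
  have hmem : (v * s + b, a - v * w, v * s - d, v * w - c) ∈ XX m := by
    rw [mem_XX]
    refine ⟨⟨by omega, by omega, by omega, by omega⟩, ⟨by omega, by omega, by omega, by omega⟩, ?_⟩
    rw [← h9, hw, hs]; ring
  rw [hg]
  refine ⟨hmem, by simp only; omega, ?_, ?_⟩
  · have : (v * s + b) / (v * s + b - (v * s - d)) = v := by
      have : v * s + b - (v * s - d) = s := by omega
      rw [this, add_comm, Int.add_mul_ediv_right _ _ (by omega), Int.ediv_eq_zero_of_lt (by omega) (by omega), zero_add]
    simp only [gg, this]
    have ew : v * s + b - (v * s - d) = s := by omega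
    have es : a - v * w + (v * w - c) = w := by omega
    rw [ew, es]
    ext <;> simp
  · rw [sg_eq h5 h7, sg_eq (by omega) (by omega)]
    have := parity_key h5 h6 h7 h8 hm h9
    have ew : v * s + b - (v * s - d) = b + d := by omega
    rw [ew]
    split_ifs <;> first | rfl | (exfalso; tauto)

theorem sum_XX {m : ℤ} (hm : m % 2 = 1) (hm0 : 0 < m) : m ≤ ∑ p ∈ XX m, sg p := by
  have hgt : ∑ p ∈ (XX m).filter (fun p => p.2.2.1 < p.1), sg p = 0 := by
    refine Finset.sum_involution (fun p _ => gg p) ?_ ?_ ?_ ?_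
    · rintro ⟨a, b, c, d⟩ hp
      rw [Finset.mem_filter] at hp
      exact (gg_facts hm hp.1 hp.2).2.2.2
    · rintro ⟨a, b, c, d⟩ hp hne heq
      rw [Finset.mem_filter] at hp
      have := (gg_facts hm hp.1 hp.2).2.2.2
      rw [heq] at this
      omega
    · rintro ⟨a, b, c, d⟩ hp
      rw [Finset.mem_filter] at hp
      rw [Finset.mem_filter]
      exact ⟨(gg_facts hm hp.1 hp.2).1, (gg_facts hm hp.1 hp.2).2.1⟩
    · rintro ⟨a, b, c, d⟩ hp
      rw [Finset.mem_filter] at hp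
      exact (gg_facts hm hp.1 hp.2).2.2.1
  have hlt : ∑ p ∈ (XX m).filter (fun p => p.1 < p.2.2.1), sg p = 0 := by
    rw [← hgt]
    refine Finset.sum_bij' (fun p _ => (p.2.2.1, p.2.2.2, p.1, p.2.1)) (fun p _ => (p.2.2.1, p.2.2.2, p.1, p.2.1)) ?_ ?_ ?_ ?_ ?_
    · rintro ⟨a, b, c, d⟩ hp
      simp only [Finset.mem_filter, mem_XX] at hp ⊢
      refine ⟨⟨by tauto, by tauto, by linarith⟩, hp.2⟩
    · rintro ⟨a, b, c, d⟩ hp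
      simp only [Finset.mem_filter, mem_XX] at hp ⊢
      refine ⟨⟨by tauto, by tauto, by linarith⟩, hp.2⟩
    · rintro ⟨a, b, c, d⟩ hp; rfl
    · rintro ⟨a, b, c, d⟩ hp; rfl
    · rintro ⟨a, b, c, d⟩ hp
      simp only [sg]; ring
  have hsplit : ∑ p ∈ XX m, sg p = ∑ p ∈ (XX m).filter (fun p => p.2.2.1 < p.1), sg p
      + (∑ p ∈ (XX m).filter (fun p => p.1 < p.2.2.1), sg p
      + ∑ p ∈ (XX m).filter (fun p => p.1 = p.2.2.1), sg p) := by
    rw [Finset.sum_filter, Finset.sum_filter, Finset.sum_filter, ← Finset.sum_add_distrib, ← Finset.sum_add_distrib]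
    refine Finset.sum_congr rfl fun p _ => ?_
    rcases lt_trichotomy p.1 p.2.2.1 with h | h | h
    · simp [h, h.ne, h.le]
    · simp [h]
    · simp [h, h.ne', h.le]
  rw [hsplit, hgt, hlt, zero_add, zero_add]
  have hone : ∀ p ∈ (XX m).filter (fun p => p.1 = p.2.2.1), sg p = 1 := by
    rintro ⟨a, b, c, d⟩ hp
    simp only [Finset.mem_filter, mem_XX] at hp
    obtain ⟨⟨_, h, _⟩, rfl⟩ := hp
    rw [sg_eq h.1 h.1]; simp
  rw [Finset.sum_congr rfl hone]
  simp only [Finset.sum_const, nsmul_eq_mul, mul_one]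
  have : (Finset.range m.toNat).card ≤ ((XX m).filter (fun p => p.1 = p.2.2.1)).card := by
    refine Finset.card_le_card_of_injOn (fun i : ℕ => ((1:ℤ), (2 * i + 1 : ℤ), (1:ℤ), 2 * m - (2 * i + 1))) ?_ ?_
    · intro i hi
      simp only [Finset.coe_range, Set.mem_Iio] at hi
      simp only [Finset.coe_filter, Set.mem_ofPred_eq, mem_XX]
      refine ⟨⟨⟨by omega, by omega, by omega, by omega⟩, ⟨by omega, by omega, by omega, by omega⟩, by ring⟩, trivial⟩
    · intro i _ j _ hij
      simp at hij
      omega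
  rw [Finset.card_range] at this
  omega

theorem sum_DD {m : ℕ} (hm : m % 2 = 1) :
    (m : ℤ) ≤ ∑ p ∈ (Finset.HasAntidiagonal.antidiagonal (2 * m)).filter (fun p => p.1 % 2 = 1), DD p.1 * DD p.2 := by
  refine (sum_XX (m := m) (by omega) (by omega)).trans (le_of_eq ?_)
  have hD : ∀ u, DD u = ∑ q ∈ u.divisorsAntidiagonal, ZMod.χ₄ (q.1 : ZMod 4) := by
    intro u
    rw [DD, ← Nat.map_div_right_divisors, Finset.sum_map]
    rfl
  simp only [hD, Finset.sum_mul_sum]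
  simp only [← Finset.sum_product']
  rw [Finset.sum_sigma']
  symm
  refine Finset.sum_bij (fun x _ => ((x.2.1.1 : ℤ), (x.2.1.2 : ℤ), (x.2.2.1 : ℤ), (x.2.2.2 : ℤ))) ?_ ?_ ?_ ?_
  · rintro ⟨⟨u, v⟩, ⟨⟨a, b⟩, ⟨c, d⟩⟩⟩ hx
    simp only [Finset.mem_sigma, Finset.mem_filter, Finset.HasAntidiagonal.mem_antidiagonal, Finset.mem_product, Nat.mem_divisorsAntidiagonal] at hx
    obtain ⟨⟨h1, h2⟩, ⟨h3, h4⟩, h5, h6⟩ := hx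
    rw [mem_XX]
    have hu : Odd (a * b) := by rw [h3]; exact Nat.odd_iff.2 h2
    have hv : Odd (c * d) := by rw [h5, Nat.odd_iff]; omega
    rw [Nat.odd_mul] at hu hv
    obtain ⟨ha, hb⟩ := hu
    obtain ⟨hc, hd⟩ := hv
    have := ha.pos; have := hb.pos; have := hc.pos; have := hd.pos
    rw [Nat.odd_iff] at ha hb hc hd
    dsimp only
    refine ⟨⟨by omega, by omega, by omega, by omega⟩, ⟨by omega, by omega, by omega, by omega⟩, ?_⟩
    rw [← h3, ← h5] at h1
    exact_mod_cast h1
  · rintro ⟨⟨u, v⟩, ⟨⟨a, b⟩, ⟨c, d⟩⟩⟩ hx ⟨⟨u', v'⟩, ⟨⟨a', b'⟩, ⟨c', d'⟩⟩⟩ hx' heq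
    simp only [Finset.mem_sigma, Finset.mem_filter, Finset.HasAntidiagonal.mem_antidiagonal, Finset.mem_product, Nat.mem_divisorsAntidiagonal] at hx hx'
    simp only [Prod.mk.injEq, Nat.cast_inj] at heq
    obtain ⟨rfl, rfl, rfl, rfl⟩ := heq
    obtain ⟨⟨h1, h2⟩, ⟨h3, h4⟩, h5, h6⟩ := hx
    obtain ⟨⟨h1', h2'⟩, ⟨h3', h4'⟩, h5', h6'⟩ := hx'
    subst h3 h5 h3' h5'
    rfl
  · rintro ⟨a, b, c, d⟩ h
    rw [mem_XX] at h
    obtain ⟨⟨h1, h2, h3, h4⟩, ⟨h5, h6, h7, h8⟩, h9⟩ := h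
    lift a to ℕ using h1.le
    lift b to ℕ using h2.le
    lift c to ℕ using h3.le
    lift d to ℕ using h4.le
    refine ⟨⟨(a * b, c * d), ((a, b), (c, d))⟩, ?_, rfl⟩
    simp only [Finset.mem_sigma, Finset.mem_filter, Finset.HasAntidiagonal.mem_antidiagonal, Finset.mem_product, Nat.mem_divisorsAntidiagonal]
    have ha : Odd a := Nat.odd_iff.2 (by omega)
    have hb : Odd b := Nat.odd_iff.2 (by omega)
    have hc : Odd c := Nat.odd_iff.2 (by omega)
    have hd : Odd d := Nat.odd_iff.2 (by omega)
    refine ⟨⟨by exact_mod_cast h9, Nat.odd_iff.1 (ha.mul hb)⟩, ⟨trivial, ?_⟩, trivial, ?_⟩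
    · exact (ha.mul hb).pos.ne'
    · exact (hc.mul hd).pos.ne'
  · rintro ⟨⟨u, v⟩, ⟨⟨a, b⟩, ⟨c, d⟩⟩⟩ hx
    simp [sg]

/-- lattice points of squared norm `N`. -/
def rS (d N : ℕ) : Finset (Fin d → ℤ) :=
  (Fintype.piFinset (fun _ => Finset.Icc (-(N:ℤ)) N)).filter (fun m => ∑ i, (m i)^2 = (N:ℤ))

theorem mem_rS {d N : ℕ} {m : Fin d → ℤ} : m ∈ rS d N ↔ ∑ i, (m i)^2 = (N:ℤ) := by
  rw [rS, Finset.mem_filter, Fintype.mem_piFinset]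
  refine ⟨fun h => h.2, fun h => ⟨fun i => ?_, h⟩⟩
  have h1 : (m i)^2 ≤ N := by
    rw [← h]; exact Finset.single_le_sum (f := fun i => (m i)^2) (fun j _ => sq_nonneg _) (Finset.mem_univ i)
  rw [Finset.mem_Icc]
  constructor
  · nlinarith [sq_nonneg (m i + 1), sq_nonneg (m i)]
  · rcases le_or_gt (m i) 0 with h0 | h0
    · have : (0:ℤ) ≤ N := by positivity
      linarith
    · nlinarith

theorem rS_succ (d N s : ℕ) (x : ℕ → ℕ) (hx : Function.Injective x) (hs : ∀ i < s, x i ^ 2 ≤ N) :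
    ∑ i ∈ Finset.range s, (rS d (N - x i ^ 2)).card ≤ (rS (d+1) N).card := by
  rw [← Finset.card_sigma]
  refine Finset.card_le_card_of_injOn (fun p => (Fin.cons (x p.1 : ℤ) p.2 : Fin (d+1) → ℤ)) ?_ ?_
  · rintro ⟨i, v⟩ h
    simp only [Finset.coe_sigma, Set.mem_sigma_iff, Finset.mem_coe, Finset.mem_range, mem_rS] at h
    simp only [Finset.mem_coe, mem_rS, Fin.sum_univ_succ, Fin.cons_zero, Fin.cons_succ]
    rw [h.2, Nat.cast_sub (hs i h.1)]
    push_cast; ring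
  · rintro ⟨i, v⟩ h ⟨i', v'⟩ h' e
    have e' := Fin.cons_injective2 e
    obtain ⟨e1, e2⟩ := e'
    have : i = i' := hx (by exact_mod_cast e1)
    subst this
    simp at e2
    rw [e2]

/-- pairs of Gaussian integers -/
def pS (m : ℕ) : Finset (Σ _ : ℕ × ℕ, GaussianInt × GaussianInt) :=
  ((Finset.HasAntidiagonal.antidiagonal (2 * m)).filter (fun p => p.1 % 2 = 1)).sigma
    (fun p => (gauss_fin p.1).toFinset ×ˢ (gauss_fin p.2).toFinset)

theorem pS_card {m : ℕ} (hm : m % 2 = 1) : 16 * m ≤ (pS m).card := by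
  rw [pS, Finset.card_sigma, ← Int.ofNat_le, Nat.cast_mul, Nat.cast_sum, Nat.cast_ofNat]
  have h := sum_DD hm
  have : 16 * ∑ p ∈ (Finset.HasAntidiagonal.antidiagonal (2 * m)).filter (fun p => p.1 % 2 = 1), DD p.1 * DD p.2 ≤
    ∑ p ∈ (Finset.HasAntidiagonal.antidiagonal (2 * m)).filter (fun p => p.1 % 2 = 1), (((gauss_fin p.1).toFinset ×ˢ (gauss_fin p.2).toFinset).card : ℤ) := by
    rw [Finset.mul_sum]
    refine Finset.sum_le_sum ?_
    rintro ⟨u, v⟩ hp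
    simp only [Finset.mem_filter, Finset.HasAntidiagonal.mem_antidiagonal] at hp
    rw [Finset.card_product, ← Set.ncard_eq_toFinset_card _ (gauss_fin u), ← Set.ncard_eq_toFinset_card _ (gauss_fin v)]
    have key : ∀ u : ℕ, u % 2 = 1 → 0 ≤ DD u ∧ 4 * DD u ≤ ({z : GaussianInt | z.norm = u}.ncard : ℤ) := by
      intro u hu
      have h1 := DD_le hu
      have h2 := GB_le u (by omega)
      refine ⟨h1.1, ?_⟩
      have : 4 * ((GB u).ncard : ℤ) ≤ ({z : GaussianInt | z.norm = u}.ncard : ℤ) := by exact_mod_cast h2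
      linarith [h1.2]
    obtain ⟨a, b⟩ := key u hp.2
    obtain ⟨a', b'⟩ := key v (by omega)
    push_cast
    calc 16 * (DD u * DD v) = (4 * DD u) * (4 * DD v) := by ring
      _ ≤ _ := mul_le_mul b b' (by positivity) (by positivity)
  linarith

theorem mem_pS {m : ℕ} {x} : x ∈ pS m ↔ (x.1.1 + x.1.2 = 2 * m ∧ x.1.1 % 2 = 1) ∧
    x.2.1.re^2 + x.2.1.im^2 = (x.1.1:ℤ) ∧ x.2.2.re^2 + x.2.2.im^2 = (x.1.2:ℤ) := by
  obtain ⟨⟨u, v⟩, ⟨⟨a, b⟩, ⟨c, e⟩⟩⟩ := x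
  simp only [pS, Finset.mem_sigma, Finset.mem_filter, Finset.HasAntidiagonal.mem_antidiagonal, Finset.mem_product,
    Set.Finite.mem_toFinset, Set.mem_ofPred_eq, Zsqrtd.norm_def]
  constructor <;> rintro ⟨h1, h2, h3⟩ <;> refine ⟨h1, ?_, ?_⟩ <;> linarith

theorem pS_inj {m : ℕ} {x y} (hx : x ∈ pS m) (hy : y ∈ pS m) (h1 : x.2.1.re = y.2.1.re) (h2 : x.2.1.im = y.2.1.im)
   (h3 : x.2.2.re = y.2.2.re) (h4 : x.2.2.im = y.2.2.im) : x = y := by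
  rw [mem_pS] at hx hy
  obtain ⟨⟨u, v⟩, ⟨⟨a, b⟩, ⟨c, e⟩⟩⟩ := x
  obtain ⟨⟨u', v'⟩, ⟨⟨a', b'⟩, ⟨c', e'⟩⟩⟩ := y
  dsimp only at *
  subst h1 h2 h3 h4
  have : u = u' := by have := hx.2.1.symm.trans hy.2.1; exact_mod_cast this
  have : v = v' := by have := hx.2.2.symm.trans hy.2.2; exact_mod_cast this
  subst u v
  rfl

theorem rS4_two {m : ℕ} (hm : m % 2 = 1) : 16 * m ≤ (rS 4 (2*m)).card := by
  refine (pS_card hm).trans (Finset.card_le_card_of_injOn (fun x => ![x.2.1.re, x.2.1.im, x.2.2.re, x.2.2.im]) ?_ ?_)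
  · intro x hx
    rw [Finset.mem_coe, mem_pS] at hx
    rw [Finset.mem_coe, mem_rS]
    simp only [Fin.sum_univ_four, Matrix.cons_val]
    push_cast
    have := hx.1.1
    zify at this
    linarith [hx.2.1, hx.2.2]
  · intro x hx y hy h
    simp only [Finset.mem_coe] at hx hy
    refine pS_inj hx hy ?_ ?_ ?_ ?_
    · exact congrFun h 0
    · exact congrFun h 1
    · exact congrFun h 2
    · exact congrFun h 3

theorem pS_par {m : ℕ} {x} (h : x ∈ pS m) : (x.2.1.re + x.2.1.im) % 2 = 1 ∧ (x.2.2.re + x.2.2.im) % 2 = 1 := by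
  rw [mem_pS] at h
  obtain ⟨⟨h1, h2⟩, h3, h4⟩ := h
  have key : ∀ a b : ℤ, (a^2 + b^2) % 2 = 1 → (a + b) % 2 = 1 := by
    intro a b h
    rcases Int.emod_two_eq_zero_or_one a with ha | ha <;> rcases Int.emod_two_eq_zero_or_one b with hb | hb <;>
      simp [pow_two, Int.add_emod, Int.mul_emod, ha, hb] at h ⊢
  exact ⟨key _ _ (by omega), key _ _ (by omega)⟩

set_option maxHeartbeats 1000000 in
theorem rS4_odd {m : ℕ} (hm : m % 2 = 1) : 8 * m ≤ (rS 4 m).card := by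
  have h := pS_card hm
  rw [← Finset.card_filter_add_card_filter_not (fun x => (x.2.1.re + x.2.2.re) % 2 = 0)] at h
  have e1 : ((pS m).filter (fun x => (x.2.1.re + x.2.2.re) % 2 = 0)).card ≤ (rS 4 m).card := by
    refine Finset.card_le_card_of_injOn (fun x => ![(x.2.1.re + x.2.2.re)/2, (x.2.1.re - x.2.2.re)/2, (x.2.1.im + x.2.2.im)/2, (x.2.1.im - x.2.2.im)/2]) ?_ ?_
    · intro x hx
      rw [Finset.mem_coe, Finset.mem_filter] at hx
      have hp := pS_par hx.1
      have hx2 := hx.2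
      have hx1 := mem_pS.1 hx.1
      rw [Finset.mem_coe, mem_rS]
      simp only [Fin.sum_univ_four, Matrix.cons_val]
      obtain ⟨p, hp1⟩ : ∃ p, (x.2.1.re + x.2.2.re)/2 = p := ⟨_, rfl⟩
      obtain ⟨r, hr1⟩ : ∃ p, (x.2.1.re - x.2.2.re)/2 = p := ⟨_, rfl⟩
      obtain ⟨s, hs1⟩ : ∃ p, (x.2.1.im + x.2.2.im)/2 = p := ⟨_, rfl⟩
      obtain ⟨t, ht1⟩ : ∃ p, (x.2.1.im - x.2.2.im)/2 = p := ⟨_, rfl⟩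
      rw [hp1, hr1, hs1, ht1]
      have a1 : x.2.1.re = p + r := by omega
      have a2 : x.2.2.re = p - r := by omega
      have a3 : x.2.1.im = s + t := by omega
      have a4 : x.2.2.im = s - t := by omega
      rw [a1, a2, a3, a4] at hx1
      have := hx1.1.1
      zify at this
      linarith [hx1.2.1, hx1.2.2]
    · intro x hx y hy h
      rw [Finset.mem_coe, Finset.mem_filter] at hx hy
      have hp := pS_par hx.1
      have hp' := pS_par hy.1
      have hx2 := hx.2
      have hy2 := hy.2
      have h0 := congrFun h 0
      have h1 := congrFun h 1
      have h2 := congrFun h 2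
      have h3 := congrFun h 3
      simp only [Matrix.cons_val] at h0 h1 h2 h3
      refine pS_inj hx.1 hy.1 ?_ ?_ ?_ ?_ <;> omega
  have e2 : ((pS m).filter (fun x => ¬ (x.2.1.re + x.2.2.re) % 2 = 0)).card ≤ (rS 4 m).card := by
    refine Finset.card_le_card_of_injOn (fun x => ![(x.2.1.re + x.2.2.im)/2, (x.2.1.re - x.2.2.im)/2, (x.2.1.im + x.2.2.re)/2, (x.2.1.im - x.2.2.re)/2]) ?_ ?_
    · intro x hx
      rw [Finset.mem_coe, Finset.mem_filter] at hx
      have hp := pS_par hx.1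
      have hx2 := hx.2
      have hx1 := mem_pS.1 hx.1
      rw [Finset.mem_coe, mem_rS]
      simp only [Fin.sum_univ_four, Matrix.cons_val]
      obtain ⟨p, hp1⟩ : ∃ p, (x.2.1.re + x.2.2.im)/2 = p := ⟨_, rfl⟩
      obtain ⟨r, hr1⟩ : ∃ p, (x.2.1.re - x.2.2.im)/2 = p := ⟨_, rfl⟩
      obtain ⟨s, hs1⟩ : ∃ p, (x.2.1.im + x.2.2.re)/2 = p := ⟨_, rfl⟩
      obtain ⟨t, ht1⟩ : ∃ p, (x.2.1.im - x.2.2.re)/2 = p := ⟨_, rfl⟩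
      rw [hp1, hr1, hs1, ht1]
      have a1 : x.2.1.re = p + r := by omega
      have a2 : x.2.2.im = p - r := by omega
      have a3 : x.2.1.im = s + t := by omega
      have a4 : x.2.2.re = s - t := by omega
      rw [a1, a2, a3, a4] at hx1
      have := hx1.1.1
      zify at this
      linarith [hx1.2.1, hx1.2.2]
    · intro x hx y hy h
      rw [Finset.mem_coe, Finset.mem_filter] at hx hy
      have hp := pS_par hx.1
      have hp' := pS_par hy.1
      have hx2 := hx.2
      have hy2 := hy.2
      have h0 := congrFun h 0
      have h1 := congrFun h 1
      have h2 := congrFun h 2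
      have h3 := congrFun h 3
      simp only [Matrix.cons_val] at h0 h1 h2 h3
      refine pS_inj hx.1 hy.1 ?_ ?_ ?_ ?_ <;> omega
  omega

theorem rS4 {n : ℕ} (hn : n % 4 ≠ 0) : 8 * n ≤ (rS 4 n).card := by
  rcases Nat.mod_two_eq_zero_or_one n with h | h
  · obtain ⟨m, rfl⟩ : ∃ m, n = 2 * m := ⟨n / 2, by omega⟩
    have := rS4_two (m := m) (by omega)
    omega
  · exact rS4_odd h

theorem rS5 (N : ℕ) : 4 * N * Nat.sqrt (N / 8) ≤ (rS 5 N).card := by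
  have hs : Nat.sqrt (N/8) * Nat.sqrt (N/8) ≤ N / 8 := Nat.sqrt_le _
  set s := Nat.sqrt (N/8)
  have hs' : s * s * 8 ≤ N := (Nat.le_div_iff_mul_le (by norm_num)).1 hs
  have key : ∀ x : ℕ → ℕ, Function.Injective x → (∀ i < s, x i < 2 * s) → (∀ i, (N - x i ^ 2) % 4 ≠ 0 ∨ N < x i ^ 2) →
      4 * N * s ≤ (rS 5 N).card := by
    intro x hx h1 h2
    have h3 : ∀ i < s, 2 * x i ^ 2 ≤ N := by
      intro i hi
      have := h1 i hi
      nlinarith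
    refine le_trans ?_ (rS_succ 4 N s x hx (fun i hi => by have := h3 i hi; omega))
    calc 4 * N * s = ∑ i ∈ Finset.range s, 4 * N := by simp [mul_comm]
      _ ≤ _ := by
        refine Finset.sum_le_sum fun i hi => ?_
        have hi := Finset.mem_range.1 hi
        have h4 := h3 i hi
        refine le_trans ?_ (rS4 ((h2 i).resolve_right (by omega)))
        omega
  by_cases h : N % 4 = 0
  · refine key (fun i => 2 * i + 1) (fun a b h => by simpa using h) (fun i hi => by omega) (fun i => ?_)
    have : (2 * i + 1)^2 = 4 * (i * i + i) + 1 := by ring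
    simp only [this]
    omega
  · refine key (fun i => 2 * i) (fun a b h => by simpa using h) (fun i hi => by omega) (fun i => ?_)
    have : (2 * i)^2 = 4 * (i * i) := by ring
    simp only [this]
    omega

theorem sqrt_lb {N a : ℕ} (ha : 0 < a) (h : a ≤ N) : √(N:ℝ) ≤ 2 * √(a:ℝ) * Nat.sqrt (N / a) := by
  have h1 : 1 ≤ Nat.sqrt (N/a) := by
    rw [Nat.le_sqrt]; exact (Nat.one_le_div_iff ha).2 h
  have h2 : N / a < (Nat.sqrt (N/a) + 1) * (Nat.sqrt (N/a) + 1) := Nat.lt_succ_sqrt _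
  have h3 : N < (Nat.sqrt (N/a) + 1) * (Nat.sqrt (N/a) + 1) * a := (Nat.div_lt_iff_lt_mul ha).1 h2
  have h4 : N ≤ (2 * Nat.sqrt (N/a))^2 * a := by nlinarith
  have h5 : (N:ℝ) ≤ (2 * Nat.sqrt (N/a))^2 * a := by exact_mod_cast h4
  calc √(N:ℝ) ≤ √((2 * Nat.sqrt (N/a))^2 * a) := Real.sqrt_le_sqrt h5
    _ = _ := by
      rw [Real.sqrt_mul (by positivity), Real.sqrt_sq (by positivity)]; ring

theorem rS_lb (d : ℕ) : ∃ c : ℝ, 0 < c ∧ ∃ N₀ : ℕ, N₀ ≤ 8 * 2^d ∧ ∀ N : ℕ, N₀ ≤ N → c * √(N:ℝ) ^ (d+3) ≤ (rS (d+5) N).card := by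
  induction d with
  | zero =>
    refine ⟨2 / √8, by positivity, 8, by norm_num, fun N hN => ?_⟩
    have h := rS5 N
    have h2 := sqrt_lb (a := 8) (by norm_num) hN
    have h' : 4 * (N:ℝ) * Nat.sqrt (N / 8) ≤ (rS 5 N).card := by exact_mod_cast h
    have h3 : √(N:ℝ)^2 = N := Real.sq_sqrt (by positivity)
    push_cast at h2
    calc 2 / √8 * √(N:ℝ)^(0+3) = 2 / √8 * N * √(N:ℝ) := by rw [← h3]; simp only [Real.sqrt_sq (Real.sqrt_nonneg _)]; ring
      _ ≤ 2 / √8 * N * (2 * √8 * Nat.sqrt (N/8)) := by gcongr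
      _ = 4 * (N:ℝ) * Nat.sqrt (N / 8) := by field_simp; ring
      _ ≤ _ := h'
  | succ d ih =>
    obtain ⟨c, hc, N₀, hN0, ih⟩ := ih
    refine ⟨c * (1/√2)^(d+3) / (2 * √2), by positivity, max 2 (2 * N₀), ?_, fun N hN => ?_⟩
    · rw [pow_succ]; have : 1 ≤ 2^d := Nat.one_le_two_pow
      omega
    have hN2 : 2 ≤ N := le_trans (le_max_left _ _) hN
    have hN3 : 2 * N₀ ≤ N := le_trans (le_max_right _ _) hN
    have h2 := sqrt_lb (a := 2) (by norm_num) hN2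
    have hs : Nat.sqrt (N/2) * Nat.sqrt (N/2) ≤ N / 2 := Nat.sqrt_le _
    set s := Nat.sqrt (N/2)
    have hb : ∀ i < s, i ^ 2 ≤ N / 2 := fun i hi => by nlinarith
    have h3 := rS_succ (d+5) N s id Function.injective_id (fun i hi => by have := hb i hi; simp only [id]; omega)
    have h3' : ∑ i ∈ Finset.range s, ((rS (d+5) (N - id i ^ 2)).card : ℝ) ≤ (rS (d+5+1) N).card := by exact_mod_cast h3
    refine le_trans ?_ h3'
    have h4 : ∀ i ∈ Finset.range s, c * ((1/√2) * √(N:ℝ))^(d+3) ≤ ((rS (d+5) (N - id i ^ 2)).card : ℝ) := by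
      intro i hi
      have hi := hb i (Finset.mem_range.1 hi)
      refine le_trans ?_ (ih (N - id i ^2) (by simp only [id]; omega))
      gcongr
      rw [one_div, inv_mul_eq_div, ← Real.sqrt_div (by positivity)]
      apply Real.sqrt_le_sqrt
      have : N ≤ 2 * (N - id i ^ 2) := by simp only [id]; omega
      have : (N:ℝ) ≤ 2 * ((N - id i ^ 2 : ℕ):ℝ) := by exact_mod_cast this
      linarith
    calc c * (1/√2)^(d+3) / (2 * √2) * √(N:ℝ)^(d+1+3) = c * ((1/√2) * √(N:ℝ))^(d+3) * (√(N:ℝ) / (2 * √2)) := by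
          rw [mul_pow]; ring
      _ ≤ c * ((1/√2) * √(N:ℝ))^(d+3) * s := by
          gcongr
          rw [div_le_iff₀ (by positivity)]; push_cast at h2; linarith
      _ = ∑ i ∈ Finset.range s, c * ((1/√2) * √(N:ℝ))^(d+3) := by simp; ring
      _ ≤ _ := Finset.sum_le_sum h4

theorem rS_pos (d N : ℕ) : 1 ≤ (rS (d+4) N).card := by
  induction d with
  | zero =>
    obtain ⟨a, b, c, e, h⟩ := Nat.sum_four_squares N
    refine Finset.card_pos.2 ⟨![(a:ℤ), b, c, e], ?_⟩
    rw [mem_rS]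
    change ∑ i : Fin 4, (![(a:ℤ), b, c, e] i)^2 = (N:ℤ)
    simp only [Fin.sum_univ_four, Matrix.cons_val]
    exact_mod_cast h
  | succ d ih =>
    have := rS_succ (d+4) N 1 id Function.injective_id (fun i hi => by obtain rfl : i = 0 := by omega
                                                                       simp)
    simp at this
    exact ih.trans this

theorem sph_eq (d N : ℕ) (lam : ℝ) (h : (N:ℝ) = lam^2) : sph d lam = (rS d N : Set (Fin d → ℤ)) := by
  ext m
  rw [Finset.mem_coe, mem_rS, sph, Set.mem_ofPred_eq, nsq, ← h]
  constructor <;> intro h <;> exact_mod_cast h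

theorem Nlam_lb (d : ℕ) (hd : 5 ≤ d) : ∃ c : ℝ, 0 < c ∧ ∀ (lam : ℝ) (N : ℕ), 0 < lam → (N:ℝ) = lam^2 →
    c * lam^(d-2) ≤ Nlam d lam := by
  obtain ⟨e, rfl⟩ : ∃ e, d = e + 5 := ⟨d - 5, by omega⟩
  obtain ⟨c, hc, N₀, -, h⟩ := rS_lb e
  refine ⟨min c ((√(N₀+1:ℝ)^(e+3))⁻¹), by positivity, fun lam N hl hN => ?_⟩
  have h1 : lam = √(N:ℝ) := by rw [hN, Real.sqrt_sq hl.le]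
  have h2 : Nlam (e+5) lam = (rS (e+5) N).card := by
    rw [Nlam, sph_eq _ N _ hN]; simp
  rw [h2, h1, show e + 5 - 2 = e + 3 by omega]
  by_cases hN0 : N₀ ≤ N
  · refine le_trans ?_ (h N hN0)
    gcongr
    exact min_le_left _ _
  · have h3 := rS_pos (e+1) N
    have h4 : (1:ℝ) ≤ (rS (e+5) N).card := by exact_mod_cast h3
    refine le_trans ?_ h4
    have h5 : √(N:ℝ)^(e+3) ≤ √(N₀+1:ℝ)^(e+3) := by
      gcongr
      have : (N:ℝ) ≤ N₀ := by exact_mod_cast (by omega : N ≤ N₀)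
      linarith
    calc _ ≤ (√(N₀+1:ℝ)^(e+3))⁻¹ * √(N₀+1:ℝ)^(e+3) := by
          gcongr
          exact min_le_right _ _
      _ = 1 := inv_mul_cancel₀ (by positivity)

section pars
local instance instMS1 : MeasureTheory.MeasureSpace UnitAddCircle := ⟨AddCircle.haarAddCircle⟩

local instance instHaar1 : MeasureTheory.Measure.IsAddHaarMeasure (MeasureTheory.volume : MeasureTheory.Measure UnitAddCircle) :=
  inferInstanceAs (MeasureTheory.Measure.IsAddHaarMeasure AddCircle.haarAddCircle)

local instance instProb1 : MeasureTheory.IsProbabilityMeasure (MeasureTheory.volume : MeasureTheory.Measure UnitAddCircle) :=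
  inferInstanceAs (MeasureTheory.IsProbabilityMeasure AddCircle.haarAddCircle)

open UnitAddTorus MeasureTheory in
theorem parseval_aux {d : ℕ} : ∃ μ : Measure (UnitAddTorus (Fin d)), ∀ a : (Fin d → ℤ) → ℂ, Summable (fun n => ‖a n‖) →
    ∑' n, ‖a n‖ₑ ^ 2 = ∫⁻ t, ‖∑' n, a n * mFourier n t‖ₑ ^ 2 ∂μ := by
  refine ⟨volume, fun a ha => ?_⟩
  have h1 : Summable (fun n => a n • mFourier n) := by
    refine Summable.of_norm ?_
    simpa [norm_smul, mFourier_norm] using ha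
  obtain ⟨F, hF⟩ := h1
  have hFt : ∀ t, ∑' n, a n * mFourier n t = F t := by
    intro t
    have := (ContinuousMap.evalCLM ℂ t).hasSum hF
    simpa using this.tsum_eq
  have h2 : HasSum (fun n => a n • mFourierLp 2 n) (ContinuousMap.toLp (E := ℂ) 2 volume ℂ F) := by
    have := (ContinuousMap.toLp (E := ℂ) 2 (volume : Measure (UnitAddTorus (Fin d))) ℂ).hasSum hF
    simpa using this
  have h3 : ∀ n, mFourierCoeff (ContinuousMap.toLp (E := ℂ) 2 (volume : Measure (UnitAddTorus (Fin d))) ℂ F) n = a n := by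
    intro n
    rw [← mFourierBasis_repr, HilbertBasis.repr_apply_apply, coe_mFourierBasis]
    have h4 := (innerSL ℂ (mFourierLp (d := Fin d) 2 n)).hasSum h2
    simp only [innerSL_apply_apply] at h4
    have h5 : HasSum (fun m => inner ℂ (mFourierLp (d := Fin d) 2 n) (a m • mFourierLp 2 m)) (a n) := by
      have : ∀ m, inner ℂ (mFourierLp (d := Fin d) 2 n) (a m • mFourierLp 2 m) = if m = n then a n else 0 := by
        intro m
        rw [inner_smul_right, orthonormal_iff_ite.1 orthonormal_mFourier]
        by_cases h : m = n
        · subst h; simp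
        · simp [h, Ne.symm h]
      simp only [this]
      exact hasSum_ite_eq n (a n)
    exact h4.unique h5
  have h6 := hasSum_sq_mFourierCoeff (ContinuousMap.toLp (E := ℂ) 2 (volume : Measure (UnitAddTorus (Fin d))) ℂ F)
  simp only [h3] at h6
  have h7 : ∫ t, ‖(ContinuousMap.toLp (E := ℂ) 2 (volume : Measure (UnitAddTorus (Fin d))) ℂ F) t‖^2 = ∫ t, ‖F t‖^2 := by
    refine integral_congr_ae ?_
    filter_upwards [ContinuousMap.coeFn_toLp (𝕜 := ℂ) (p := 2) (volume : Measure (UnitAddTorus (Fin d))) F] with t ht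
    rw [ht]
  rw [h7] at h6
  simp only [hFt]
  have h8 : ∀ z : ℂ, ‖z‖ₑ^2 = ENNReal.ofReal (‖z‖^2) := by
    intro z; rw [ENNReal.ofReal_pow (norm_nonneg _), ofReal_norm]
  simp only [h8]
  rw [← ofReal_integral_eq_lintegral_ofReal, ← h6.tsum_eq, ENNReal.ofReal_tsum_of_nonneg (fun n => by positivity) h6.summable]
  · exact (Continuous.integrable_of_hasCompactSupport (by fun_prop) (HasCompactSupport.of_compactSpace _))
  · exact Filter.Eventually.of_forall (fun t => by positivity)
end pars

/-- `e(x) = exp(2πix)` -/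
def ec (x : ℝ) : ℂ := Complex.exp (2 * π * Complex.I * x)

theorem ec_add (x y : ℝ) : ec (x + y) = ec x * ec y := by
  rw [ec, ec, ec, ← Complex.exp_add]; congr 1; push_cast; ring

theorem ec_eq (x : ℝ) : ec x = Complex.exp ((2 * π * x : ℝ) * Complex.I) := by
  rw [ec]; congr 1; push_cast; ring

theorem norm_ec (x : ℝ) : ‖ec x‖ = 1 := by rw [ec_eq, Complex.norm_exp_ofReal_mul_I]

theorem ec_sum {ι : Type*} (s : Finset ι) (f : ι → ℝ) : ec (∑ i ∈ s, f i) = ∏ i ∈ s, ec (f i) := by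
  simp only [ec, ← Complex.exp_sum]
  congr 1; push_cast; rw [Finset.mul_sum]

theorem ec_int (n : ℤ) : ec n = 1 := by
  rw [ec, Complex.exp_eq_one_iff]; exact ⟨n, by push_cast; ring⟩

theorem ec_zero : ec 0 = 1 := by simp [ec]

/-- dot product -/
def dotp {d : ℕ} (m : Fin d → ℤ) (ξ : Fin d → ℝ) : ℝ := ∑ i, (m i : ℝ) * ξ i

theorem dotp_add {d : ℕ} (m n : Fin d → ℤ) (ξ : Fin d → ℝ) : dotp (m + n) ξ = dotp m ξ + dotp n ξ := by
  simp [dotp, add_mul, Finset.sum_add_distrib]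

/-- Fourier transform on `ℤ^d` -/
def ftZ {d : ℕ} (K : (Fin d → ℤ) → ℂ) (ξ : Fin d → ℝ) : ℂ := ∑' m, K m * ec (dotp m ξ)

/-- convolution, complex -/
def cv {d : ℕ} (f K : (Fin d → ℤ) → ℂ) (n : Fin d → ℤ) : ℂ := ∑' m, f (n - m) * K m

theorem mFourier_coe {d : ℕ} (n : Fin d → ℤ) (ξ : Fin d → ℝ) :
    UnitAddTorus.mFourier n (fun i => (ξ i : UnitAddCircle)) = ec (dotp n ξ) := by
  simp only [UnitAddTorus.mFourier, ContinuousMap.coe_mk, dotp, ec_sum]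
  refine Finset.prod_congr rfl fun i _ => ?_
  rw [fourier_coe_apply, ec]
  congr 1; push_cast; ring

/-- pairing trick -/
def shE (d : ℕ) : (Fin d → ℤ) × (Fin d → ℤ) ≃ (Fin d → ℤ) × (Fin d → ℤ) where
  toFun p := (p.1 - p.2, p.2)
  invFun p := (p.1 + p.2, p.2)
  left_inv p := by simp
  right_inv p := by simp

theorem cv_prod_summable {d : ℕ} {a K : (Fin d → ℤ) → ℂ} (ha : Summable fun n => ‖a n‖) (hK : Summable fun n => ‖K n‖) :
    Summable (fun p : (Fin d → ℤ) × (Fin d → ℤ) => ‖a (p.1 - p.2) * K p.2‖) := by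
  have h := ha.mul_of_nonneg hK (fun _ => norm_nonneg _) (fun _ => norm_nonneg _)
  have := (shE d).summable_iff.2 h
  refine this.congr fun p => ?_
  simp [shE]

theorem cv_summable {d : ℕ} {a K : (Fin d → ℤ) → ℂ} (ha : Summable fun n => ‖a n‖) (hK : Summable fun n => ‖K n‖) :
    Summable (fun n => ‖cv a K n‖) := by
  have h := cv_prod_summable ha hK
  refine Summable.of_nonneg_of_le (fun _ => norm_nonneg _) (fun n => ?_) h.prod
  exact norm_tsum_le_tsum_norm (h.prod_factor n)

theorem summable_ec {d : ℕ} {a : (Fin d → ℤ) → ℂ} (ha : Summable fun n => ‖a n‖) (ξ) :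
    Summable (fun n => ‖a n * ec (dotp n ξ)‖) := by
  simpa [norm_ec] using ha

theorem ftZ_cv {d : ℕ} {a K : (Fin d → ℤ) → ℂ} (ha : Summable fun n => ‖a n‖) (hK : Summable fun n => ‖K n‖) (ξ) :
    ftZ (cv a K) ξ = ftZ a ξ * ftZ K ξ := by
  have h := cv_prod_summable ha hK
  rw [ftZ, ftZ, ftZ, tsum_mul_tsum_of_summable_norm (summable_ec ha ξ) (summable_ec hK ξ)]
  have h2 : Summable (fun p : (Fin d → ℤ) × (Fin d → ℤ) => a (p.1 - p.2) * K p.2 * ec (dotp p.1 ξ)) := by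
    refine Summable.of_norm ?_
    simpa [norm_ec] using h
  rw [← (shE d).tsum_eq (fun z : (Fin d → ℤ) × (Fin d → ℤ) => a z.1 * ec (dotp z.1 ξ) * (K z.2 * ec (dotp z.2 ξ)))]
  have e : ∀ p : (Fin d → ℤ) × (Fin d → ℤ), a (shE d p).1 * ec (dotp (shE d p).1 ξ) * (K (shE d p).2 * ec (dotp (shE d p).2 ξ)) =
      a (p.1 - p.2) * K p.2 * ec (dotp p.1 ξ) := by
    intro p
    simp only [shE, Equiv.coe_fn_mk]
    have : dotp p.1 ξ = dotp (p.1 - p.2) ξ + dotp p.2 ξ := by rw [← dotp_add]; simp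
    rw [this, ec_add]; ring
  simp only [e]
  rw [h2.tsum_prod]
  refine tsum_congr fun n => ?_
  rw [cv, ← tsum_mul_right]

theorem cv_pt_summable {d : ℕ} {f K : (Fin d → ℤ) → ℂ} {M : ℝ} (hf : ∀ n, ‖f n‖ ≤ M) (hK : Summable fun n => ‖K n‖) (n) :
    Summable (fun m => ‖f (n - m) * K m‖) := by
  refine Summable.of_nonneg_of_le (fun _ => norm_nonneg _) (fun m => ?_) (hK.mul_left M)
  rw [norm_mul]; gcongr; exact hf _

theorem cv_bdd {d : ℕ} {f K : (Fin d → ℤ) → ℂ} {M : ℝ} (hf : ∀ n, ‖f n‖ ≤ M) (hK : Summable fun n => ‖K n‖) (n) :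
    ‖cv f K n‖ ≤ M * ∑' m, ‖K m‖ := by
  have h := cv_pt_summable hf hK n
  refine (norm_tsum_le_tsum_norm h).trans ?_
  rw [← tsum_mul_left]
  refine h.tsum_le_tsum (fun m => ?_) (hK.mul_left M)
  rw [norm_mul]; gcongr; exact hf _

theorem cv_assoc {d : ℕ} {f K L : (Fin d → ℤ) → ℂ} {M : ℝ} (hf : ∀ n, ‖f n‖ ≤ M) (hK : Summable fun n => ‖K n‖)
    (hL : Summable fun n => ‖L n‖) (n) : cv (cv f K) L n = cv f (cv K L) n := by
  have h := cv_prod_summable hK hL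
  have hs : Summable (fun p : (Fin d → ℤ) × (Fin d → ℤ) => f (n - p.1) * (K (p.1 - p.2) * L p.2)) := by
    refine Summable.of_norm (Summable.of_nonneg_of_le (fun _ => norm_nonneg _) (fun p => ?_) (h.mul_left M))
    rw [norm_mul]; gcongr; exact hf _
  have e1 : cv f (cv K L) n = ∑' p : (Fin d → ℤ) × (Fin d → ℤ), f (n - p.1) * (K (p.1 - p.2) * L p.2) := by
    rw [hs.tsum_prod]
    simp only [cv, tsum_mul_left]
  have hs' := (shE d).symm.summable_iff.2 hs
  rw [e1, ← (shE d).symm.tsum_eq, ← (Equiv.prodComm _ _).tsum_eq]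
  have hs'' := (Equiv.prodComm (Fin d → ℤ) (Fin d → ℤ)).summable_iff.2 hs'
  refine Eq.trans ?_ (Summable.tsum_prod ?_).symm
  · simp only [cv, shE, Equiv.coe_fn_symm_mk, Equiv.prodComm_apply, Prod.swap]
    refine tsum_congr fun m => ?_
    rw [← tsum_mul_right]
    refine tsum_congr fun l => ?_
    simp only [add_sub_cancel_right]
    rw [show n - m - l = n - (l + m) by abel]; ring
  · exact hs''

/-- Plancherel square function, `ℓ¹` data. -/
theorem planch1 {d : ℕ} {ι : Type*} (s : Finset ι) (K : ι → (Fin d → ℤ) → ℂ) (hK : ∀ k ∈ s, Summable fun n => ‖K k n‖)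
    (B : ℝ≥0∞) (hB : ∀ ξ, ∑ k ∈ s, ‖ftZ (K k) ξ‖ₑ ^ 2 ≤ B) (a : (Fin d → ℤ) → ℂ) (ha : Summable fun n => ‖a n‖) :
    ∑ k ∈ s, ∑' n, ‖cv a (K k) n‖ₑ ^ 2 ≤ B * ∑' n, ‖a n‖ₑ ^ 2 := by
  obtain ⟨μ, hμ⟩ := parseval_aux (d := d)
  have ht : ∀ (b : (Fin d → ℤ) → ℂ) (t : UnitAddTorus (Fin d)), ∃ ξ : Fin d → ℝ, ∀ b : (Fin d → ℤ) → ℂ, ∑' n, b n * UnitAddTorus.mFourier n t = ftZ b ξ := by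
    intro b t
    have : ∃ ξ : Fin d → ℝ, t = fun i => (ξ i : UnitAddCircle) := by
      choose ξ hξ using fun i => QuotientAddGroup.mk_surjective (t i)
      exact ⟨ξ, funext fun i => (hξ i).symm⟩
    obtain ⟨ξ, rfl⟩ := this
    exact ⟨ξ, fun b => by simp only [mFourier_coe, ftZ]⟩
  have hm : ∀ b : (Fin d → ℤ) → ℂ, (Summable fun n => ‖b n‖) → Measurable (fun t : UnitAddTorus (Fin d) => ‖∑' n, b n * UnitAddTorus.mFourier n t‖ₑ ^ 2) := by
    intro b hb
    have : Continuous (fun t : UnitAddTorus (Fin d) => ∑' n, b n * UnitAddTorus.mFourier n t) := by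
      refine continuous_tsum (fun n => by fun_prop) hb (fun n t => ?_)
      rw [norm_mul]
      have := (UnitAddTorus.mFourier n).norm_coe_le_norm t
      rw [UnitAddTorus.mFourier_norm] at this
      nlinarith [norm_nonneg (b n)]
    have h2 : Continuous (fun t : UnitAddTorus (Fin d) => ‖∑' n, b n * UnitAddTorus.mFourier n t‖ₑ ^ 2) := by fun_prop
    exact h2.measurable
  calc ∑ k ∈ s, ∑' n, ‖cv a (K k) n‖ₑ ^ 2 = ∑ k ∈ s, ∫⁻ t, ‖∑' n, cv a (K k) n * UnitAddTorus.mFourier n t‖ₑ ^ 2 ∂μ :=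
        Finset.sum_congr rfl fun k hk => hμ _ (cv_summable ha (hK k hk))
    _ = ∫⁻ t, ∑ k ∈ s, ‖∑' n, cv a (K k) n * UnitAddTorus.mFourier n t‖ₑ ^ 2 ∂μ :=
        (MeasureTheory.lintegral_finsetSum' _ (fun k hk => (hm _ (cv_summable ha (hK k hk))).aemeasurable)).symm
    _ ≤ ∫⁻ t, B * ‖∑' n, a n * UnitAddTorus.mFourier n t‖ₑ ^ 2 ∂μ := by
        refine MeasureTheory.lintegral_mono fun t => ?_
        obtain ⟨ξ, hξ⟩ := ht a t
        simp only [hξ]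
        calc ∑ k ∈ s, ‖ftZ (cv a (K k)) ξ‖ₑ ^ 2 = (∑ k ∈ s, ‖ftZ (K k) ξ‖ₑ ^ 2) * ‖ftZ a ξ‖ₑ ^ 2 := by
              rw [Finset.sum_mul]
              refine Finset.sum_congr rfl fun k hk => ?_
              rw [ftZ_cv ha (hK k hk), enorm_mul]; ring
          _ ≤ _ := by gcongr; exact hB ξ
    _ = B * ∑' n, ‖a n‖ₑ ^ 2 := by rw [MeasureTheory.lintegral_const_mul _ (hm a ha), hμ a ha]

theorem planch {d : ℕ} {ι : Type*} (K : ι → (Fin d → ℤ) → ℂ) (hK : ∀ k, Summable fun n => ‖K k n‖)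
    (B : ℝ≥0∞) (hB : ∀ ξ, ∀ s : Finset ι, ∑ k ∈ s, ‖ftZ (K k) ξ‖ₑ ^ 2 ≤ B) (a : (Fin d → ℤ) → ℂ) {M : ℝ} (ha : ∀ n, ‖a n‖ ≤ M) :
    ∑' n, ∑' k, ‖cv a (K k) n‖ₑ ^ 2 ≤ B * ∑' n, ‖a n‖ₑ ^ 2 := by
  classical
  rw [ENNReal.tsum_comm, ENNReal.tsum_eq_iSup_sum]
  refine iSup_le fun s => ?_
  have e : ∑ k ∈ s, ∑' n, ‖cv a (K k) n‖ₑ ^ 2 = ∑' n, ∑ k ∈ s, ‖cv a (K k) n‖ₑ ^ 2 :=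
    (Summable.tsum_finsetSum (fun _ _ => ENNReal.summable)).symm
  rw [e, ENNReal.tsum_eq_iSup_sum]
  refine iSup_le fun F => ?_
  -- truncate
  have key : ∀ k n, Filter.Tendsto (fun S : Finset (Fin d → ℤ) => cv (fun m => if m ∈ S then a m else 0) (K k) n) Filter.atTop (nhds (cv a (K k) n)) := by
    intro k n
    refine tendsto_tsum_of_dominated_convergence (bound := fun m => M * ‖K k m‖) ((hK k).mul_left M) ?_ ?_
    · intro m
      refine tendsto_const_nhds.congr' ?_
      filter_upwards [Filter.eventually_ge_atTop {n - m}] with S hS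
      rw [if_pos (hS (by simp))]
    · refine Filter.Eventually.of_forall fun S m => ?_
      rw [norm_mul]
      gcongr
      dsimp only
      split_ifs
      · exact ha _
      · simpa using (norm_nonneg _).trans (ha 0)
  have lim : Filter.Tendsto (fun S : Finset (Fin d → ℤ) => ∑ n ∈ F, ∑ k ∈ s, ‖cv (fun m => if m ∈ S then a m else 0) (K k) n‖ₑ ^ 2) Filter.atTop
      (nhds (∑ n ∈ F, ∑ k ∈ s, ‖cv a (K k) n‖ₑ ^ 2)) := by
    refine tendsto_finsetSum _ fun n _ => tendsto_finsetSum _ fun k _ => ?_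
    exact ((ENNReal.continuous_pow 2).tendsto _).comp ((continuous_enorm.tendsto _).comp (key k n))
  refine le_of_tendsto' lim fun S => ?_
  have hfin : Summable (fun n => ‖(if n ∈ S then a n else 0 : ℂ)‖) := by
    refine summable_of_ne_finset_zero (s := S) fun n hn => ?_
    simp [hn]
  have h1 := planch1 s K (fun k _ => hK k) B (fun ξ => hB ξ s) (fun m => if m ∈ S then a m else 0) hfin
  have e2 : ∑ k ∈ s, ∑' n, ‖cv (fun m => if m ∈ S then a m else 0) (K k) n‖ₑ ^ 2 = ∑' n, ∑ k ∈ s, ‖cv (fun m => if m ∈ S then a m else 0) (K k) n‖ₑ ^ 2 :=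
    (Summable.tsum_finsetSum (fun _ _ => ENNReal.summable)).symm
  rw [e2] at h1
  refine (ENNReal.sum_le_tsum F).trans (h1.trans ?_)
  gcongr with n
  split_ifs
  · exact le_rfl
  · simp

theorem cs_w {X : Type*} [MeasurableSpace X] (μ : MeasureTheory.Measure X) (G B : X → ℝ≥0∞) (hG : Measurable G) (hB : Measurable B)
    (hBf : ∀ x, B x ≠ ∞) (h0 : ∀ x, B x = 0 → G x = 0) :
    (∫⁻ x, G x ∂μ) ^ 2 ≤ (∫⁻ x, B x ∂μ) * ∫⁻ x, G x ^ 2 * (B x)⁻¹ ∂μ := by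
  have hpq : (2:ℝ).HolderConjugate 2 := Real.HolderConjugate.two_two
  have h := ENNReal.lintegral_mul_le_Lp_mul_Lq μ hpq (f := fun x => B x ^ (1/2:ℝ)) (g := fun x => G x * (B x)⁻¹ ^ (1/2:ℝ))
    (hB.pow_const _).aemeasurable (hG.mul (hB.inv.pow_const _)).aemeasurable
  have e1 : ∀ x, ((fun x => B x ^ (1/2:ℝ)) * (fun x => G x * (B x)⁻¹ ^ (1/2:ℝ))) x = G x := by
    intro x
    simp only [Pi.mul_apply]
    by_cases hb : B x = 0
    · rw [h0 x hb]; simp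
    · rw [mul_left_comm, ← ENNReal.mul_rpow_of_nonneg _ _ (by norm_num), ENNReal.mul_inv_cancel hb (hBf x)]; simp
  have e2 : ∀ x, (B x ^ (1/2:ℝ)) ^ (2:ℝ) = B x := by
    intro x; rw [← ENNReal.rpow_mul]; simp
  have e3 : ∀ x, (G x * (B x)⁻¹ ^ (1/2:ℝ)) ^ (2:ℝ) = G x ^ 2 * (B x)⁻¹ := by
    intro x; rw [ENNReal.mul_rpow_of_nonneg _ _ (by norm_num), ← ENNReal.rpow_mul]; simp
  simp only [e1, e2, e3] at h
  calc (∫⁻ x, G x ∂μ) ^ 2 ≤ ((∫⁻ x, B x ∂μ)^(1/2:ℝ) * (∫⁻ x, G x ^ 2 * (B x)⁻¹ ∂μ)^(1/2:ℝ))^2 := by gcongr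
    _ = _ := by
      rw [mul_pow, ← ENNReal.rpow_natCast, ← ENNReal.rpow_natCast, ← ENNReal.rpow_mul, ← ENNReal.rpow_mul]; simp

theorem mink {X N : Type*} [MeasurableSpace X] [Countable N] (μ : MeasureTheory.Measure X) (G : X → N → ℝ≥0∞) (B : X → ℝ≥0∞)
    (hG : ∀ n, Measurable fun x => G x n) (hB : Measurable B)
    (hBf : ∀ x, B x ≠ ∞) (A : ℝ≥0∞) (hA : A ≠ ∞) (h : ∀ x, ∑' n, G x n ^ 2 ≤ B x ^ 2 * A) :
    ∑' n, (∫⁻ x, G x n ∂μ) ^ 2 ≤ (∫⁻ x, B x ∂μ) ^ 2 * A := by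
  have h0 : ∀ n x, B x = 0 → G x n = 0 := by
    intro n x hx
    have := h x
    rw [hx] at this
    simp at this
    exact this n
  calc ∑' n, (∫⁻ x, G x n ∂μ) ^ 2 ≤ ∑' n, (∫⁻ x, B x ∂μ) * ∫⁻ x, G x n ^ 2 * (B x)⁻¹ ∂μ :=
        ENNReal.tsum_le_tsum fun n => cs_w μ _ B (hG n) hB hBf (h0 n)
    _ = (∫⁻ x, B x ∂μ) * ∫⁻ x, ∑' n, G x n ^ 2 * (B x)⁻¹ ∂μ := by
        rw [ENNReal.tsum_mul_left, MeasureTheory.lintegral_tsum (f := fun n x => G x n ^ 2 * (B x)⁻¹) (fun n => (((hG n).pow_const 2).mul hB.inv).aemeasurable)]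
    _ ≤ (∫⁻ x, B x ∂μ) * ∫⁻ x, B x * A ∂μ := by
        gcongr with x
        rw [ENNReal.tsum_mul_right]
        by_cases hx : B x = 0
        · simp [h0 _ x hx]
        calc (∑' n, G x n ^ 2) * (B x)⁻¹ ≤ B x ^ 2 * A * (B x)⁻¹ := by gcongr; exact h x
          _ = B x * A * (B x * (B x)⁻¹) := by ring
          _ = B x * A := by rw [ENNReal.mul_inv_cancel hx (hBf x), mul_one]
    _ = _ := by rw [MeasureTheory.lintegral_mul_const' _ _ hA]; ring

theorem mink_tsum {X N : Type*} [Countable N] (G : X → N → ℝ≥0∞) (B : X → ℝ≥0∞)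
    (hBf : ∀ x, B x ≠ ∞) (A : ℝ≥0∞) (hA : A ≠ ∞) (h : ∀ x, ∑' n, G x n ^ 2 ≤ B x ^ 2 * A) :
    ∑' n, (∑' x, G x n) ^ 2 ≤ (∑' x, B x) ^ 2 * A := by
  let _ : MeasurableSpace X := ⊤
  have := mink MeasureTheory.Measure.count G B (fun n => measurable_from_top) measurable_from_top hBf A hA h
  simpa [MeasureTheory.lintegral_count] using this

theorem tsum_pi_prod {d : ℕ} (g : Fin d → ℤ → ℝ≥0∞) : ∑' m : Fin d → ℤ, ∏ i, g i (m i) = ∏ i, ∑' x, g i x := by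
  induction d with
  | zero => simp
  | succ d ih =>
    rw [← (Fin.consEquiv (fun _ => ℤ)).tsum_eq, ENNReal.tsum_prod']
    simp only [Fin.consEquiv_apply, Fin.prod_univ_succ, Fin.cons_zero, Fin.cons_succ, ENNReal.tsum_mul_left, ENNReal.tsum_mul_right]
    rw [ih (fun i => g i.succ)]

theorem tsum_pi_prodC {d : ℕ} (g : Fin d → ℤ → ℂ) (hg : ∀ i, Summable (fun x => ‖g i x‖)) :
    Summable (fun m : Fin d → ℤ => ‖∏ i, g i (m i)‖) ∧ ∑' m : Fin d → ℤ, ∏ i, g i (m i) = ∏ i, ∑' x, g i x := by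
  induction d with
  | zero => exact ⟨by simpa using (Summable.of_finite), by simp⟩
  | succ d ih =>
    obtain ⟨h1, h2⟩ := ih (fun i => g i.succ) (fun i => hg _)
    have e : ∀ p : ℤ × (Fin d → ℤ), ∏ i, g i (Fin.consEquiv (fun _ => ℤ) p i) = g 0 p.1 * ∏ i : Fin d, g i.succ (p.2 i) := by
      intro p
      simp only [Fin.consEquiv_apply, Fin.prod_univ_succ, Fin.cons_zero, Fin.cons_succ]
    constructor
    · rw [← (Fin.consEquiv (fun _ => ℤ)).summable_iff]
      refine ((hg 0).mul_of_nonneg h1 (fun _ => norm_nonneg _) (fun _ => norm_nonneg _)).congr fun p => ?_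
      simp only [Function.comp]
      rw [e, norm_mul]
    · rw [← (Fin.consEquiv (fun _ => ℤ)).tsum_eq]
      simp only [e]
      rw [Fin.prod_univ_succ, ← h2, tsum_mul_tsum_of_summable_norm (hg 0) h1]

theorem cs_tsum {N : Type*} (x y : N → ℝ≥0∞) : (∑' n, x n * y n) ^ 2 ≤ (∑' n, x n ^ 2) * ∑' n, y n ^ 2 := by
  have h : ∑' n, x n * y n ≤ (∑' n, x n ^ (2:ℝ)) ^ (1/2:ℝ) * (∑' n, y n ^ (2:ℝ)) ^ (1/2:ℝ) := by
    rw [ENNReal.tsum_eq_iSup_sum]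
    refine iSup_le fun s => (ENNReal.inner_le_Lp_mul_Lq s x y Real.HolderConjugate.two_two).trans ?_
    gcongr <;> exact ENNReal.sum_le_tsum s
  calc _ ≤ ((∑' n, x n ^ (2:ℝ)) ^ (1/2:ℝ) * (∑' n, y n ^ (2:ℝ)) ^ (1/2:ℝ))^2 := by gcongr
    _ = _ := by
      rw [mul_pow, ← ENNReal.rpow_natCast, ← ENNReal.rpow_natCast, ← ENNReal.rpow_mul, ← ENNReal.rpow_mul]; simp

theorem le_of_sq_le' {Y Z : ℝ≥0∞} (hY : Y ≠ ∞) (h : Y ^ 2 ≤ Z * Y) : Y ≤ Z := by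
  by_cases h0 : Y = 0
  · simp [h0]
  rw [pow_two] at h
  exact (ENNReal.mul_le_mul_iff_left h0 hY).1 h

theorem TTstar {N : Type*} (k : N → N → ℝ≥0∞) (C : ℝ≥0∞) (hC : C ≠ ∞) (hC0 : C ≠ 0) (hk : ∀ n m, k n m ≠ ∞)
    (h : ∀ n n', ∑' m, k n m * k n' m ≤ C * (k n n' + k n' n)) (g : N → ℝ≥0∞) :
    ∑' n, (∑' m, k n m * g m) ^ 2 ≤ (4 * C ^ 2) * ∑' m, g m ^ 2 := by
  by_cases hG : ∑' m, g m ^ 2 = ∞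
  · rw [hG, ENNReal.mul_top (by simp [hC0])]; exact le_top
  rw [ENNReal.tsum_eq_iSup_sum]
  refine iSup_le fun S => ?_
  set H : N → ℝ≥0∞ := fun n => ∑' m, k n m * g m with hH
  have hHf : ∀ n, H n ≠ ∞ := by
    intro n hn
    have h1 := cs_tsum (k n) g
    have h2 : (∑' m, k n m ^ 2) ≠ ∞ := by
      have h3 := h n n
      simp only [← pow_two] at h3
      exact ne_top_of_le_ne_top (ENNReal.mul_ne_top hC (by simp [hk])) h3
    have h4 : H n ^ 2 ≠ ∞ := ne_top_of_le_ne_top (ENNReal.mul_ne_top h2 hG) h1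
    rw [hn] at h4; simp at h4
  set A := ∑ n ∈ S, H n ^ 2 with hA
  have hAf : A ≠ ∞ := by
    rw [hA]; exact (ENNReal.sum_lt_top.2 fun n _ => ENNReal.pow_lt_top (hHf n).lt_top).ne
  set T : N → ℝ≥0∞ := fun m => ∑ n ∈ S, H n * k n m with hT
  set Y := ∑' m, T m ^ 2 with hY
  have e1 : A = ∑' m, g m * T m := by
    simp only [hA, hT, Finset.mul_sum]
    rw [Summable.tsum_finsetSum (fun _ _ => ENNReal.summable)]
    refine Finset.sum_congr rfl fun n _ => ?_
    rw [pow_two]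
    nth_rw 2 [hH]
    rw [← ENNReal.tsum_mul_left]
    exact tsum_congr fun m => by ring
  have e2 : Y = ∑ n ∈ S, ∑ n' ∈ S, H n * H n' * ∑' m, k n m * k n' m := by
    have : ∀ m, T m ^ 2 = ∑ n ∈ S, ∑ n' ∈ S, H n * H n' * (k n m * k n' m) := by
      intro m
      rw [pow_two, hT, Finset.sum_mul_sum]
      exact Finset.sum_congr rfl fun n _ => Finset.sum_congr rfl fun n' _ => by ring
    simp only [hY, this]
    rw [Summable.tsum_finsetSum (fun _ _ => ENNReal.summable)]
    refine Finset.sum_congr rfl fun n _ => ?_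
    rw [Summable.tsum_finsetSum (fun _ _ => ENNReal.summable)]
    exact Finset.sum_congr rfl fun n' _ => by rw [ENNReal.tsum_mul_left]
  have e3 : Y ≤ 2 * C * ∑ n ∈ S, H n * T n := by
    rw [e2]
    calc _ ≤ ∑ n ∈ S, ∑ n' ∈ S, H n * H n' * (C * (k n n' + k n' n)) := by
          gcongr with n _ n' _; exact h n n'
      _ = C * (∑ n ∈ S, ∑ n' ∈ S, H n * H n' * k n n') + C * (∑ n ∈ S, ∑ n' ∈ S, H n * H n' * k n' n) := by
          rw [Finset.mul_sum, Finset.mul_sum, ← Finset.sum_add_distrib]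
          refine Finset.sum_congr rfl fun n _ => ?_
          rw [Finset.mul_sum, Finset.mul_sum, ← Finset.sum_add_distrib]
          exact Finset.sum_congr rfl fun n' _ => by ring
      _ = C * (∑ n ∈ S, ∑ n' ∈ S, H n * H n' * k n' n) + C * (∑ n ∈ S, ∑ n' ∈ S, H n * H n' * k n' n) := by
          congr 2
          rw [Finset.sum_comm]
          exact Finset.sum_congr rfl fun n _ => Finset.sum_congr rfl fun n' _ => by ring
      _ = 2 * C * ∑ n ∈ S, H n * T n := by
          rw [← two_mul, ← mul_assoc]
          congr 1
          refine Finset.sum_congr rfl fun n _ => ?_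
          rw [hT, Finset.mul_sum]
          exact Finset.sum_congr rfl fun n' _ => by ring
  have e4 : (∑ n ∈ S, H n * T n) ^ 2 ≤ A * Y := by
    have h1 := cs_tsum (fun n : S => H n) (fun n : S => T n)
    rw [Finset.tsum_subtype S (fun n => H n * T n), Finset.tsum_subtype S (fun n => H n ^ 2), Finset.tsum_subtype S (fun n => T n ^ 2)] at h1
    refine h1.trans ?_
    gcongr
    exact ENNReal.sum_le_tsum S
  have hYf : Y ≠ ∞ := by
    rw [e2]
    refine (ENNReal.sum_lt_top.2 fun n _ => ENNReal.sum_lt_top.2 fun n' _ => ?_).ne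
    refine ENNReal.mul_lt_top (ENNReal.mul_lt_top (hHf n).lt_top (hHf n').lt_top) ?_
    exact lt_of_le_of_lt (h n n') (ENNReal.mul_lt_top hC.lt_top (ENNReal.add_lt_top.2 ⟨(hk _ _).lt_top, (hk _ _).lt_top⟩))
  have e5 : Y ≤ 4 * C ^ 2 * A := by
    refine le_of_sq_le' hYf ?_
    calc Y ^ 2 ≤ (2 * C * ∑ n ∈ S, H n * T n) ^ 2 := by gcongr
      _ = 4 * C ^ 2 * (∑ n ∈ S, H n * T n) ^ 2 := by ring
      _ ≤ 4 * C ^ 2 * (A * Y) := by gcongr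
      _ = _ := by ring
  refine le_of_sq_le' hAf ?_
  calc A ^ 2 ≤ (∑' m, g m ^ 2) * Y := by rw [e1]; exact cs_tsum g T
    _ ≤ (∑' m, g m ^ 2) * (4 * C ^ 2 * A) := by gcongr
    _ = _ := by ring

/-- one-dimensional majorant -/
def pk (a : ℝ) (u : ℤ) : ℝ := a / (a + |(u:ℝ)|) ^ 2

def pq (q : ℕ) (a : ℝ) (x : ℤ) : ℝ≥0∞ := if (q:ℤ) ∣ x then ENNReal.ofReal (pk a (x / q)) else 0

theorem pk_conv {a b : ℝ} (hb : 0 < b) (hab : b ≤ a) (w v : ℤ) : pk a w * pk b v ≤ 2 * pk a (w + v) * (pk b v + pk a w) := by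
  have ha : 0 < a := hb.trans_le hab
  have h1 : |((w + v : ℤ):ℝ)| ≤ |(w:ℝ)| + |(v:ℝ)| := by push_cast; exact abs_add_le _ _
  unfold pk
  set W := |(w:ℝ)|
  set V := |(v:ℝ)|
  set U := |((w + v : ℤ):ℝ)|
  have hW : 0 ≤ W := abs_nonneg _
  have hV : 0 ≤ V := abs_nonneg _
  have hU : 0 ≤ U := abs_nonneg _
  have h2 : (a + U)^2 ≤ 2 * ((a + W)^2 + V^2) := by nlinarith [sq_nonneg (a + W - V)]
  have h3 : b * V^2 ≤ a * (b + V)^2 := by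
    have : V ≤ b + V := by linarith
    gcongr
  have key : (a + U)^2 * b ≤ 2 * (a * (b + V)^2 + b * (a + W)^2) := by nlinarith
  rw [div_mul_div_comm, show 2 * (a / (a + U)^2) * (b / (b + V)^2 + a / (a + W)^2) = (a * (2 * (a * (b + V)^2 + b * (a + W)^2))) / ((a + U)^2 * ((a + W)^2 * (b + V)^2)) by
    field_simp; ring]
  rw [div_le_div_iff₀ (by positivity) (by positivity)]
  have h4 : 0 ≤ a * ((a + W)^2 * (b + V)^2) := by positivity
  nlinarith [mul_le_mul_of_nonneg_left key h4]

theorem pk_nonneg {a : ℝ} (ha : 0 < a) (u) : 0 ≤ pk a u := by unfold pk; positivity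

theorem pk_neg (a : ℝ) (u : ℤ) : pk a (-u) = pk a u := by simp [pk]

theorem pq_neg (q : ℕ) (a : ℝ) (x : ℤ) : pq q a (-x) = pq q a x := by
  unfold pq
  by_cases h : (q:ℤ) ∣ x
  · rw [if_pos h, if_pos (by simpa using h), Int.neg_ediv_of_dvd h, pk_neg]
  · rw [if_neg h, if_neg (by simpa using h)]

theorem pk_hasSum {a : ℝ} (ha : 1 ≤ a) (N : ℕ) : ∑ v ∈ Finset.range N, pk a (v + 1 : ℤ) ≤ 1 := by
  have : ∀ N : ℕ, ∑ v ∈ Finset.range N, pk a (v + 1 : ℤ) ≤ 1 - a / (a + N) := by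
    intro N
    induction N with
    | zero => simp [div_self (by positivity : a ≠ 0)]
    | succ N ih =>
      rw [Finset.sum_range_succ]
      have e : |((N + 1 : ℤ):ℝ)| = N + 1 := by push_cast; exact abs_of_nonneg (by positivity)
      have : pk a (N + 1 : ℤ) ≤ a / (a + N) - a / (a + (N + 1)) := by
        unfold pk
        rw [e, div_sub_div _ _ (by positivity) (by positivity), div_le_div_iff₀ (by positivity) (by positivity)]
        have : 0 ≤ a * (a + (N + 1)) := by positivity
        nlinarith
      push_cast
      linarith
  have h2 : 0 ≤ a / (a + N) := by positivity
  linarith [this N]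

theorem pk_tsum {a : ℝ} (ha : 1 ≤ a) : ∑' v : ℤ, ENNReal.ofReal (pk a v) ≤ 3 := by
  have h0 : 0 < a := by linarith
  have hs : ∑' v : ℕ, ENNReal.ofReal (pk a (v + 1 : ℤ)) ≤ 1 := by
    rw [ENNReal.tsum_eq_iSup_nat]
    refine iSup_le fun N => ?_
    rw [← ENNReal.ofReal_sum_of_nonneg (fun _ _ => pk_nonneg h0 _)]
    exact ENNReal.ofReal_le_one.2 (pk_hasSum ha N)
  have h1 : pk a 0 ≤ 1 := by
    simp only [pk, Int.cast_zero, abs_zero, add_zero]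
    rw [div_le_one (by positivity)]; nlinarith
  have h2 : ∑' v : ℤ, ENNReal.ofReal (pk a v) = ENNReal.ofReal (pk a 0) + ∑' v : ℕ, ENNReal.ofReal (pk a (v + 1 : ℤ)) + ∑' v : ℕ, ENNReal.ofReal (pk a (v + 1 : ℤ)) := by
    rw [tsum_of_add_one_of_neg_add_one ENNReal.summable ENNReal.summable]
    have : ∀ n : ℕ, pk a (-((n:ℤ) + 1)) = pk a (n + 1) := fun n => pk_neg a _
    simp only [this]
    ring
  rw [h2, show (3:ℝ≥0∞) = 1 + 1 + 1 by norm_num]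
  gcongr
  exact ENNReal.ofReal_le_one.2 h1

theorem pq_tsum {q : ℕ} (hq : 0 < q) {a : ℝ} (ha : 1 ≤ a) : ∑' x : ℤ, pq q a x ≤ 3 := by
  have hinj : Function.Injective (fun u : ℤ => (q:ℤ) * u) := fun x y h => by
    have : (q:ℤ) ≠ 0 := by positivity
    exact mul_left_cancel₀ this h
  rw [← hinj.tsum_eq]
  · refine le_trans (le_of_eq (tsum_congr fun u => ?_)) (pk_tsum ha)
    have : (q:ℤ) ≠ 0 := by positivity
    simp [pq, Int.mul_ediv_cancel_left u this]
  · intro x hx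
    rw [Function.mem_support] at hx
    by_cases h : (q:ℤ) ∣ x
    · obtain ⟨u, rfl⟩ := h; exact ⟨u, rfl⟩
    · simp [pq, h] at hx

theorem pq_conv1 {q : ℕ} {a b : ℝ} (hb : 0 < b) (hab : b ≤ a) (w v : ℤ) :
    pq q a w * pq q b v ≤ 2 * pq q a (w + v) * (pq q b v + pq q a w) := by
  unfold pq
  by_cases h1 : (q:ℤ) ∣ w
  · by_cases h2 : (q:ℤ) ∣ v
    · have ha : 0 < a := hb.trans_le hab
      rw [if_pos h1, if_pos h2, if_pos (dvd_add h1 h2), Int.add_ediv_of_dvd_left h1, show (2:ℝ≥0∞) = ENNReal.ofReal 2 by simp,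
        ← ENNReal.ofReal_mul (pk_nonneg ha _), ← ENNReal.ofReal_add (pk_nonneg hb _) (pk_nonneg ha _),
        ← ENNReal.ofReal_mul (by norm_num), ← ENNReal.ofReal_mul (mul_nonneg (by norm_num) (pk_nonneg ha _))]
      exact ENNReal.ofReal_le_ofReal (pk_conv hb hab _ _)
    · simp [h2]
  · simp [h1]

theorem pq_conv {q : ℕ} (hq : 0 < q) {a b : ℝ} (hb : 1 ≤ b) (hab : b ≤ a) (u : ℤ) :
    ∑' v, pq q a (u - v) * pq q b v ≤ 12 * pq q a u := by
  calc ∑' v, pq q a (u - v) * pq q b v ≤ ∑' v, 2 * pq q a u * (pq q b v + pq q a (u - v)) := by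
        refine ENNReal.tsum_le_tsum fun v => ?_
        have := pq_conv1 (q := q) (by linarith) hab (u - v) v
        rwa [sub_add_cancel] at this
    _ = 2 * pq q a u * (∑' v, pq q b v + ∑' v, pq q a (u - v)) := by rw [ENNReal.tsum_mul_left, ENNReal.tsum_add]
    _ ≤ 2 * pq q a u * (3 + 3) := by
        gcongr
        · exact pq_tsum hq hb
        · exact ((Equiv.subLeft u).tsum_eq (fun v => pq q a v)).trans_le (pq_tsum hq (hb.trans hab))
    _ = _ := by ring

/-- d-dimensional majorant -/
def HK {d : ℕ} (q : ℕ) (a : ℝ) (m : Fin d → ℤ) : ℝ≥0∞ := ∏ i, pq q a (m i)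

theorem HK_conv {d q : ℕ} (hq : 0 < q) {a b : ℝ} (hb : 1 ≤ b) (hab : b ≤ a) (u : Fin d → ℤ) :
    ∑' v : Fin d → ℤ, HK q a (u - v) * HK q b v ≤ 12 ^ d * HK q a u := by
  simp only [HK, ← Finset.prod_mul_distrib, Pi.sub_apply]
  rw [tsum_pi_prod (fun i v => pq q a (u i - v) * pq q b v)]
  calc _ ≤ ∏ i, (12 * pq q a (u i)) := Finset.prod_le_prod' fun i _ => pq_conv hq hb hab (u i)
    _ = _ := by rw [Finset.prod_mul_distrib]; simp

theorem HK_neg {d q : ℕ} (a : ℝ) (u : Fin d → ℤ) : HK q a (-u) = HK q a u := by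
  simp [HK, pq_neg]

theorem HK_ne_top {d q : ℕ} (a : ℝ) (u : Fin d → ℤ) : HK q a u ≠ ∞ := by
  unfold HK
  refine ENNReal.prod_ne_top fun i _ => ?_
  unfold pq; split_ifs <;> simp

theorem HL_sel {d q : ℕ} (hq : 0 < q) (κ : (Fin d → ℤ) → ℝ) (hκ : ∀ n, 1 ≤ κ n) (g : (Fin d → ℤ) → ℝ≥0∞) :
    ∑' n, (∑' m, HK q (κ n) m * g (n - m)) ^ 2 ≤ (4 * (12 ^ d) ^ 2) * ∑' m, g m ^ 2 := by
  have e : ∀ n, ∑' m, HK q (κ n) m * g (n - m) = ∑' m, HK q (κ n) (n - m) * g m := by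
    intro n
    rw [← (Equiv.subLeft n).tsum_eq]
    simp
  simp only [e]
  have hf : (12:ℝ≥0∞)^d ≠ ∞ := ENNReal.pow_ne_top (by norm_num)
  refine TTstar (fun n m => HK q (κ n) (n - m)) (12 ^ d) hf (by positivity) (fun _ _ => HK_ne_top _ _) (fun n n' => ?_) g
  have e2 : ∀ n n', ∑' m, HK q (κ n) (n - m) * HK q (κ n') (n' - m) = ∑' v : Fin d → ℤ, HK q (κ n) (n - n' - v) * HK q (κ n') v := by
    intro n n'
    rw [← (Equiv.addLeft n').tsum_eq]
    refine tsum_congr fun v => ?_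
    simp only [Equiv.coe_addLeft]
    rw [show n' - (n' + v) = -v by abel, HK_neg, show n - (n' + v) = n - n' - v by abel]
  rcases le_total (κ n') (κ n) with h | h
  · rw [e2]
    refine (HK_conv hq (hκ n') h _).trans ?_
    gcongr; exact le_self_add
  · simp only [mul_comm (HK q (κ n) _) (HK q (κ n') _)]
    rw [e2]
    refine (HK_conv hq (hκ n) h _).trans ?_
    gcongr; exact le_add_self

theorem sup_sel {N : Type*} (F : ℕ → N → ℝ≥0∞) (D : ℝ≥0∞) (h : ∀ κ : N → ℕ, ∑' n, (F (κ n) n) ^ 2 ≤ D) :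
    ∑' n, (⨆ i, F i n) ^ 2 ≤ D := by
  classical
  rw [ENNReal.tsum_eq_iSup_sum]
  refine iSup_le fun S => ?_
  have e : ∀ n, (⨆ i, F i n) ^ 2 = ⨆ M : ℕ, (partialSups (fun i => F i n) M) ^ 2 := by
    intro n
    rw [← iSup_partialSups_eq, ENNReal.iSup_pow]
  simp only [e]
  rw [ENNReal.finsetSum_iSup_of_monotone]
  · refine iSup_le fun M => ?_
    have : ∀ n, ∃ i, partialSups (fun i => F i n) M = F i n := by
      intro n
      obtain ⟨i, _, hi⟩ := exists_partialSups_eq (fun i => F i n) M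
      exact ⟨i, hi⟩
    choose κ hκ using this
    simp only [hκ]
    exact (ENNReal.sum_le_tsum S).trans (h κ)
  · intro n a b hab
    dsimp only
    gcongr

theorem HL {d q : ℕ} (hq : 0 < q) (a : ℕ → ℝ) (ha : ∀ i, 1 ≤ a i) (g : (Fin d → ℤ) → ℝ≥0∞) :
    ∑' n, (⨆ i, ∑' m, HK q (a i) m * g (n - m)) ^ 2 ≤ (4 * (12 ^ d) ^ 2) * ∑' m, g m ^ 2 :=
  sup_sel _ _ fun κ => HL_sel hq (fun n => a (κ n)) (fun n => ha _) g

theorem inner_toLp {d : ℕ} (x y : Fin d → ℝ) : inner ℝ (WithLp.toLp 2 x : EuclideanSpace ℝ (Fin d)) (WithLp.toLp 2 y) = ∑ i, x i * y i := by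
  simp [PiLp.inner_apply, mul_comm]

open MeasureTheory FourierTransform in
theorem ftR_inv {d : ℕ} (ψ : SchwartzMap (Fin d → ℝ) ℝ) :
    Continuous (ftR (fun x => ψ x)) ∧ ∀ x : Fin d → ℝ, ∫ ξ : Fin d → ℝ, ftR (fun x => ψ x) ξ * ec (∑ i, x i * ξ i) = (ψ x : ℂ) := by
  let E := EuclideanSpace ℝ (Fin d)
  let φ : SchwartzMap E ℂ := SchwartzMap.postcompCLM Complex.ofRealCLM
    (SchwartzMap.compCLMOfContinuousLinearEquiv ℝ (EuclideanSpace.equiv (Fin d) ℝ) ψ)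
  have hφ : ∀ x : E, φ x = (ψ (WithLp.ofLp x) : ℂ) := fun x => rfl
  have hmp := PiLp.volume_preserving_toLp (Fin d)
  have hme : MeasurableEmbedding (@WithLp.toLp 2 (Fin d → ℝ)) := (MeasurableEquiv.toLp 2 (Fin d → ℝ)).measurableEmbedding
  have h1 : ∀ ξ : Fin d → ℝ, ftR (fun x => ψ x) ξ = 𝓕 φ (WithLp.toLp 2 ξ) := by
    intro ξ
    rw [SchwartzMap.fourier_coe, Real.fourier_eq', ← hmp.integral_comp hme]
    rw [ftR]
    refine integral_congr_ae (Filter.Eventually.of_forall fun x => ?_)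
    simp only [hφ, smul_eq_mul]
    rw [mul_comm]
    congr 2
    erw [inner_toLp]
    push_cast
    ring
  constructor
  · have : ftR (fun x => ψ x) = fun ξ => 𝓕 φ (WithLp.toLp 2 ξ) := funext h1
    rw [this]
    exact (𝓕 φ).continuous.comp (PiLp.continuous_toLp 2 _)
  · intro x
    have h2 : 𝓕⁻ (𝓕 φ) = φ := FourierPair.fourierInv_fourier_eq φ
    have h3 : 𝓕⁻ (𝓕 φ) (WithLp.toLp 2 x) = (ψ x : ℂ) := by rw [h2, hφ]
    rw [← h3, SchwartzMap.fourierInv_coe, Real.fourierInv_eq', ← hmp.integral_comp hme]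
    refine integral_congr_ae (Filter.Eventually.of_forall fun ξ => ?_)
    simp only [smul_eq_mul, h1]
    rw [mul_comm, ec]
    congr 2
    erw [inner_toLp]
    push_cast
    simp only [mul_comm]
    ring

theorem psi_decay {d : ℕ} (ψ : SchwartzMap (Fin d → ℝ) ℝ) : ∃ C : ℝ, 0 < C ∧ ∀ x : Fin d → ℝ, |ψ x| ≤ C * ∏ i, ((1 + |x i|) ^ 2)⁻¹ := by
  refine ⟨2 ^ (2 * d) * (Finset.Iic (2 * d, 0)).sup (fun m => SchwartzMap.seminorm ℝ m.1 m.2) ψ + 1, by positivity, fun x => ?_⟩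
  have h := SchwartzMap.one_add_le_sup_seminorm_apply (𝕜 := ℝ) (m := (2 * d, 0)) le_rfl le_rfl ψ x
  rw [norm_iteratedFDeriv_zero, Real.norm_eq_abs] at h
  have h2 : ∏ i, (1 + |x i|) ^ 2 ≤ (1 + ‖x‖) ^ (2 * d) := by
    calc _ ≤ ∏ i : Fin d, (1 + ‖x‖) ^ 2 := by
          refine Finset.prod_le_prod (fun _ _ => by positivity) fun i _ => ?_
          gcongr
          exact norm_le_pi_norm x i
      _ = _ := by simp [pow_mul]
  rw [Finset.prod_inv_distrib, ← div_eq_mul_inv, le_div_iff₀ (Finset.prod_pos fun i _ => by positivity)]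
  calc _ ≤ |ψ x| * (1 + ‖x‖) ^ (2 * d) := by gcongr
    _ ≤ _ := by rw [mul_comm]; linarith

theorem psi_HK {d : ℕ} (ψ : SchwartzMap (Fin d → ℝ) ℝ) : ∃ C : ℝ, 0 < C ∧ ∀ (q : ℕ) (L : ℝ), 0 < q → 0 < L → ∀ m : Fin d → ℤ,
    ‖(psiQL (fun x => ψ x) q L m : ℂ)‖ₑ ≤ ENNReal.ofReal C * HK q (L / q) m := by
  obtain ⟨C, hC, h⟩ := psi_decay ψ
  refine ⟨C, hC, fun q L hq hL m => ?_⟩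
  have hq' : (0:ℝ) < q := by exact_mod_cast hq
  by_cases hm : ∀ i, (q:ℤ) ∣ m i
  · rw [psiQL, Set.indicator_of_mem (by exact hm)]
    have : HK q (L / q) m = ENNReal.ofReal (∏ i, pk (L / q) (m i / q)) := by
      rw [ENNReal.ofReal_prod_of_nonneg (fun i _ => pk_nonneg (by positivity) _)]
      exact Finset.prod_congr rfl fun i _ => by rw [pq, if_pos (hm i)]
    rw [this, ← ENNReal.ofReal_mul hC.le, ← ofReal_norm]
    refine ENNReal.ofReal_le_ofReal ?_
    rw [Complex.norm_real, Real.norm_eq_abs, abs_mul, abs_of_pos (by positivity : 0 < ((q:ℝ)/L)^d)]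
    refine (mul_le_mul_of_nonneg_left (h _) (by positivity)).trans (le_of_eq ?_)
    rw [mul_left_comm]
    congr 1
    rw [show ((q:ℝ)/L)^d = ∏ i : Fin d, (q:ℝ)/L by rw [Finset.prod_const]; simp, ← Finset.prod_mul_distrib]
    refine Finset.prod_congr rfl fun i _ => ?_
    obtain ⟨u, hu⟩ := hm i
    rw [hu, Int.mul_ediv_cancel_left _ (by positivity), pk]
    push_cast
    rw [abs_div, abs_mul, abs_of_pos hL, abs_of_pos hq']
    field_simp
  · rw [psiQL, Set.indicator_of_notMem (by exact hm)]; simp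

theorem HK_tsum {d q : ℕ} (hq : 0 < q) {a : ℝ} (ha : 1 ≤ a) : ∑' m : Fin d → ℤ, HK q a m ≤ 3 ^ d := by
  simp only [HK]
  rw [tsum_pi_prod (fun _ x => pq q a x)]
  calc _ ≤ ∏ i : Fin d, (3:ℝ≥0∞) := Finset.prod_le_prod' fun i _ => pq_tsum hq ha
    _ = _ := by simp

theorem psi_summable {d : ℕ} (ψ : SchwartzMap (Fin d → ℝ) ℝ) {q : ℕ} {L : ℝ} (hq : 0 < q) (hL : (q:ℝ) ≤ L) :
    Summable (fun m : Fin d → ℤ => ‖(psiQL (fun x => ψ x) q L m : ℂ)‖) := by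
  obtain ⟨C, hC, h⟩ := psi_HK ψ
  have hq' : (0:ℝ) < q := by exact_mod_cast hq
  refine summable_norm_iff.2 (Summable.of_enorm ?_)
  refine ne_top_of_le_ne_top ?_ (ENNReal.tsum_le_tsum (h q L hq (by linarith)))
  rw [ENNReal.tsum_mul_left]
  refine ENNReal.mul_ne_top (by simp) (ne_top_of_le_ne_top ?_ (HK_tsum hq (by rwa [le_div_iff₀ hq', one_mul])))
  exact ENNReal.pow_ne_top (by norm_num)

def rep (t : UnitAddCircle) : ℝ := (AddCircle.equivIoc (1:ℝ) (-1/2) t : ℝ)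

theorem rep_coe_of_mem {x : ℝ} (hx : x ∈ Set.Ioc (-1/2:ℝ) (1/2)) : rep (x : UnitAddCircle) = x := by
  have h := AddCircle.coe_equivIoc (p := (1:ℝ)) (a := (-1/2:ℝ)) (y := (x : UnitAddCircle))
  have : AddCircle.equivIoc (1:ℝ) (-1/2) (x : UnitAddCircle) = ⟨x, by norm_num; exact ⟨by linarith [hx.1], hx.2⟩⟩ := by
    rw [← Equiv.eq_symm_apply]; rfl
  rw [rep, this]

theorem rep_mem (t : UnitAddCircle) : rep t ∈ Set.Ioc (-1/2:ℝ) (1/2) := by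
  have h := (AddCircle.equivIoc (1:ℝ) (-1/2) t).2
  norm_num at h ⊢
  exact h

theorem coe_rep (t : UnitAddCircle) : (rep t : UnitAddCircle) = t := AddCircle.coe_equivIoc

theorem norm_rep (t : UnitAddCircle) : |rep t| = ‖t‖ := by
  conv_rhs => rw [← coe_rep t]
  symm
  rw [AddCircle.norm_coe_eq_abs_iff _ one_ne_zero, abs_le]
  have := rep_mem t
  simp only [abs_one]
  exact ⟨by linarith [this.1], this.2⟩

theorem rep_contAt {t : UnitAddCircle} (ht : ‖t‖ < 1/2) : ContinuousAt rep t := by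
  refine continuousAt_subtype_val.comp (AddCircle.continuousAt_equivIoc 1 (-1/2) ?_)
  rintro rfl
  have : ‖((-1/2:ℝ) : UnitAddCircle)‖ = |(-1/2:ℝ)| := by
    rw [AddCircle.norm_coe_eq_abs_iff _ one_ne_zero]; norm_num [abs_le]
  rw [this] at ht
  norm_num [abs_of_neg] at ht

theorem torus_fun {d : ℕ} (φ : (Fin d → ℝ) → ℂ) (hφ : Continuous φ) (hs : ∀ ξ, (∃ i, 1 < |ξ i|) → φ ξ = 0) {A : ℝ} (hA : 2 < A) :
    Continuous (fun t : UnitAddTorus (Fin d) => φ (fun i => A * rep (t i))) := by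
  rw [continuous_iff_continuousAt]
  intro t
  by_cases h : ∃ i, 1 / A < ‖t i‖
  · obtain ⟨i, hi⟩ := h
    have : (fun t : UnitAddTorus (Fin d) => φ (fun i => A * rep (t i))) =ᶠ[nhds t] fun _ => 0 := by
      have ho : IsOpen {s : UnitAddTorus (Fin d) | 1 / A < ‖s i‖} := isOpen_lt continuous_const (continuous_apply i).norm
      filter_upwards [ho.mem_nhds hi] with s hs'
      refine hs _ ⟨i, ?_⟩
      have hs2 : 1 / A < ‖s i‖ := hs'
      rw [abs_mul, norm_rep, abs_of_pos (by linarith)]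
      rw [div_lt_iff₀ (by linarith)] at hs2
      linarith
    exact continuousAt_const.congr this.symm
  · push Not at h
    refine hφ.continuousAt.comp (continuousAt_pi.2 fun i => ?_)
    refine continuousAt_const.mul ?_
    refine ContinuousAt.comp (f := fun t : UnitAddTorus (Fin d) => t i) (rep_contAt ?_) (continuous_apply i).continuousAt
    refine (h i).trans_lt ?_
    exact one_div_lt_one_div_of_lt (by norm_num) hA

open MeasureTheory in
theorem torus_coeff {d : ℕ} (ψ : SchwartzMap (Fin d → ℝ) ℝ) (hs : ∀ ξ, (∃ i, 1 < |ξ i|) → ftR (fun x => ψ x) ξ = 0) {A : ℝ} (hA : 2 < A) (n : Fin d → ℤ) :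
    UnitAddTorus.mFourierCoeff (fun t : UnitAddTorus (Fin d) => ftR (fun x => ψ x) (fun i => A * rep (t i))) n =
      ((A ^ d)⁻¹ * ψ (fun i => -(n i) / A) : ℝ) := by
  have hA0 : 0 < A := by linarith
  rw [UnitAddTorus.mFourierCoeff_eq_integral _ n (fun _ => -1/2)]
  set B : Set (Fin d → ℝ) := {x | ∀ i, x i ∈ Set.Ioc (-1/2:ℝ) (-1/2 + 1)} with hB
  have hBm : MeasurableSet B := by
    have : B = Set.univ.pi fun _ => Set.Ioc (-1/2:ℝ) (-1/2 + 1) := by ext x; simp [hB]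
    rw [this]
    exact MeasurableSet.univ_pi fun _ => measurableSet_Ioc
  have h1 : ∫ x in B, UnitAddTorus.mFourier (-n) (fun i => (x i : UnitAddCircle)) • ftR (fun x => ψ x) (fun i => A * rep (x i : UnitAddCircle))
      = ∫ x in B, ec (dotp (-n) x) * ftR (fun x => ψ x) (A • x) := by
    refine setIntegral_congr_fun hBm fun x hx => ?_
    simp only [smul_eq_mul]
    rw [mFourier_coe]
    congr 2
    funext i
    rw [rep_coe_of_mem (by have := hx i; norm_num at this ⊢; exact this)]
    simp
  rw [h1, setIntegral_eq_integral_of_forall_compl_eq_zero]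
  · have h2 : ∀ x : Fin d → ℝ, ec (dotp (-n) x) * ftR (fun x => ψ x) (A • x) =
      (fun y : Fin d → ℝ => ftR (fun x => ψ x) y * ec (∑ i, (-(n i) / A) * y i)) (A • x) := by
      intro x
      simp only []
      rw [mul_comm]
      congr 2
      refine Finset.sum_congr rfl fun i _ => ?_
      simp
      field_simp
    rw [integral_congr_ae (Filter.Eventually.of_forall h2), Measure.integral_comp_smul volume
      (fun y : Fin d → ℝ => ftR (fun x => ψ x) y * ec (∑ i, (-(n i) / A) * y i)), (ftR_inv ψ).2]
    simp [abs_of_pos hA0]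
  · intro x hx
    rw [hs, mul_zero]
    by_contra hc
    push Not at hc
    apply hx
    intro i
    have := hc i
    simp only [Pi.smul_apply, smul_eq_mul, abs_mul, abs_of_pos hA0] at this
    have h3 : |x i| < 1/2 := by
      by_contra h4
      push Not at h4
      nlinarith
    rw [abs_lt] at h3
    exact ⟨by linarith [h3.1], by linarith [h3.2]⟩

theorem psi_poisson {d : ℕ} (ψ : SchwartzMap (Fin d → ℝ) ℝ) (hs : ∀ ξ, (∃ i, 1 < |ξ i|) → ftR (fun x => ψ x) ξ = 0) {q : ℕ} {L : ℝ}
    (hq : 0 < q) (hL : 2 * (q:ℝ) < L) (ξ : Fin d → ℝ) :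
    ftZ (fun m => (psiQL (fun x => ψ x) q L m : ℂ)) ξ = ftR (fun x => ψ x) (fun i => L / q * rep ((-(q * ξ i) : ℝ) : UnitAddCircle)) := by
  have hq' : (0:ℝ) < q := by exact_mod_cast hq
  have hA : 2 < L / q := by rwa [lt_div_iff₀ hq']
  set g : C(UnitAddTorus (Fin d), ℂ) := ⟨_, torus_fun _ (ftR_inv ψ).1 hs hA⟩ with hg
  have hc : ∀ n, UnitAddTorus.mFourierCoeff g n = (((L/q) ^ d)⁻¹ * ψ (fun i => -(n i) / (L/q)) : ℝ) := torus_coeff ψ hs hA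
  have hinj : Function.Injective (fun u : Fin d → ℤ => -((q:ℤ) • u)) := by
    intro x y h
    have : (q:ℤ) ≠ 0 := by positivity
    funext i
    have h2 := congrFun (neg_injective h) i
    simp only [Pi.smul_apply, smul_eq_mul] at h2
    exact mul_left_cancel₀ this h2
  have hval : ∀ u : Fin d → ℤ, (psiQL (fun x => ψ x) q L (-((q:ℤ) • u)) : ℂ) = (((L/q) ^ d)⁻¹ * ψ (fun i => -(u i) / (L/q)) : ℝ) := by
    intro u
    rw [psiQL, Set.indicator_of_mem (by intro i; simp)]
    congr 2
    · rw [← inv_pow, inv_div]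
    · congr 1; funext i; simp; field_simp
  have hsup : Function.support (fun m => (psiQL (fun x => ψ x) q L m : ℂ)) ⊆ Set.range (fun u : Fin d → ℤ => -((q:ℤ) • u)) := by
    intro m hm
    by_contra hc
    apply hm
    simp only
    rw [psiQL, Set.indicator_of_notMem]
    · simp
    · intro h
      choose u hu using h
      exact hc ⟨-u, by funext i; simp [hu]⟩
  have hsm := psi_summable ψ hq (by linarith : (q:ℝ) ≤ L)
  have hsum : Summable (UnitAddTorus.mFourierCoeff g) := by
    have := (Summable.of_norm hsm).comp_injective hinj
    refine this.congr fun u => ?_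
    simp only [Function.comp]
    rw [hval, hc]
  have h := UnitAddTorus.hasSum_mFourier_series_apply_of_summable hsum (fun i => ((-(q * ξ i) : ℝ) : UnitAddCircle))
  have h2 := h.tsum_eq
  rw [hg] at h2
  rw [← hg] at h2
  have h3 : g (fun i => ((-(q * ξ i) : ℝ) : UnitAddCircle)) = ftR (fun x => ψ x) (fun i => L / q * rep ((-(q * ξ i) : ℝ) : UnitAddCircle)) := rfl
  rw [← h3, ← h2, ftZ, ← hinj.tsum_eq]
  · refine tsum_congr fun u => ?_
    rw [hval, hc, smul_eq_mul]
    congr 1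
    rw [mFourier_coe (d := d) u (fun i => -(q * ξ i))]
    congr 1
    refine Finset.sum_congr rfl fun i _ => ?_
    simp; ring
  · intro m hm
    refine hsup ?_
    intro h0
    apply hm
    simp only at h0 ⊢
    rw [h0, zero_mul]

/-- the three facts used later -/
theorem psi_ft {d : ℕ} (ψ : SchwartzMap (Fin d → ℝ) ℝ) (hψ : ∀ ξ : Fin d → ℝ, (ftR (fun x => ψ x) ξ).im = 0 ∧
      Set.indicator (cubeQ d) (fun _ => (1 : ℝ)) ξ ≤ (ftR (fun x => ψ x) ξ).re ∧
      (ftR (fun x => ψ x) ξ).re ≤ Set.indicator (cube2Q d) (fun _ => (1 : ℝ)) ξ) {q : ℕ} {L : ℝ}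
    (hq : 0 < q) (hL : 2 * (q:ℝ) < L) (ξ : Fin d → ℝ) :
    ‖ftZ (fun m => (psiQL (fun x => ψ x) q L m : ℂ)) ξ‖ ≤ 1 ∧
    ((∃ v : Fin d → ℤ, ∀ i, |q * ξ i - v i| ≤ q / (2 * L)) → ftZ (fun m => (psiQL (fun x => ψ x) q L m : ℂ)) ξ = 1) ∧
    (∀ i, (∀ v : ℤ, q / L < |q * ξ i - v|) → ftZ (fun m => (psiQL (fun x => ψ x) q L m : ℂ)) ξ = 0) := by
  have hq' : (0:ℝ) < q := by exact_mod_cast hq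
  have hA : 2 < L / q := by rwa [lt_div_iff₀ hq']
  have hL0 : 0 < L := by linarith
  have hre : ∀ ξ, ftR (fun x => ψ x) ξ = ((ftR (fun x => ψ x) ξ).re : ℂ) := fun ξ =>
    Complex.ext (by simp) (by simp [(hψ ξ).1])
  have hs : ∀ ξ, (∃ i, 1 < |ξ i|) → ftR (fun x => ψ x) ξ = 0 := by
    rintro ξ ⟨i, hi⟩
    have h := hψ ξ
    rw [Set.indicator_of_notMem (s := cube2Q d) (by intro h; exact absurd (h i) (by linarith))] at h
    have h0 : 0 ≤ Set.indicator (cubeQ d) (fun _ => (1 : ℝ)) ξ := Set.indicator_nonneg (fun _ _ => zero_le_one) _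
    have : (ftR (fun x => ψ x) ξ).re = 0 := le_antisymm h.2.2 (h0.trans h.2.1)
    rw [hre, this]; simp
  have hP := psi_poisson ψ hs hq hL ξ
  refine ⟨?_, ?_, ?_⟩
  · rw [hP, hre, Complex.norm_real, Real.norm_eq_abs, abs_le]
    set η := (fun i => L / q * rep ((-(q * ξ i) : ℝ) : UnitAddCircle))
    have h0 : 0 ≤ Set.indicator (cubeQ d) (fun _ => (1 : ℝ)) η := Set.indicator_nonneg (fun _ _ => zero_le_one) _
    have h1 : Set.indicator (cube2Q d) (fun _ => (1 : ℝ)) η ≤ 1 := Set.indicator_le_self' (fun _ _ => zero_le_one) _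
    exact ⟨by linarith [(hψ η).2.1], (hψ η).2.2.trans h1⟩
  · rintro ⟨v, hv⟩
    have : (fun i => L / q * rep ((-(q * ξ i) : ℝ) : UnitAddCircle)) ∈ cubeQ d := by
      intro i
      simp only
      have e : ((-(q * ξ i) : ℝ) : UnitAddCircle) = ((v i - q * ξ i : ℝ) : UnitAddCircle) := by
        rw [sub_eq_add_neg, AddCircle.coe_add]
        have : ((v i : ℝ) : UnitAddCircle) = 0 := by
          rw [AddCircle.coe_eq_zero_iff]; exact ⟨v i, by simp⟩
        rw [this, zero_add]
      have hb := hv i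
      rw [abs_sub_comm] at hb
      have hb2 : q / (2 * L) < 1/4 := by rw [div_lt_div_iff₀ (by positivity) (by norm_num)]; linarith
      have hb3 := abs_le.1 hb
      rw [e, rep_coe_of_mem ⟨by linarith [hb3.1], by linarith [hb3.2]⟩, abs_mul, abs_of_pos (by positivity)]
      calc L / q * |v i - q * ξ i| ≤ L / q * (q / (2 * L)) := by gcongr
        _ = 1 / 2 := by field_simp
    have h := hψ (fun i => L / q * rep ((-(q * ξ i) : ℝ) : UnitAddCircle))
    rw [Set.indicator_of_mem this] at h
    have h1 : Set.indicator (cube2Q d) (fun _ => (1 : ℝ)) (fun i => L / q * rep ((-(q * ξ i) : ℝ) : UnitAddCircle)) ≤ 1 := Set.indicator_le_self' (fun _ _ => zero_le_one) _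
    rw [hP, hre, le_antisymm (h.2.2.trans h1) h.2.1]; simp
  · intro i hi
    rw [hP]
    refine hs _ ⟨i, ?_⟩
    set t := ((-(q * ξ i) : ℝ) : UnitAddCircle) with ht
    have : ∃ v : ℤ, rep t = v - q * ξ i := by
      have h := coe_rep t
      rw [ht, ← sub_eq_zero, ← AddCircle.coe_sub, AddCircle.coe_eq_zero_iff] at h
      obtain ⟨v, hv⟩ := h
      refine ⟨v, ?_⟩
      simp only [zsmul_eq_mul, mul_one] at hv
      linarith
    obtain ⟨v, hv⟩ := this
    have h := hi v
    rw [abs_mul, abs_of_pos (by positivity : 0 < L / q), hv, abs_sub_comm]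
    calc 1 = L / q * (q / L) := by field_simp
      _ < _ := by gcongr

theorem lcm_bound_large (i : ℕ) (hi : 5 ≤ i) : (Nat.lcmUpto (2 ^ i) : ℝ) * 2 ^ (i + 1) < 16 ^ (2 ^ i) := by
  have hr : ∀ i : ℕ, 5 ≤ i → ((i:ℝ) + 0.6) ^ 2 ≤ 2 ^ i := by
    intro i hi
    induction i, hi using Nat.le_induction with
    | base => norm_num
    | succ i hi ih =>
      have : (5:ℝ) ≤ i := by exact_mod_cast hi
      push_cast
      rw [pow_succ 2 i]
      nlinarith
  have h5 : (5:ℝ) ≤ i := by exact_mod_cast hi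
  have h1 := hr i hi
  have hp : (0:ℝ) < Nat.lcmUpto (2 ^ i) := by exact_mod_cast Nat.lcmUpto_pos _
  have h2 := Chebyshev.psi_le (x := ((2 ^ i : ℕ):ℝ)) (by exact_mod_cast Nat.one_le_two_pow)
  rw [Chebyshev.psi_eq_log_lcmUpto] at h2
  rw [← Real.log_lt_log_iff (by positivity) (by positivity), Real.log_mul hp.ne' (by positivity), Real.log_pow, Real.log_pow]
  set r := Real.sqrt ((2 ^ i : ℕ) : ℝ) with hrd
  have hr2 : r ^ 2 = 2 ^ i := by rw [hrd, Real.sq_sqrt (by positivity)]; push_cast; rfl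
  have hr0 : 0 ≤ r := Real.sqrt_nonneg _
  have hr1 : i + 0.6 ≤ r := by
    rw [← hr2] at h1
    exact le_of_sq_le_sq h1 hr0
  have hl : 0 < Real.log 2 := Real.log_pos (by norm_num)
  have e4 : Real.log 4 = 2 * Real.log 2 := by rw [show (4:ℝ) = 2 ^ 2 by norm_num, Real.log_pow]; norm_num
  have e16 : Real.log 16 = 4 * Real.log 2 := by rw [show (16:ℝ) = 2 ^ 4 by norm_num, Real.log_pow]; norm_num
  push_cast at h2 ⊢
  rw [e4, Real.log_pow] at h2
  rw [e16, ← hr2]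
  rw [← hr2] at h2
  have h3 : 2 * r * i + i + 1 < 2 * r ^ 2 := by nlinarith
  nlinarith

theorem lcm_bound (j k : ℕ) (h : 2 ^ (j + 3) ≤ k) : (qlcm (j + 1) : ℝ) * 2 ^ (j + 2) < 2 ^ k := by
  have h1 : (qlcm (j + 1) : ℝ) * 2 ^ (j + 2) < 16 ^ (2 ^ (j + 1)) := by
    by_cases hj : 5 ≤ j + 1
    · exact lcm_bound_large (j + 1) hj
    · have : j < 4 := by omega
      have e : ∀ j < 4, qlcm (j + 1) * 2 ^ (j + 2) < 16 ^ (2 ^ (j + 1)) := by decide +kernel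
      exact_mod_cast e j this
  refine h1.trans_le ?_
  rw [show (16:ℝ) = 2 ^ 4 by norm_num, ← pow_mul]
  refine pow_le_pow_right₀ (by norm_num) (le_trans (le_of_eq ?_) h)
  ring

theorem qlcm_pos (j : ℕ) : 0 < qlcm j := Nat.lcmUpto_pos _

theorem dvd_qlcm {j q : ℕ} (h0 : 0 < q) (h : q ≤ 2 ^ j) : q ∣ qlcm j := by
  unfold qlcm
  exact Finset.dvd_lcm (f := id) (Finset.mem_Icc.2 ⟨h0, h⟩)

theorem qlcm_mono (j : ℕ) : qlcm j ∣ qlcm (j + 1) := by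
  unfold qlcm
  refine Finset.lcm_mono (Finset.Icc_subset_Icc le_rfl ?_)
  exact Nat.pow_le_pow_right (by norm_num) (by omega)

theorem qL_bound {j k : ℕ} (h : 2 ^ (j + 3) ≤ k) : 2 * (qlcm (j + 1) : ℝ) < (2:ℝ) ^ ((k:ℤ) - ((j + 1 : ℕ):ℤ)) ∧
   2 * (qlcm j : ℝ) < (2:ℝ) ^ ((k:ℤ) - (j:ℤ)) := by
  have h1 := lcm_bound j k h
  have h2 : (qlcm j : ℝ) ≤ qlcm (j + 1) := by exact_mod_cast Nat.le_of_dvd (qlcm_pos _) (qlcm_mono j)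
  have h3 : 2 * (qlcm (j + 1) : ℝ) < (2:ℝ) ^ ((k:ℤ) - ((j + 1 : ℕ):ℤ)) := by
    rw [zpow_sub₀ (by norm_num), lt_div_iff₀ (by positivity)]
    rw [pow_succ] at h1
    rw [zpow_natCast, zpow_natCast]
    linarith
  have h4 : (2:ℝ) ^ ((k:ℤ) - (j:ℤ)) = (2:ℝ) ^ ((k:ℤ) - ((j + 1 : ℕ):ℤ)) * 2 := by
    rw [← zpow_add_one₀ (by norm_num)]; congr 1; push_cast; ring
  refine ⟨h3, ?_⟩
  rw [h4]; linarith [Nat.cast_nonneg (α := ℝ) (qlcm j)]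

/-- The complex version of `ΔΨ_{j,k}`. -/
def DPc {d : ℕ} (ψ : SchwartzMap (Fin d → ℝ) ℝ) (j k : ℕ) (m : Fin d → ℤ) : ℂ := (DeltaPsiJK (fun x => ψ x) j k m : ℝ)

theorem DPc_summable {d : ℕ} (ψ : SchwartzMap (Fin d → ℝ) ℝ) {j k : ℕ} (h : 2 ^ (j + 3) ≤ k) : Summable fun m => ‖DPc ψ j k m‖ := by
  obtain ⟨h1, h2⟩ := qL_bound h
  have s1 := psi_summable ψ (L := (2:ℝ) ^ ((k:ℤ) - ((j + 1 : ℕ):ℤ))) (qlcm_pos (j+1)) (by linarith [Nat.cast_nonneg (α := ℝ) (qlcm (j+1))])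
  have s2 := psi_summable ψ (L := (2:ℝ) ^ ((k:ℤ) - (j:ℤ))) (qlcm_pos j) (by linarith [Nat.cast_nonneg (α := ℝ) (qlcm j)])
  refine Summable.of_nonneg_of_le (fun _ => norm_nonneg _) (fun m => ?_) (s1.add s2)
  simp only [DPc, DeltaPsiJK, PsiJK]
  rw [Complex.ofReal_sub]
  exact norm_sub_le _ _

theorem DPc_ft {d : ℕ} (ψ : SchwartzMap (Fin d → ℝ) ℝ) (hψ : ∀ ξ : Fin d → ℝ, (ftR (fun x => ψ x) ξ).im = 0 ∧
      Set.indicator (cubeQ d) (fun _ => (1 : ℝ)) ξ ≤ (ftR (fun x => ψ x) ξ).re ∧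
      (ftR (fun x => ψ x) ξ).re ≤ Set.indicator (cube2Q d) (fun _ => (1 : ℝ)) ξ) {j k : ℕ} (h : 2 ^ (j + 3) ≤ k) (ξ : Fin d → ℝ) :
    ‖ftZ (DPc ψ j k) ξ‖ ≤ 2 ∧ ∀ q : ℕ, 0 < q → q ≤ 2 ^ j → ∀ v : Fin d → ℤ, (∀ i, |q * ξ i - v i| ≤ q * 2 ^ j / (2 * 2 ^ k)) → ftZ (DPc ψ j k) ξ = 0 := by
  obtain ⟨h1, h2⟩ := qL_bound h
  have s1 := psi_summable ψ (L := (2:ℝ) ^ ((k:ℤ) - ((j + 1 : ℕ):ℤ))) (qlcm_pos (j+1)) (by linarith [Nat.cast_nonneg (α := ℝ) (qlcm (j+1))])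
  have s2 := psi_summable ψ (L := (2:ℝ) ^ ((k:ℤ) - (j:ℤ))) (qlcm_pos j) (by linarith [Nat.cast_nonneg (α := ℝ) (qlcm j)])
  have f1 := psi_ft ψ hψ (qlcm_pos (j+1)) h1 ξ
  have f2 := psi_ft ψ hψ (qlcm_pos j) h2 ξ
  have e : ftZ (DPc ψ j k) ξ = ftZ (fun m => (psiQL (fun x => ψ x) (qlcm (j+1)) ((2:ℝ) ^ ((k:ℤ) - ((j + 1 : ℕ):ℤ))) m : ℂ)) ξ -
      ftZ (fun m => (psiQL (fun x => ψ x) (qlcm j) ((2:ℝ) ^ ((k:ℤ) - (j:ℤ))) m : ℂ)) ξ := by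
    rw [ftZ, ftZ, ftZ, ← (Summable.of_norm (summable_ec s1 ξ)).tsum_sub (Summable.of_norm (summable_ec s2 ξ))]
    refine tsum_congr fun m => ?_
    simp only [DPc, DeltaPsiJK, PsiJK]
    push_cast
    ring
  constructor
  · rw [e]
    refine (norm_sub_le _ _).trans ?_
    linarith [f1.1, f2.1]
  · intro q hq hqj v hv
    have hq' : (0:ℝ) < q := by exact_mod_cast hq
    have key : ∀ Q : ℕ, 0 < Q → q ∣ Q → ∀ L : ℝ, 0 < L → L ≤ 2 ^ k / 2 ^ j → ∃ v : Fin d → ℤ, ∀ i, |Q * ξ i - v i| ≤ Q / (2 * L) := by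
      rintro Q hQ ⟨c, rfl⟩ L hL hLk
      refine ⟨fun i => c * v i, fun i => ?_⟩
      have := hv i
      push_cast
      rw [show (q:ℝ) * c * ξ i - c * v i = c * (q * ξ i - v i) by ring, abs_mul, abs_of_nonneg (Nat.cast_nonneg c)]
      rw [le_div_iff₀ (by positivity)] at hLk
      calc (c:ℝ) * |q * ξ i - v i| ≤ c * (q * 2 ^ j / (2 * 2 ^ k)) := by gcongr
        _ ≤ c * (q / (2 * L)) := by
          gcongr ?_ * ?_
          rw [div_le_div_iff₀ (by positivity) (by positivity)]
          nlinarith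
        _ = _ := by ring
    have hz : (2:ℝ) ^ ((k:ℤ) - (j:ℤ)) = 2 ^ k / 2 ^ j := by
      rw [zpow_sub₀ (by norm_num), zpow_natCast, zpow_natCast]
    have hz2 : (2:ℝ) ^ ((k:ℤ) - ((j+1:ℕ):ℤ)) ≤ 2 ^ k / 2 ^ j := by
      rw [← hz]
      refine zpow_le_zpow_right₀ (by norm_num) ?_
      push_cast; linarith
    rw [e, f1.2.1 (key _ (qlcm_pos _) ((dvd_qlcm hq hqj).trans (qlcm_mono j)) _ (by positivity) hz2),
      f2.2.1 (key _ (qlcm_pos _) (dvd_qlcm hq hqj) _ (by positivity) hz.le), sub_self]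

/-- quadratic Gauss sum -/
def Gs (q : ℕ) [NeZero q] (a v : ℤ) : ℂ := ∑ r : ZMod q, ZMod.stdAddChar ((a : ZMod q) * r ^ 2 - r * (v : ZMod q))

theorem stdc (q : ℕ) [NeZero q] (x : ℤ) : (ZMod.stdAddChar (x : ZMod q) : ℂ) = ec (x / q) := by
  rw [ZMod.stdAddChar_coe, ec]; congr 1; push_cast; ring

theorem Gs_norm (q : ℕ) [NeZero q] (a v : ℤ) (h : IsCoprime a (q:ℤ)) : ‖Gs q a v‖ ^ 2 ≤ 2 * q := by
  set e : AddChar (ZMod q) ℂ := ZMod.stdAddChar with he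
  have hprim : e.IsPrimitive := ZMod.isPrimitive_stdAddChar q
  have hsq : ((‖Gs q a v‖ ^ 2 : ℝ) : ℂ) = ∑ t : ZMod q, e ((a : ZMod q) * t ^ 2 - t * (v : ZMod q)) * ∑ r : ZMod q, e (r * (2 * a * t)) := by
    rw [Complex.ofReal_pow, ← Complex.mul_conj', Gs, map_sum, Finset.sum_mul_sum]
    rw [Finset.sum_comm]
    have : ∀ r : ZMod q, ∑ x : ZMod q, e ((a : ZMod q) * x ^ 2 - x * (v : ZMod q)) * (starRingEnd ℂ) (e ((a : ZMod q) * r ^ 2 - r * (v : ZMod q)))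
       = ∑ t : ZMod q, e ((a : ZMod q) * t ^ 2 - t * (v : ZMod q)) * e (r * (2 * a * t)) := by
      intro r
      rw [← Equiv.sum_comp (Equiv.addLeft r)]
      refine Finset.sum_congr rfl fun t _ => ?_
      rw [← AddChar.map_neg_eq_conj, ← AddChar.map_add_eq_mul, ← AddChar.map_add_eq_mul]
      congr 1
      simp only [Equiv.coe_addLeft]
      ring
    refine (Finset.sum_congr rfl fun r _ => this r).trans ?_
    rw [Finset.sum_comm]
    exact Finset.sum_congr rfl fun t _ => by rw [Finset.mul_sum]
  have hcard : ((Finset.univ.filter fun t : ZMod q => 2 * (a : ZMod q) * t = 0).card : ℝ) ≤ 2 := by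
    have hu : IsUnit (a : ZMod q) := by
      rwa [ZMod.coe_int_isUnit_iff_isCoprime, isCoprime_comm]
    have hsub : (Finset.univ.filter fun t : ZMod q => 2 * (a : ZMod q) * t = 0) ⊆ {0, ((q / 2 : ℕ) : ZMod q)} := by
      intro t ht
      simp only [Finset.mem_filter, Finset.mem_univ, true_and] at ht
      have h2 : 2 * t = 0 := by
        have : (a : ZMod q) * (2 * t) = 0 := by rw [← ht]; ring
        exact (hu.mul_right_eq_zero).1 this
      have h3 : q ∣ 2 * t.val := by
        rw [← ZMod.natCast_eq_zero_iff]; push_cast; rw [ZMod.natCast_zmod_val]; exact h2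
      have h4 := ZMod.val_lt t
      simp only [Finset.mem_insert, Finset.mem_singleton]
      obtain ⟨c, hc⟩ := h3
      have hc2 : c < 2 := by
        by_contra hcc
        have : q * 2 ≤ q * c := Nat.mul_le_mul_left _ (by omega)
        omega
      interval_cases c
      · left; exact (ZMod.val_eq_zero t).1 (by omega)
      · right
        rw [← ZMod.natCast_zmod_val t]; congr 1; omega
    calc _ ≤ ((({0, ((q / 2 : ℕ) : ZMod q)} : Finset (ZMod q)).card : ℕ) : ℝ) := by exact_mod_cast Finset.card_le_card hsub
      _ ≤ 2 := by exact_mod_cast Finset.card_le_two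
  have h1 : ‖Gs q a v‖ ^ 2 = ‖((‖Gs q a v‖ ^ 2 : ℝ) : ℂ)‖ := by
    rw [Complex.norm_real, Real.norm_of_nonneg (by positivity)]
  rw [h1, hsq]
  refine (norm_sum_le _ _).trans ?_
  have h5 : ∀ t : ZMod q, ‖e ((a : ZMod q) * t ^ 2 - t * (v : ZMod q)) * ∑ r : ZMod q, e (r * (2 * a * t))‖ = if 2 * (a : ZMod q) * t = 0 then (q:ℝ) else 0 := by
    intro t
    rw [norm_mul, AddChar.norm_apply, one_mul, AddChar.sum_mulShift _ hprim]
    split_ifs <;> simp [ZMod.card]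
  simp only [h5]
  rw [← Finset.sum_filter, Finset.sum_const, nsmul_eq_mul]
  gcongr

theorem sum_fin_zmod (q : ℕ) [NeZero q] (F : ZMod q → ℂ) : ∑ l : Fin q, F ((l : ℕ) : ZMod q) = ∑ l : ZMod q, F l := by
  refine Fintype.sum_bijective (fun l : Fin q => ((l : ℕ) : ZMod q)) ?_ _ _ (fun _ => rfl)
  rw [Fintype.bijective_iff_injective_and_card]
  refine ⟨fun x y h => ?_, by simp [ZMod.card]⟩
  have := (ZMod.natCast_eq_natCast_iff' _ _ _).1 h
  rw [Nat.mod_eq_of_lt x.2, Nat.mod_eq_of_lt y.2] at this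
  exact Fin.ext this

theorem finFourier (q : ℕ) [NeZero q] (a x : ℤ) :
    ec (a * x ^ 2 / q) = (q:ℂ)⁻¹ * ∑ l : Fin q, Gs q a (l : ℕ) * ec (x * (l : ℕ) / q) := by
  set e : AddChar (ZMod q) ℂ := ZMod.stdAddChar with he
  have hprim : e.IsPrimitive := ZMod.isPrimitive_stdAddChar q
  have hq : (q:ℂ) ≠ 0 := by exact_mod_cast NeZero.ne q
  have h1 : ∀ l : Fin q, Gs q a (l : ℕ) * ec (x * (l : ℕ) / q) =
      (fun l : ZMod q => (∑ r : ZMod q, e ((a : ZMod q) * r ^ 2 - r * l)) * e (x * l)) ((l : ℕ) : ZMod q) := by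
    intro l
    simp only [Gs, Int.cast_natCast]
    congr 1
    have := stdc q (x * (l : ℕ))
    push_cast at this
    rw [← this]
  have h2 : ec (a * x ^ 2 / q) = e (a * x ^ 2) := by
    have := stdc q (a * x ^ 2)
    push_cast at this
    rw [← this]
  rw [Finset.sum_congr rfl fun l _ => h1 l, sum_fin_zmod q (fun l : ZMod q => (∑ r : ZMod q, e ((a : ZMod q) * r ^ 2 - r * l)) * e (x * l)), h2]
  have h3 : ∀ l : ZMod q, (∑ r : ZMod q, e ((a : ZMod q) * r ^ 2 - r * l)) * e (x * l) = ∑ r : ZMod q, e ((a : ZMod q) * r ^ 2) * e (l * (x - r)) := by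
    intro l
    rw [Finset.sum_mul]
    refine Finset.sum_congr rfl fun r _ => ?_
    rw [← AddChar.map_add_eq_mul, ← AddChar.map_add_eq_mul]
    congr 1; ring
  simp only [h3]
  rw [Finset.sum_comm]
  simp only [← Finset.mul_sum, AddChar.sum_mulShift _ hprim, ZMod.card]
  rw [Finset.sum_eq_single (x : ZMod q)]
  · simp; field_simp
  · intro r _ hr
    rw [if_neg (sub_ne_zero.2 hr.symm)]; simp
  · simp

theorem Gs_periodic (q : ℕ) [NeZero q] (a v w : ℤ) (h : (q:ℤ) ∣ v - w) : Gs q a v = Gs q a w := by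
  have : (v : ZMod q) = (w : ZMod q) := by
    rw [← sub_eq_zero, ← Int.cast_sub, ZMod.intCast_zmod_eq_zero_iff_dvd]; exact h
  simp only [Gs, this]

def zz (τ : ℝ) : ℂ := 1 - τ * Complex.I
def AA (s τ : ℝ) : ℂ := 2 * zz τ / (s:ℂ) ^ 2
def gam (s τ : ℝ) : ℂ := (s:ℂ)⁻¹ * (1 / AA s τ ^ (1 / 2 : ℂ))
/-- one-dimensional kernel -/
def k1 (s : ℝ) (q : ℕ) (a : ℤ) (τ : ℝ) (x : ℤ) : ℂ :=
  (s:ℂ)⁻¹ * ec (a * x ^ 2 / q) * Complex.exp (-π * AA s τ * x ^ 2)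

theorem zz_norm (τ : ℝ) : ‖zz τ‖ = Real.sqrt (1 + τ ^ 2) := by
  rw [Complex.norm_eq_sqrt_sq_add_sq]; congr 1; simp [zz]

theorem zz_ne (τ : ℝ) : zz τ ≠ 0 := by
  intro h; have := congrArg Complex.re h; simp [zz] at this

theorem AA_re {s : ℝ} (τ : ℝ) (hs : 0 < s) : (AA s τ).re = 2 / s ^ 2 := by
  have : AA s τ = ((2 / s ^ 2 : ℝ) : ℂ) * zz τ := by unfold AA; push_cast; ring
  rw [this, Complex.re_ofReal_mul]; simp [zz]

theorem AA_inv_re {s : ℝ} (τ : ℝ) (hs : 0 < s) : ((AA s τ)⁻¹).re = s ^ 2 / (2 * (1 + τ ^ 2)) := by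
  have : (AA s τ)⁻¹ = ((s ^ 2 / 2 : ℝ) : ℂ) * (zz τ)⁻¹ := by unfold AA; push_cast; field_simp
  rw [this, Complex.re_ofReal_mul, Complex.inv_re]
  have h2 : Complex.normSq (zz τ) = 1 + τ ^ 2 := by
    rw [Complex.normSq_eq_norm_sq, zz_norm, Real.sq_sqrt (by positivity)]
  rw [h2]; simp [zz]; field_simp

theorem AA_inv_norm {s : ℝ} (τ : ℝ) (hs : 0 < s) : ‖(AA s τ)⁻¹‖ = s ^ 2 / (2 * Real.sqrt (1 + τ ^ 2)) := by
  unfold AA; rw [norm_inv, norm_div, norm_mul, zz_norm, norm_pow]; simp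

theorem gam_norm {s : ℝ} (τ : ℝ) (hs : 0 < s) : ‖gam s τ‖ ^ 2 = 1 / (2 * Real.sqrt (1 + τ ^ 2)) := by
  have h0 : AA s τ ≠ 0 := by
    intro h; have := AA_re τ hs; rw [h, Complex.zero_re] at this; have h3 : 0 < 2 / s ^ 2 := by positivity
    linarith
  have h1 : (AA s τ ^ (1/2:ℂ)) ^ 2 = AA s τ := by
    rw [← Complex.cpow_nat_mul]; simp
  have : (gam s τ) ^ 2 = ((s:ℂ)⁻¹) ^ 2 * (AA s τ)⁻¹ := by
    unfold gam; rw [mul_pow, one_div, inv_pow, inv_pow, h1]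
  rw [← norm_pow, this, norm_mul, AA_inv_norm τ hs, norm_pow, norm_inv, Complex.norm_real, Real.norm_of_nonneg hs.le]
  have := Real.sqrt_pos.2 (show 0 < 1 + τ ^ 2 by positivity)
  field_simp

theorem gauss_summable {a : ℂ} (ha : 0 < a.re) (x : ℂ) : Summable fun n : ℤ => ‖Complex.exp (-π * a * ((n:ℂ) + x) ^ 2)‖ := by
  have h := (summable_jacobiTheta₂_term_iff (a * Complex.I * x) (a * Complex.I)).2 (by simpa using ha)
  have h2 := (h.mul_left (Complex.exp (-π * a * x ^ 2))).norm
  refine h2.congr fun n => ?_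
  rw [jacobiTheta₂_term, ← Complex.exp_add]
  congr 2
  linear_combination (2 * π * n * a * x + π * n ^ 2 * a) * Complex.I_sq

theorem theta_formula {s : ℝ} (hs : 0 < s) (q : ℕ) [NeZero q] (a : ℤ) (τ ξ : ℝ) :
    (Summable fun x : ℤ => ‖k1 s q a τ x‖) ∧
    (Summable fun v : ℤ => ‖Gs q a v * Complex.exp (-π * (AA s τ)⁻¹ * ((v + q * ξ) / q) ^ 2)‖) ∧
    ∑' x : ℤ, k1 s q a τ x * ec (x * ξ) = (q:ℂ)⁻¹ * gam s τ * ∑' v : ℤ, Gs q a v * Complex.exp (-π * (AA s τ)⁻¹ * ((v + q * ξ) / q) ^ 2) := by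
  have hA : 0 < (AA s τ).re := by rw [AA_re τ hs]; positivity
  have hA' : 0 < ((AA s τ)⁻¹).re := by rw [AA_inv_re τ hs]; positivity
  have hq : (q:ℂ) ≠ 0 := by exact_mod_cast NeZero.ne q
  have hsum : Summable fun x : ℤ => ‖k1 s q a τ x‖ := by
    have := (gauss_summable hA 0).mul_left ‖(s:ℂ)⁻¹‖
    refine this.congr fun x => ?_
    unfold k1; rw [norm_mul, norm_mul, norm_ec, mul_one, add_zero]
  have hterm : ∀ l : Fin q, Summable fun n : ℤ => ‖Complex.exp (-π * (AA s τ)⁻¹ * ((n:ℂ) + ((l:ℕ) / q + ξ)) ^ 2)‖ := fun l => gauss_summable hA' _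
  have hG : Summable fun v : ℤ => ‖Gs q a v * Complex.exp (-π * (AA s τ)⁻¹ * ((v + q * ξ) / q) ^ 2)‖ := by
    rw [← (Int.divModEquiv q).symm.summable_iff]
    rw [← (Equiv.prodComm _ _).summable_iff]
    refine (summable_prod_of_nonneg (fun _ => norm_nonneg _)).2 ⟨fun l => ?_, Summable.of_finite⟩
    refine ((hterm l).mul_left ‖Gs q a (l:ℕ)‖).congr fun n => ?_
    simp only [Function.comp, Equiv.prodComm_apply, Prod.swap_prod_mk, Int.divModEquiv_symm_apply]
    rw [norm_mul, Gs_periodic q a (n * q + (l:ℕ)) (l:ℕ) (by simp)]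
    congr 4
    push_cast; field_simp; ring
  refine ⟨hsum, hG, ?_⟩
  have e1 : ∀ x : ℤ, k1 s q a τ x * ec (x * ξ) = ∑ l : Fin q, ((q:ℂ)⁻¹ * (s:ℂ)⁻¹ * Gs q a (l:ℕ)) * Complex.exp (-π * AA s τ * x ^ 2 + 2 * π * (Complex.I * ((l:ℕ) / q + ξ)) * x) := by
    intro x
    unfold k1
    rw [finFourier, Finset.mul_sum, Finset.mul_sum, Finset.sum_mul, Finset.sum_mul]
    refine Finset.sum_congr rfl fun l _ => ?_
    have : ec ((x:ℝ) * (l:ℕ) / q) * Complex.exp (-π * AA s τ * x ^ 2) * ec (x * ξ) = Complex.exp (-π * AA s τ * x ^ 2 + 2 * π * (Complex.I * ((l:ℕ) / q + ξ)) * x) := by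
      unfold ec; rw [← Complex.exp_add, ← Complex.exp_add]; congr 1; push_cast; ring
    rw [← this]; ring
  have e2 : ∀ l : Fin q, Summable fun x : ℤ => ((q:ℂ)⁻¹ * (s:ℂ)⁻¹ * Gs q a (l:ℕ)) * Complex.exp (-π * AA s τ * x ^ 2 + 2 * π * (Complex.I * ((l:ℕ) / q + ξ)) * x) := by
    intro l
    refine Summable.mul_left _ (Summable.of_norm ?_)
    refine (gauss_summable hA 0).congr fun x => ?_
    rw [Complex.norm_exp, Complex.norm_exp]; congr 1
    have : (2 * π * (Complex.I * ((l:ℕ) / q + ξ)) * x : ℂ) = ((2 * π * ((l:ℕ) / q + ξ) * x : ℝ) : ℂ) * Complex.I := by push_cast; ring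
    rw [Complex.add_re, this, Complex.re_ofReal_mul]; simp
  rw [tsum_congr e1, Summable.tsum_finsetSum (fun l _ => e2 l)]
  rw [← (Int.divModEquiv q).symm.tsum_eq, ← (Equiv.prodComm _ _).tsum_eq]
  rw [Summable.tsum_prod]
  rotate_left
  · exact (Equiv.prodComm _ _).summable_iff.2 ((Int.divModEquiv q).symm.summable_iff.2 hG.of_norm)
  rw [tsum_fintype, Finset.mul_sum]
  refine Finset.sum_congr rfl fun l _ => ?_
  rw [tsum_mul_left, Complex.tsum_exp_neg_quadratic hA]
  have e3 : ∀ n : ℤ, Gs q a ((Int.divModEquiv q).symm ((Equiv.prodComm (Fin q) ℤ) (l, n))) * Complex.exp (-π * (AA s τ)⁻¹ * ((((Int.divModEquiv q).symm ((Equiv.prodComm (Fin q) ℤ) (l, n)) : ℤ) + q * ξ) / q) ^ 2)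
      = Gs q a (l:ℕ) * Complex.exp (-π * (AA s τ)⁻¹ * ((n:ℂ) + ((l:ℕ) / q + ξ)) ^ 2) := by
    intro n
    simp only [Equiv.prodComm_apply, Prod.swap_prod_mk, Int.divModEquiv_symm_apply]
    rw [Gs_periodic q a (n * q + (l:ℕ)) (l:ℕ) (by simp)]
    congr 3
    push_cast; field_simp; ring
  rw [tsum_congr e3, tsum_mul_left, ← (Equiv.neg ℤ).tsum_eq]
  have e4 : ∀ n : ℤ, Complex.exp (-π / AA s τ * (((Equiv.neg ℤ n : ℤ) : ℂ) + Complex.I * (Complex.I * ((l:ℕ) / q + ξ))) ^ 2) = Complex.exp (-π * (AA s τ)⁻¹ * ((n:ℂ) + ((l:ℕ) / q + ξ)) ^ 2) := by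
    intro n
    congr 1
    rw [← mul_assoc, Complex.I_mul_I, div_eq_mul_inv]
    congr 1
    simp only [Equiv.neg_apply]; push_cast; ring
  rw [tsum_congr e4]
  unfold gam; ring

def Xs (s : ℝ) (q : ℕ) (τ : ℝ) : ℝ := s ^ 2 / ((q:ℝ) ^ 2 * (1 + τ ^ 2))
def Bq (q : ℕ) (τ : ℝ) : ℝ := Real.sqrt (1 / (q * Real.sqrt (1 + τ ^ 2)))
def th (s : ℝ) (q : ℕ) (a : ℤ) (τ ξ : ℝ) : ℂ := ∑' x : ℤ, k1 s q a τ x * ec (x * ξ)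
def ge (s : ℝ) (q : ℕ) (τ y : ℝ) : ℂ := Complex.exp (-π * (AA s τ)⁻¹ * (y / q) ^ 2)
def mn (s : ℝ) (q : ℕ) [NeZero q] (a : ℤ) (τ : ℝ) (v : ℤ) (y : ℝ) : ℂ :=
  (q:ℂ)⁻¹ * gam s τ * Gs q a v * ge s q τ y

theorem Xs_pos {s : ℝ} (hs : 0 < s) (q : ℕ) [NeZero q] (τ : ℝ) : 0 < Xs s q τ := by
  have : (0:ℝ) < q := by exact_mod_cast Nat.pos_of_ne_zero (NeZero.ne q)
  unfold Xs; positivity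

theorem ge_norm {s : ℝ} (hs : 0 < s) (q : ℕ) [NeZero q] (τ y : ℝ) : ‖ge s q τ y‖ = Real.exp (-(π / 2 * Xs s q τ * y ^ 2)) := by
  have hq : (0:ℝ) < q := by exact_mod_cast Nat.pos_of_ne_zero (NeZero.ne q)
  unfold ge
  rw [Complex.norm_exp]; congr 1
  have : (-π * (AA s τ)⁻¹ * (y / q) ^ 2 : ℂ) = ((-π * (y / q) ^ 2 : ℝ) : ℂ) * (AA s τ)⁻¹ := by push_cast; ring
  rw [this, Complex.re_ofReal_mul, AA_inv_re τ hs, Xs]; field_simp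

theorem exp_neg_le {u : ℝ} (hu : 0 < u) : Real.exp (-u) ≤ 1 / u := by
  rw [Real.exp_neg, one_div]
  apply inv_anti₀ hu
  linarith [Real.add_one_le_exp u]

theorem pref {s : ℝ} (hs : 0 < s) (q : ℕ) [NeZero q] (a : ℤ) (h : IsCoprime a (q:ℤ)) (τ : ℝ) (v : ℤ) :
    ‖(q:ℂ)⁻¹ * gam s τ * Gs q a v‖ ≤ Bq q τ := by
  have hq : (0:ℝ) < q := by exact_mod_cast Nat.pos_of_ne_zero (NeZero.ne q)
  have hZ := Real.sqrt_pos.2 (show 0 < 1 + τ ^ 2 by positivity)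
  apply Real.le_sqrt_of_sq_le
  rw [norm_mul, norm_mul, mul_pow, mul_pow, gam_norm τ hs]
  have := Gs_norm q a v h
  calc _ ≤ ‖(q:ℂ)⁻¹‖ ^ 2 * (1 / (2 * Real.sqrt (1 + τ ^ 2))) * (2 * q) := by gcongr
    _ = _ := by
      rw [norm_inv, Complex.norm_natCast]; field_simp

theorem mn_norm {s : ℝ} (hs : 0 < s) (q : ℕ) [NeZero q] (a : ℤ) (h : IsCoprime a (q:ℤ)) (τ : ℝ) (v : ℤ) (y : ℝ) :
    ‖mn s q a τ v y‖ ≤ Bq q τ * Real.exp (-(π / 2 * Xs s q τ * y ^ 2)) := by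
  unfold mn; rw [norm_mul, ge_norm hs]
  gcongr; exact pref hs q a h τ v

set_option maxHeartbeats 1000000 in
theorem theta_est : ∃ C : ℝ, 1 ≤ C ∧ ∀ (s : ℝ), 0 < s → ∀ (q : ℕ) [NeZero q] (a : ℤ), IsCoprime a (q:ℤ) → ∀ (τ ξ : ℝ) (v0 : ℤ),
    |(v0:ℝ) + q * ξ| ≤ 1 / 2 → ‖th s q a τ ξ - mn s q a τ v0 (v0 + q * ξ)‖ ≤ Bq q τ * (C / Xs s q τ) := by
  have hS : Summable fun u : ℤ => 1 / (u:ℝ) ^ 2 := Real.summable_one_div_int_pow.2 (by norm_num)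
  set S := ∑' u : ℤ, 1 / (u:ℝ) ^ 2 with hSd
  have hS0 : 0 ≤ S := tsum_nonneg fun u => by positivity
  refine ⟨1 + 4 * S, by linarith, ?_⟩
  intro s hs q _ a h τ ξ v0 hv
  have hX := Xs_pos hs q τ
  have hB : 0 ≤ Bq q τ := Real.sqrt_nonneg _
  obtain ⟨-, hG, hth⟩ := theta_formula hs q a τ ξ
  have e1 : th s q a τ ξ = ∑' v : ℤ, mn s q a τ v (v + q * ξ) := by
    unfold th; rw [hth, ← tsum_mul_left]
    refine tsum_congr fun v => ?_
    unfold mn ge; push_cast; ring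
  have hsum : Summable fun v : ℤ => mn s q a τ v (v + q * ξ) := by
    refine (hG.of_norm.mul_left ((q:ℂ)⁻¹ * gam s τ)).congr fun v => ?_
    unfold mn ge; push_cast; ring
  rw [e1, hsum.tsum_eq_add_tsum_ite v0, add_sub_cancel_left]
  have hS2 : Summable fun v : ℤ => 1 / ((v - v0 : ℤ):ℝ) ^ 2 := (Equiv.subRight v0).summable_iff.2 hS
  have hS3 : ∑' v : ℤ, 1 / ((v - v0 : ℤ):ℝ) ^ 2 = S := (Equiv.subRight v0).tsum_eq (fun u : ℤ => 1 / (u:ℝ) ^ 2)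
  have hb : ∀ v : ℤ, ‖(if v = v0 then 0 else mn s q a τ v (v + q * ξ))‖ ≤ Bq q τ * (4 / Xs s q τ) * (1 / ((v - v0 : ℤ):ℝ) ^ 2) := by
    intro v
    split_ifs with hvv
    · rw [norm_zero]; positivity
    · refine (mn_norm hs q a h τ v _).trans ?_
      rw [mul_assoc (Bq q τ)]
      refine mul_le_mul_of_nonneg_left ?_ hB
      set u : ℝ := ((v - v0 : ℤ):ℝ) with hu
      have hu1 : 1 ≤ |u| := by
        rw [hu, ← Int.cast_abs]; exact_mod_cast Int.one_le_abs (sub_ne_zero.2 hvv)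
      set y : ℝ := (v0:ℝ) + q * ξ with hy
      have hvy : (v:ℝ) + q * ξ = u + y := by rw [hu, hy]; push_cast; ring
      rw [hvy]
      have h1 : |u| / 2 ≤ |u + y| := by
        have := abs_sub_abs_le_abs_sub u (-y); rw [abs_neg, sub_neg_eq_add] at this; linarith
      have h2 : u ^ 2 / 4 ≤ (u + y) ^ 2 := by
        rw [← sq_abs u, ← sq_abs (u + y)]; nlinarith [abs_nonneg u]
      have hu0 : 0 < u ^ 2 := by rw [← sq_abs]; positivity
      have h3 : Xs s q τ * u ^ 2 / 4 ≤ π / 2 * Xs s q τ * (u + y) ^ 2 := by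
        have := Real.pi_gt_three
        have : Xs s q τ * (u ^ 2 / 4) ≤ Xs s q τ * (u + y) ^ 2 := by gcongr
        nlinarith [mul_nonneg hX.le (sq_nonneg (u + y))]
      calc _ ≤ Real.exp (-(Xs s q τ * u ^ 2 / 4)) := by gcongr
        _ ≤ 1 / (Xs s q τ * u ^ 2 / 4) := exp_neg_le (by positivity)
        _ = _ := by field_simp
  refine (tsum_of_norm_bounded ((hS2.mul_left (Bq q τ * (4 / Xs s q τ))).hasSum) hb).trans ?_
  rw [tsum_mul_left, hS3, mul_assoc (Bq q τ)]
  refine mul_le_mul_of_nonneg_left ?_ hB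
  rw [div_mul_eq_mul_div]; gcongr; linarith

theorem prod_diff {ι : Type*} (s : Finset ι) (f g : ι → ℂ) (M ε : ℝ) (hM : 0 ≤ M) (hf : ∀ i ∈ s, ‖f i‖ ≤ M) (hg : ∀ i ∈ s, ‖g i‖ ≤ M)
    (he : ∀ i ∈ s, ‖f i - g i‖ ≤ M * ε) : ‖∏ i ∈ s, f i - ∏ i ∈ s, g i‖ ≤ s.card * M ^ s.card * ε := by
  classical
  induction s using Finset.induction_on with
  | empty => simp
  | insert a s ha ih =>
    rw [Finset.prod_insert ha, Finset.prod_insert ha, Finset.card_insert_of_notMem ha]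
    have h1 : f a * ∏ i ∈ s, f i - g a * ∏ i ∈ s, g i = f a * (∏ i ∈ s, f i - ∏ i ∈ s, g i) + (f a - g a) * ∏ i ∈ s, g i := by ring
    have ih' := ih (fun i hi => hf i (Finset.mem_insert_of_mem hi)) (fun i hi => hg i (Finset.mem_insert_of_mem hi)) (fun i hi => he i (Finset.mem_insert_of_mem hi))
    have h2 : ‖∏ i ∈ s, g i‖ ≤ M ^ s.card := by
      rw [norm_prod, ← Finset.prod_const]; exact Finset.prod_le_prod (fun _ _ => norm_nonneg _) fun i hi => hg i (Finset.mem_insert_of_mem hi)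
    have hfa := hf a (Finset.mem_insert_self _ _)
    have hea := he a (Finset.mem_insert_self _ _)
    rw [h1]
    calc _ ≤ ‖f a‖ * ‖∏ i ∈ s, f i - ∏ i ∈ s, g i‖ + ‖f a - g a‖ * ‖∏ i ∈ s, g i‖ := by
          refine (norm_add_le _ _).trans ?_; rw [norm_mul, norm_mul]
      _ ≤ M * (s.card * M ^ s.card * ε) + (M * ε) * M ^ s.card := by
          refine add_le_add (mul_le_mul hfa ih' (norm_nonneg _) hM) (mul_le_mul hea h2 (norm_nonneg _) ((norm_nonneg _).trans hea))
      _ = _ := by push_cast; ring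

theorem geo_sum : ∃ C : ℝ, 0 < C ∧ ∀ (W : ℝ), 0 ≤ W → ∀ s : Finset ℕ, ∑ k ∈ s, min (4 ^ k * W) (4 ^ k * W)⁻¹ ≤ C := by
  have hs : Summable fun n : ℤ => (1/4:ℝ) ^ n.natAbs := by
    apply Summable.of_nat_of_neg
    · simpa using summable_geometric_of_lt_one (r := (1/4:ℝ)) (by norm_num) (by norm_num)
    · simpa using summable_geometric_of_lt_one (r := (1/4:ℝ)) (by norm_num) (by norm_num)
  have h0 : 0 ≤ ∑' n : ℤ, (1/4:ℝ) ^ n.natAbs := tsum_nonneg fun n => by positivity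
  refine ⟨4 * (∑' n : ℤ, (1/4:ℝ) ^ n.natAbs) + 1, by positivity, ?_⟩
  intro W hW s
  rcases hW.eq_or_lt with rfl | hW
  · simp; positivity
  obtain ⟨n, hn1, hn2⟩ := exists_mem_Ico_zpow hW (show (1:ℝ) < 4 by norm_num)
  have hb : ∀ k : ℕ, min (4 ^ k * W) (4 ^ k * W)⁻¹ ≤ 4 * (1/4:ℝ) ^ ((k:ℤ) + n).natAbs := by
    intro k
    have e1 : (4:ℝ) ^ ((k:ℤ) + n) ≤ 4 ^ k * W := by
      rw [zpow_add₀ (by norm_num), zpow_natCast]; gcongr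
    have e2 : 4 ^ k * W ≤ 4 * (4:ℝ) ^ ((k:ℤ) + n) := by
      rw [zpow_add₀ (by norm_num), zpow_natCast]
      rw [zpow_add_one₀ (by norm_num)] at hn2
      nlinarith [pow_pos (show (0:ℝ) < 4 by norm_num) k]
    rcases le_total 0 ((k:ℤ) + n) with h | h
    · refine (min_le_right _ _).trans ?_
      have : (4:ℝ) ^ ((k:ℤ) + n) = 4 ^ ((k:ℤ) + n).natAbs := by
        rw [← zpow_natCast, Int.natCast_natAbs, abs_of_nonneg h]
      rw [this] at e1
      rw [one_div, inv_pow]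
      calc _ ≤ ((4:ℝ) ^ ((k:ℤ) + n).natAbs)⁻¹ := inv_anti₀ (by positivity) e1
        _ ≤ _ := by
          have : 0 < ((4:ℝ) ^ ((k:ℤ) + n).natAbs)⁻¹ := by positivity
          linarith
    · refine (min_le_left _ _).trans (e2.trans_eq ?_)
      congr 1
      rw [one_div, inv_pow, ← zpow_natCast, Int.natCast_natAbs, abs_of_nonpos h, zpow_neg, inv_inv]
  calc _ ≤ ∑ k ∈ s, 4 * (1/4:ℝ) ^ ((k:ℤ) + n).natAbs := Finset.sum_le_sum fun k _ => hb k
    _ = 4 * ∑ k ∈ s, (1/4:ℝ) ^ ((k:ℤ) + n).natAbs := by rw [Finset.mul_sum]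
    _ ≤ 4 * ∑' n : ℤ, (1/4:ℝ) ^ n.natAbs := by
        gcongr
        have hinj : Function.Injective fun k : ℕ => (k:ℤ) + n := fun x y h => by simpa using h
        rw [show ∑ k ∈ s, (1/4:ℝ) ^ ((k:ℤ) + n).natAbs = ∑ m ∈ s.map ⟨_, hinj⟩, (1/4:ℝ) ^ m.natAbs by simp]
        exact hs.sum_le_tsum _ fun _ _ => by positivity
    _ ≤ _ := by linarith

def Kk {d : ℕ} (s : ℝ) (q : ℕ) (a : ℤ) (τ : ℝ) (m : Fin d → ℤ) : ℂ := ∏ i, k1 s q a τ (m i)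

theorem Kk_ft {d : ℕ} {s : ℝ} (hs : 0 < s) (q : ℕ) [NeZero q] (a : ℤ) (τ : ℝ) :
    (Summable fun m : Fin d → ℤ => ‖Kk s q a τ m‖) ∧ ∀ ξ : Fin d → ℝ, ftZ (Kk s q a τ) ξ = ∏ i, th s q a τ (ξ i) := by
  have h1 := (theta_formula hs q a τ 0).1
  refine ⟨?_, fun ξ => ?_⟩
  · exact (tsum_pi_prodC (fun _ : Fin d => k1 s q a τ) (fun _ => h1)).1
  · have := (tsum_pi_prodC (fun (i : Fin d) x => k1 s q a τ x * ec (x * ξ i)) (fun i => by simpa [norm_ec] using h1)).2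
    unfold th; rw [← this, ftZ]
    refine tsum_congr fun m => ?_
    rw [Kk, dotp, ec_sum, Finset.prod_mul_distrib]

theorem prod_th (d : ℕ) (hd : 0 < d) : ∃ C : ℝ, 1 ≤ C ∧ ∀ (s : ℝ), 0 < s → ∀ (q : ℕ) [NeZero q] (a : ℤ), IsCoprime a (q:ℤ) → ∀ (τ : ℝ) (ξ : Fin d → ℝ)
    (v : Fin d → ℤ) (y : Fin d → ℝ), (∀ i, y i = v i + q * ξ i) → (∀ i, |y i| ≤ 1 / 2) → 1 / 65 ≤ Xs s q τ →
    ‖∏ i, th s q a τ (ξ i) - ∏ i, mn s q a τ (v i) (y i)‖ ≤ C * Bq q τ ^ d * (1 / Xs s q τ) ∧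
    ‖∏ i, th s q a τ (ξ i)‖ ≤ C * Bq q τ ^ d ∧
    ∀ i, y i ≠ 0 → ‖∏ i, th s q a τ (ξ i)‖ ≤ C * Bq q τ ^ d * (1 / (Xs s q τ * y i ^ 2)) := by
  obtain ⟨C, hC, hth⟩ := theta_est
  set D := 1 + 65 * C with hD
  have hD1 : 1 ≤ D := by linarith
  refine ⟨(d + 1) * D ^ d * (1 + C), ?_, ?_⟩
  · have : (1:ℝ) ≤ D ^ d := one_le_pow₀ hD1
    have h1 : (1:ℝ) ≤ d + 1 := by have : (0:ℝ) ≤ d := by positivity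
                                  linarith
    nlinarith [mul_nonneg (sub_nonneg.2 h1) (sub_nonneg.2 this)]
  intro s hs q _ a hco τ ξ v y hy hy2 hX
  have hX0 := Xs_pos hs q τ
  set X := Xs s q τ with hXd
  set B := Bq q τ with hBd
  have hB : 0 ≤ B := Real.sqrt_nonneg _
  have hD0 : 0 ≤ D := by linarith
  have hdiff : ∀ i, ‖th s q a τ (ξ i) - mn s q a τ (v i) (y i)‖ ≤ B * (C / X) := by
    intro i; have := hth s hs q a hco τ (ξ i) (v i) (by rw [← hy]; exact hy2 i); rwa [← hy] at this
  have hCX : C / X ≤ 65 * C := by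
    rw [div_le_iff₀ hX0]; nlinarith
  have hmn : ∀ i, ‖mn s q a τ (v i) (y i)‖ ≤ B * Real.exp (-(π / 2 * X * y i ^ 2)) := fun i => mn_norm hs q a hco τ _ _
  have hmn1 : ∀ i, ‖mn s q a τ (v i) (y i)‖ ≤ B := fun i => (hmn i).trans (by
    refine mul_le_of_le_one_right hB (Real.exp_le_one_iff.2 ?_)
    have := Real.pi_pos
    have : 0 ≤ π / 2 * X * y i ^ 2 := by positivity
    linarith)
  have hth1 : ∀ i, ‖th s q a τ (ξ i)‖ ≤ B * D := by
    intro i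
    have h1 : ‖th s q a τ (ξ i)‖ ≤ ‖th s q a τ (ξ i) - mn s q a τ (v i) (y i)‖ + ‖mn s q a τ (v i) (y i)‖ := by
      simpa using norm_add_le (th s q a τ (ξ i) - mn s q a τ (v i) (y i)) (mn s q a τ (v i) (y i))
    have h2 := hdiff i
    have h3 := hmn1 i
    have h4 : B * (C / X) ≤ B * (65 * C) := by gcongr
    rw [hD]; linarith
  have hDd : (1:ℝ) ≤ D ^ d := one_le_pow₀ hD1
  have hBd : 0 ≤ B ^ d := by positivity
  have hd0 : (0:ℝ) ≤ d := by positivity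
  refine ⟨?_, ?_, ?_⟩
  · have := prod_diff Finset.univ (fun i => th s q a τ (ξ i)) (fun i => mn s q a τ (v i) (y i)) (B * D) (C / X) (by positivity)
      (fun i _ => hth1 i) (fun i _ => (hmn1 i).trans (le_mul_of_one_le_right hB hD1))
      (fun i _ => (hdiff i).trans (by rw [mul_assoc]; gcongr; exact le_mul_of_one_le_left (by positivity) hD1))
    rw [Finset.card_univ, Fintype.card_fin, mul_pow] at this
    refine this.trans ?_
    calc (d:ℝ) * (B ^ d * D ^ d) * (C / X) = (d * D ^ d * C) * (B ^ d * (1 / X)) := by ring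
      _ ≤ ((d + 1) * D ^ d * (1 + C)) * (B ^ d * (1 / X)) := by gcongr <;> linarith
      _ = _ := by ring
  · rw [norm_prod]
    calc _ ≤ ∏ i : Fin d, B * D := Finset.prod_le_prod (fun _ _ => norm_nonneg _) fun i _ => hth1 i
      _ = D ^ d * B ^ d := by simp [mul_pow]; ring
      _ ≤ _ := by
        gcongr
        rw [mul_comm (_ + _), mul_assoc]
        refine le_mul_of_one_le_right (by positivity) ?_
        nlinarith
  · intro i hi
    rw [norm_prod, ← Finset.mul_prod_erase _ _ (Finset.mem_univ i)]
    have hy0 : 0 < y i ^ 2 := by positivity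
    have hy1 : y i ^ 2 ≤ 1 := by rw [← sq_abs]; nlinarith [hy2 i, abs_nonneg (y i)]
    have h1 : ‖th s q a τ (ξ i)‖ ≤ B * ((1 + C) * (1 / (X * y i ^ 2))) := by
      have h1 : ‖th s q a τ (ξ i)‖ ≤ ‖th s q a τ (ξ i) - mn s q a τ (v i) (y i)‖ + ‖mn s q a τ (v i) (y i)‖ := by
        simpa using norm_add_le (th s q a τ (ξ i) - mn s q a τ (v i) (y i)) (mn s q a τ (v i) (y i))
      have h2 := hdiff i
      have h3 : ‖mn s q a τ (v i) (y i)‖ ≤ B * (1 / (X * y i ^ 2)) := by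
        refine (hmn i).trans ?_
        gcongr
        calc _ ≤ Real.exp (-(X * y i ^ 2)) := by
              have := Real.pi_gt_three
              gcongr; nlinarith
          _ ≤ _ := exp_neg_le (by positivity)
      have h4 : C / X ≤ C * (1 / (X * y i ^ 2)) := by
        rw [mul_one_div]; gcongr; nlinarith
      have h5 : B * (C / X) ≤ B * (C * (1 / (X * y i ^ 2))) := by gcongr
      linarith
    calc _ ≤ (B * ((1 + C) * (1 / (X * y i ^ 2)))) * ∏ j ∈ Finset.univ.erase i, (B * D) :=
          mul_le_mul h1 (Finset.prod_le_prod (fun _ _ => norm_nonneg _) fun i _ => hth1 i) (Finset.prod_nonneg fun _ _ => norm_nonneg _) (by positivity)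
      _ = (B * B ^ (d - 1)) * (D ^ (d - 1) * (1 + C)) * (1 / (X * y i ^ 2)) := by
          rw [Finset.prod_const, Finset.card_erase_of_mem (Finset.mem_univ i), Finset.card_univ, Fintype.card_fin, mul_pow]; ring
      _ = B ^ d * (D ^ (d - 1) * (1 + C)) * (1 / (X * y i ^ 2)) := by rw [← pow_succ', Nat.sub_add_cancel hd]
      _ ≤ B ^ d * ((d + 1) * D ^ d * (1 + C)) * (1 / (X * y i ^ 2)) := by
          have : D ^ (d - 1) ≤ (d + 1) * D ^ d := by
            have h1 : D ^ (d - 1) ≤ D ^ d := pow_le_pow_right₀ hD1 (by omega)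
            nlinarith
          gcongr
      _ = _ := by ring

/-- hypothesis on `ψ` -/
def HPsi {d : ℕ} (ψ : SchwartzMap (Fin d → ℝ) ℝ) : Prop := ∀ ξ : Fin d → ℝ, (ftR (fun x => ψ x) ξ).im = 0 ∧
      Set.indicator (cubeQ d) (fun _ => (1 : ℝ)) ξ ≤ (ftR (fun x => ψ x) ξ).re ∧
      (ftR (fun x => ψ x) ξ).re ≤ Set.indicator (cube2Q d) (fun _ => (1 : ℝ)) ξ

structure Vld (q : ℕ) (τ : ℝ) (j k : ℕ) : Prop where
  h1 : 8 * (q:ℝ) ≤ 2 ^ k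
  h2 : q * |τ| ≤ 2 ^ (k + 3)
  h3 : 2 ^ (j + 3) ≤ k

theorem Vld.X {q : ℕ} [NeZero q] {τ : ℝ} {j k : ℕ} (h : Vld q τ j k) : 1 / 65 ≤ Xs (2 ^ k) q τ := by
  have hq : (0:ℝ) < q := by exact_mod_cast Nat.pos_of_ne_zero (NeZero.ne q)
  unfold Xs
  rw [div_le_div_iff₀ (by norm_num) (by positivity)]
  have h1 := h.h1
  have h2 := h.h2
  set s : ℝ := 2 ^ k with hs
  have hs0 : 0 < s := by positivity
  have h2' : q * |τ| ≤ 8 * s := by rw [pow_add] at h2; linarith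
  have h3 : (q * |τ|) ^ 2 ≤ (8 * s) ^ 2 := by gcongr
  rw [mul_pow, sq_abs] at h3
  nlinarith

theorem exY {d : ℕ} (hd : 0 < d) (q : ℕ) (ξ : Fin d → ℝ) : ∃ (v : Fin d → ℤ) (y : Fin d → ℝ) (i0 : Fin d), (∀ i, y i = v i + q * ξ i) ∧ (∀ i, |y i| ≤ 1 / 2) ∧
    ∀ i, |y i| ≤ |y i0| := by
  haveI : Nonempty (Fin d) := ⟨⟨0, hd⟩⟩
  obtain ⟨i0, h⟩ := Finite.exists_max fun i : Fin d => |((-round (q * ξ i) : ℤ) : ℝ) + q * ξ i|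
  refine ⟨fun i => -round (q * ξ i), fun i => ((-round (q * ξ i) : ℤ) : ℝ) + q * ξ i, i0, fun i => rfl, fun i => ?_, h⟩
  have := abs_sub_round ((q:ℝ) * ξ i)
  push_cast
  rwa [neg_add_eq_sub]

theorem caseA {d : ℕ} (hd : 0 < d) (ψ : SchwartzMap (Fin d → ℝ) ℝ) (hψ : HPsi ψ) :
    ∃ C : ℝ, 0 < C ∧ ∀ (q : ℕ) [NeZero q] (a : ℤ), IsCoprime a (q:ℤ) → ∀ (τ : ℝ) (j : ℕ), q ≤ 2 ^ j → ∀ (ξ : Fin d → ℝ) (s : Finset ℕ),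
      (∀ k ∈ s, Vld q τ j k) → ∑ k ∈ s, (‖ftZ (DPc ψ j k) ξ‖ * ‖∏ i, th (2 ^ k) q a τ (ξ i)‖) ^ 2 ≤ C * ((Bq q τ ^ d) ^ 2 * (1 + τ ^ 2) / 4 ^ j) := by
  obtain ⟨C, hC, hth⟩ := prod_th d hd
  obtain ⟨G, hG, hgeo⟩ := geo_sum
  refine ⟨16 * C ^ 2 * G, by positivity, ?_⟩
  intro q _ a hco τ j hqj ξ s hs
  have hq : (0:ℝ) < q := by exact_mod_cast Nat.pos_of_ne_zero (NeZero.ne q)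
  obtain ⟨v, y, i0, hy, hy2, hmax⟩ := exY hd q ξ
  set B := Bq q τ with hBd
  have hB : 0 ≤ B := Real.sqrt_nonneg _
  set W := 4 * |y i0| ^ 2 / ((q:ℝ) ^ 2 * 4 ^ j) with hW
  have hW0 : 0 ≤ W := by positivity
  have key : ∀ k ∈ s, (‖ftZ (DPc ψ j k) ξ‖ * ‖∏ i, th (2 ^ k) q a τ (ξ i)‖) ^ 2 ≤ 16 * C ^ 2 * ((B ^ d) ^ 2 * (1 + τ ^ 2) / 4 ^ j) * min (4 ^ k * W) (4 ^ k * W)⁻¹ := by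
    intro k hk
    have hv := hs k hk
    obtain ⟨hD2, hD0⟩ := DPc_ft ψ hψ hv.h3 ξ
    by_cases hz : ftZ (DPc ψ j k) ξ = 0
    · rw [hz]; simp; positivity
    have hY : (q:ℝ) * 2 ^ j / (2 * 2 ^ k) < |y i0| := by
      by_contra hcon
      push Not at hcon
      refine hz (hD0 q (by exact_mod_cast hq) hqj (fun i => - v i) fun i => ?_)
      push_cast
      rw [sub_neg_eq_add, add_comm, ← hy]
      exact (hmax i).trans hcon
    have hY0 : 0 < |y i0| := lt_of_le_of_lt (by positivity) hY
    obtain ⟨-, t2, t3⟩ := hth (2 ^ k) (by positivity) q a hco τ ξ v y hy hy2 hv.X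
    have t3 := t3 i0 (abs_pos.1 hY0)
    set T := ‖∏ i, th (2 ^ k) q a τ (ξ i)‖ with hT
    have hT0 : 0 ≤ T := norm_nonneg _
    have hX := Xs_pos (show (0:ℝ) < 2 ^ k by positivity) q τ
    have hp : (4:ℝ) ^ k = (2 ^ k) ^ 2 := by rw [← pow_mul, mul_comm, pow_mul]; norm_num
    have hp' : (4:ℝ) ^ j = (2 ^ j) ^ 2 := by rw [← pow_mul, mul_comm, pow_mul]; norm_num
    have h4W : 1 ≤ 4 ^ k * W := by
      rw [hW, hp, hp']
      rw [div_lt_iff₀ (by positivity)] at hY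
      have : ((q:ℝ) * 2 ^ j) ^ 2 ≤ (|y i0| * (2 * 2 ^ k)) ^ 2 := by gcongr
      rw [mul_div_assoc', le_div_iff₀ (by positivity)]
      nlinarith
    have hmin : min (4 ^ k * W) (4 ^ k * W)⁻¹ = (4 ^ k * W)⁻¹ := min_eq_right ((inv_le_one_of_one_le₀ h4W).trans h4W)
    have hXW : 1 / (Xs (2 ^ k) q τ * y i0 ^ 2) = 4 * ((1 + τ ^ 2) / 4 ^ j * (4 ^ k * W)⁻¹) := by
      rw [hW, hp, Xs, ← sq_abs (y i0)]; field_simp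
    rw [hmin]
    calc (‖ftZ (DPc ψ j k) ξ‖ * T) ^ 2 ≤ (2 * T) ^ 2 := by gcongr
      _ = 4 * (T * T) := by ring
      _ ≤ 4 * ((C * B ^ d) * (C * B ^ d * (1 / (Xs (2 ^ k) q τ * y i0 ^ 2)))) := by gcongr
      _ = _ := by rw [hXW]; ring
  calc _ ≤ ∑ k ∈ s, 16 * C ^ 2 * ((B ^ d) ^ 2 * (1 + τ ^ 2) / 4 ^ j) * min (4 ^ k * W) (4 ^ k * W)⁻¹ := Finset.sum_le_sum key
    _ = 16 * C ^ 2 * ((B ^ d) ^ 2 * (1 + τ ^ 2) / 4 ^ j) * ∑ k ∈ s, min (4 ^ k * W) (4 ^ k * W)⁻¹ := by rw [Finset.mul_sum]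
    _ ≤ 16 * C ^ 2 * ((B ^ d) ^ 2 * (1 + τ ^ 2) / 4 ^ j) * G := by gcongr; exact hgeo W hW0 s
    _ = _ := by ring

theorem le_of_sq_le_sq_aux {a b : ℝ} (h : a ^ 2 ≤ b ^ 2) (hb : 0 ≤ b) : a ≤ b := le_of_abs_le (abs_le_of_sq_le_sq h hb)

set_option maxHeartbeats 4000000 in
theorem caseB {d : ℕ} (hd : 0 < d) (ψ : SchwartzMap (Fin d → ℝ) ℝ) (hψ : HPsi ψ) :
    ∃ C : ℝ, 0 < C ∧ ∀ (q : ℕ) [NeZero q] (a : ℤ), IsCoprime a (q:ℤ) → ∀ (τ : ℝ) (j : ℕ) (ξ : Fin d → ℝ) (s : Finset ℕ)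
      (v : Fin d → ℤ) (y : Fin d → ℝ), (∀ i, y i = v i + q * ξ i) → (∀ i, |y i| ≤ 1 / 2) → 
      (∀ k ∈ s, Vld q τ j k) → ∑ k ∈ s, ‖∏ i, th (2 ^ k) q a τ (ξ i) - (∏ i, (q:ℂ)⁻¹ * gam (2 ^ k) τ * Gs q a (v i)) *
        ftZ (fun m => (psiQL (fun x => ψ x) q (2 ^ k) m : ℂ)) ξ‖ ^ 2 ≤ C * ((Bq q τ ^ d) ^ 2 * (1 + τ ^ 2)) := by
  obtain ⟨C, hC, hth⟩ := prod_th d hd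
  obtain ⟨G, hG, hgeo⟩ := geo_sum
  set C1 : ℝ := C + 4 * d with hC1
  have hC1' : C ≤ C1 := by have : (0:ℝ) ≤ d := by positivity
                           linarith
  have hC10 : 1 ≤ C1 := hC.trans hC1'
  refine ⟨2 * C1 ^ 2 * 65 ^ 3 * G + 64 * C1 ^ 2 * G, by positivity, ?_⟩
  intro q _ a hco τ j ξ s v y hy hy2 hs
  have hq : (0:ℝ) < q := by exact_mod_cast Nat.pos_of_ne_zero (NeZero.ne q)
  haveI : Nonempty (Fin d) := ⟨⟨0, hd⟩⟩
  obtain ⟨i0, hmax⟩ := Finite.exists_max fun i : Fin d => |y i|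
  set B := Bq q τ with hBd
  have hB : 0 ≤ B := Real.sqrt_nonneg _
  set W := y i0 ^ 2 / (q:ℝ) ^ 2 with hW
  set V := 1 / ((q:ℝ) ^ 2 * (1 + τ ^ 2)) with hV
  have hW0 : 0 ≤ W := by positivity
  have hV0 : 0 ≤ V := by positivity
  have hZ1 : 1 ≤ 1 + τ ^ 2 := by nlinarith [sq_nonneg τ]
  have hP0 : 0 ≤ (B ^ d) ^ 2 := by positivity
  have key : ∀ k ∈ s, ‖∏ i, th (2 ^ k) q a τ (ξ i) - (∏ i, (q:ℂ)⁻¹ * gam (2 ^ k) τ * Gs q a (v i)) *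
        ftZ (fun m => (psiQL (fun x => ψ x) q (2 ^ k) m : ℂ)) ξ‖ ^ 2 ≤ 
        ((B ^ d) ^ 2 * (1 + τ ^ 2)) * (2 * C1 ^ 2 * 65 ^ 3 * min (4 ^ k * V) (4 ^ k * V)⁻¹ + 64 * C1 ^ 2 * min (4 ^ k * W) (4 ^ k * W)⁻¹) := by
    intro k hk
    have hv := hs k hk
    have hs0 : (0:ℝ) < 2 ^ k := by positivity
    have hp : (4:ℝ) ^ k = (2 ^ k) ^ 2 := by rw [← pow_mul, mul_comm, pow_mul]; norm_num
    obtain ⟨t1, t2, t3⟩ := hth (2 ^ k) hs0 q a hco τ ξ v y hy hy2 hv.X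
    obtain ⟨p1, p2, p3⟩ := psi_ft ψ hψ (show 0 < q by exact_mod_cast hq) (show 2 * (q:ℝ) < 2 ^ k by linarith [hv.h1]) ξ
    set Θ := ∏ i, th (2 ^ k) q a τ (ξ i) with hΘ
    set P := ∏ i, (q:ℂ)⁻¹ * gam (2 ^ k) τ * Gs q a (v i) with hPd
    set φ := ftZ (fun m => (psiQL (fun x => ψ x) q (2 ^ k) m : ℂ)) ξ with hφ
    have hPn : ‖P‖ ≤ B ^ d := by
      rw [hPd, norm_prod]
      calc _ ≤ ∏ i : Fin d, B := Finset.prod_le_prod (fun _ _ => norm_nonneg _) fun i _ => pref hs0 q a hco τ _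
        _ = _ := by simp
    have hXV : Xs (2 ^ k) q τ = 4 ^ k * V := by rw [hV, hp, Xs]; ring
    have hX65 := hv.X
    rw [hXV] at t1 t3 hX65
    set X := 4 ^ k * V with hXd
    have hX0 : 0 < X := by linarith
    have hminV : (1 / X) ^ 2 ≤ 65 ^ 3 * min X X⁻¹ := by
      have hh : 1 / X ≤ 65 := by rw [div_le_iff₀ hX0]; linarith
      rcases le_total X X⁻¹ with h | h
      · rw [min_eq_left h]
        have : (1 / X) ^ 2 ≤ 65 ^ 2 := by gcongr
        linarith
      · rw [min_eq_right h]
        have h1 : 0 < X⁻¹ := by positivity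
        rw [one_div] at hh ⊢
        nlinarith
    have hminW0 : 0 ≤ min (4 ^ k * W) (4 ^ k * W)⁻¹ := by positivity
    have hminV0 : 0 ≤ min X X⁻¹ := by positivity
    rcases le_or_gt (4 ^ k * W) (1 / 4) with hu | hu
    · -- small frequency
      have hYk : |y i0| ≤ q / (2 * 2 ^ k) := by
        rw [le_div_iff₀ (by positivity)]
        rw [hW, hp] at hu
        rw [mul_div_assoc', div_le_iff₀ (by positivity)] at hu
        refine le_of_sq_le_sq_aux ?_ hq.le
        rw [mul_pow, sq_abs]
        nlinarith
      have hφ1 : φ = 1 := by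
        refine p2 ⟨fun i => - v i, fun i => ?_⟩
        push_cast
        rw [sub_neg_eq_add, add_comm, ← hy]
        exact (hmax i).trans hYk
      have hge : ∀ i, ‖ge (2 ^ k) q τ (y i) - 1‖ ≤ 4 * (4 ^ k * W) := by
        intro i
        have hw : ‖(-π * (AA (2 ^ k) τ)⁻¹ * (y i / q) ^ 2 : ℂ)‖ ≤ 2 * (4 ^ k * W) := by
          rw [norm_mul, norm_mul, norm_neg, Complex.norm_real, norm_pow, norm_div, Complex.norm_real, Complex.norm_natCast,
            Real.norm_of_nonneg Real.pi_pos.le, AA_inv_norm τ hs0, Real.norm_eq_abs]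
          have hz : 1 ≤ Real.sqrt (1 + τ ^ 2) := Real.one_le_sqrt.2 hZ1
          have h1 : ((2:ℝ) ^ k) ^ 2 / (2 * Real.sqrt (1 + τ ^ 2)) ≤ (2 ^ k) ^ 2 / 2 := by
            gcongr; linarith
          have h2 : (|y i| / q) ^ 2 ≤ W := by rw [hW, ← sq_abs (y i0), div_pow]; exact div_le_div_of_nonneg_right (pow_le_pow_left₀ (abs_nonneg _) (hmax i) 2) (by positivity)
          calc _ ≤ 4 * ((2 ^ k) ^ 2 / 2) * W := by
                have := Real.pi_le_four
                gcongr
            _ = _ := by rw [hp]; ring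
        have hw1 : ‖(-π * (AA (2 ^ k) τ)⁻¹ * (y i / q) ^ 2 : ℂ)‖ ≤ 1 := by linarith
        have := Complex.norm_exp_sub_one_le hw1
        unfold ge
        linarith
      have hge1 : ∀ i, ‖ge (2 ^ k) q τ (y i)‖ ≤ 1 := by
        intro i; rw [ge_norm hs0]; refine Real.exp_le_one_iff.2 ?_
        have := Real.pi_pos
        have := Xs_pos hs0 q τ
        have : 0 ≤ π / 2 * Xs (2 ^ k) q τ * y i ^ 2 := by positivity
        linarith
      have hpg := prod_diff Finset.univ (fun i => ge (2 ^ k) q τ (y i)) (fun _ => (1:ℂ)) 1 (4 * (4 ^ k * W)) (by norm_num) (fun i _ => hge1 i) (fun _ _ => by simp)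
        (fun i _ => by rw [one_mul]; exact hge i)
      simp only [Finset.prod_const_one, Finset.card_univ, Fintype.card_fin, one_pow, mul_one] at hpg
      have hmnP : ∏ i, mn (2 ^ k) q a τ (v i) (y i) = P * ∏ i, ge (2 ^ k) q τ (y i) := by
        rw [hPd, ← Finset.prod_mul_distrib]; rfl
      rw [hmnP] at t1
      have hE : ‖Θ - P * φ‖ ≤ C1 * B ^ d * (1 / X + 4 ^ k * W) := by
        have e : Θ - P * φ = (Θ - P * ∏ i, ge (2 ^ k) q τ (y i)) + P * (∏ i, ge (2 ^ k) q τ (y i) - 1) := by rw [hφ1]; ring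
        rw [e]
        refine (norm_add_le _ _).trans ?_
        rw [norm_mul]
        calc _ ≤ C * B ^ d * (1 / X) + B ^ d * (d * (4 * (4 ^ k * W))) := add_le_add t1 (mul_le_mul hPn hpg (norm_nonneg _) (by positivity))
          _ = C * (B ^ d * (1 / X)) + (4 * d) * (B ^ d * (4 ^ k * W)) := by ring
          _ ≤ C1 * (B ^ d * (1 / X)) + C1 * (B ^ d * (4 ^ k * W)) := by gcongr; linarith
          _ = _ := by ring
      have hWW : (4 ^ k * W) ^ 2 ≤ min (4 ^ k * W) (4 ^ k * W)⁻¹ := by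
        have h0 : 0 ≤ 4 ^ k * W := by positivity
        refine le_min (by nlinarith) ?_
        rcases h0.eq_or_lt with h | h
        · rw [← h]; simp
        · rw [le_inv_comm₀ (by positivity) h]
          have : (4 ^ k * W) ^ 2 * (4 ^ k * W) ≤ 1 := by
            calc _ ≤ (1/4:ℝ) ^ 2 * (1/4) := by gcongr
              _ ≤ 1 := by norm_num
          rw [le_inv_comm₀ h (by positivity), ← one_div, le_div_iff₀ h]; exact this
      calc ‖Θ - P * φ‖ ^ 2 ≤ (C1 * B ^ d * (1 / X + 4 ^ k * W)) ^ 2 := by gcongr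
        _ = (B ^ d) ^ 2 * C1 ^ 2 * (1 / X + 4 ^ k * W) ^ 2 := by ring
        _ ≤ (B ^ d) ^ 2 * C1 ^ 2 * (2 * (1 / X) ^ 2 + 2 * (4 ^ k * W) ^ 2) := by
            gcongr; nlinarith [sq_nonneg (1 / X - 4 ^ k * W)]
        _ ≤ (B ^ d) ^ 2 * C1 ^ 2 * (2 * (65 ^ 3 * min X X⁻¹) + 64 * min (4 ^ k * W) (4 ^ k * W)⁻¹) := by
            gcongr; norm_num
        _ = ((B ^ d) ^ 2 * 1) * (2 * C1 ^ 2 * 65 ^ 3 * min X X⁻¹ + 64 * C1 ^ 2 * min (4 ^ k * W) (4 ^ k * W)⁻¹) := by ring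
        _ ≤ _ := by gcongr
    · -- large frequency
      have hy0 : y i0 ≠ 0 := by
        intro h; rw [hW, h] at hu; norm_num at hu
      have hy00 : 0 < y i0 ^ 2 := by positivity
      have t3 := t3 i0 hy0
      have hu0 : 0 < 4 ^ k * W := by linarith
      have hXW : 1 / (X * y i0 ^ 2) = (1 + τ ^ 2) * (4 ^ k * W)⁻¹ := by
        rw [hXd, hV, hW]; field_simp
      have hΘ2 : ‖Θ‖ ^ 2 ≤ C1 ^ 2 * ((B ^ d) ^ 2 * (1 + τ ^ 2)) * (4 ^ k * W)⁻¹ := by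
        calc ‖Θ‖ ^ 2 = ‖Θ‖ * ‖Θ‖ := by ring
          _ ≤ (C * B ^ d) * (C * B ^ d * (1 / (X * y i0 ^ 2))) := by gcongr
          _ = C ^ 2 * ((B ^ d) ^ 2 * (1 + τ ^ 2)) * (4 ^ k * W)⁻¹ := by rw [hXW]; ring
          _ ≤ _ := by gcongr
      have hφ2 : ‖P * φ‖ ^ 2 ≤ C1 ^ 2 * ((B ^ d) ^ 2 * (1 + τ ^ 2)) * (4 ^ k * W)⁻¹ := by
        rcases le_or_gt (4 ^ k * W) 1 with h1 | h1
        · have h2 : 1 ≤ (4 ^ k * W)⁻¹ := (one_le_inv₀ hu0).2 h1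
          calc ‖P * φ‖ ^ 2 ≤ (B ^ d * 1) ^ 2 := by rw [norm_mul]; gcongr
            _ = 1 ^ 2 * ((B ^ d) ^ 2 * 1) * 1 := by ring
            _ ≤ _ := by gcongr
        · have : φ = 0 := by
            refine p3 i0 fun w => ?_
            have h2 : (q:ℝ) / 2 ^ k < |y i0| := by
              rw [div_lt_iff₀ hs0]
              rw [hW, hp, mul_div_assoc', lt_div_iff₀ (by positivity), one_mul] at h1
              refine lt_of_pow_lt_pow_left₀ 2 (by positivity) ?_
              rw [mul_pow, sq_abs]; linarith
            refine h2.trans_le ?_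
            have h3 : (q:ℝ) * ξ i0 - w = y i0 - ((v i0 + w : ℤ):ℝ) := by rw [hy]; push_cast; ring
            rw [h3]
            rcases eq_or_ne (v i0 + w) 0 with h4 | h4
            · rw [h4]; simp
            · have h5 : (1:ℝ) ≤ |((v i0 + w : ℤ):ℝ)| := by rw [← Int.cast_abs]; exact_mod_cast Int.one_le_abs h4
              have h6 := abs_sub_abs_le_abs_sub ((v i0 + w : ℤ):ℝ) (y i0)
              rw [abs_sub_comm] at h6
              linarith [hy2 i0]
          rw [this]; simp; positivity
      have hmW : (4 ^ k * W)⁻¹ ≤ 16 * min (4 ^ k * W) (4 ^ k * W)⁻¹ := by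
        have h1 : 0 < (4 ^ k * W)⁻¹ := by positivity
        rw [mul_min_of_nonneg _ _ (by norm_num)]
        refine le_min ?_ (by linarith)
        rw [inv_le_iff_one_le_mul₀ hu0]
        nlinarith
      have htri : ‖Θ - P * φ‖ ^ 2 ≤ 2 * ‖Θ‖ ^ 2 + 2 * ‖P * φ‖ ^ 2 := by
        have := norm_sub_le Θ (P * φ)
        calc _ ≤ (‖Θ‖ + ‖P * φ‖) ^ 2 := by gcongr
          _ ≤ _ := by nlinarith [sq_nonneg (‖Θ‖ - ‖P * φ‖)]
      have hfin : C1 ^ 2 * ((B ^ d) ^ 2 * (1 + τ ^ 2)) * (4 ^ k * W)⁻¹ ≤ C1 ^ 2 * ((B ^ d) ^ 2 * (1 + τ ^ 2)) * (16 * min (4 ^ k * W) (4 ^ k * W)⁻¹) := by gcongr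
      have hpos : 0 ≤ ((B ^ d) ^ 2 * (1 + τ ^ 2)) * (2 * C1 ^ 2 * 65 ^ 3 * min X X⁻¹) := by positivity
      rw [mul_add]
      refine (htri.trans ?_).trans (le_add_of_nonneg_left hpos)
      linarith
  refine (Finset.sum_le_sum key).trans ?_
  rw [← Finset.mul_sum, Finset.sum_add_distrib, ← Finset.mul_sum, ← Finset.mul_sum, mul_comm]
  gcongr
  · exact hgeo V hV0 s
  · exact hgeo W hW0 s

def Rk {d : ℕ} (ψ : SchwartzMap (Fin d → ℝ) ℝ) (q : ℕ) (a : ℤ) (m : Fin d → ℤ) : ℂ :=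
  (∏ i, ec (a * (m i) ^ 2 / q)) * (psiQL (fun x => ψ x) 1 (4 * q) m : ℂ)

theorem Rk_summable {d : ℕ} (ψ : SchwartzMap (Fin d → ℝ) ℝ) (q : ℕ) [NeZero q] (a : ℤ) : Summable fun m => ‖Rk ψ q a m‖ := by
  have hq : (1:ℝ) ≤ q := by exact_mod_cast Nat.pos_of_ne_zero (NeZero.ne q)
  have := psi_summable ψ (q := 1) (L := 4 * (q:ℝ)) one_pos (by push_cast; linarith)
  refine this.congr fun m => ?_
  rw [Rk, norm_mul, norm_prod]; simp [norm_ec]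

theorem Rk_ft {d : ℕ} (ψ : SchwartzMap (Fin d → ℝ) ℝ) (hψ : HPsi ψ) (q : ℕ) [NeZero q] (a : ℤ) (ξ : Fin d → ℝ)
    (v : Fin d → ℤ) (y : Fin d → ℝ) (hy : ∀ i, y i = v i + q * ξ i) (hy2 : ∀ i, |y i| ≤ 1 / 2) :
    ∃ c : ℂ, ftZ (Rk ψ q a) ξ = (∏ i, (q:ℂ)⁻¹ * Gs q a (v i)) * c ∧ ‖c‖ ≤ 1 ∧ ((∀ i, |y i| ≤ 1 / 8) → c = 1) := by
  have hq : (1:ℝ) ≤ q := by exact_mod_cast Nat.pos_of_ne_zero (NeZero.ne q)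
  have hq0 : (0:ℝ) < q := by linarith
  set p : (Fin d → ℤ) → ℂ := fun m => (psiQL (fun x => ψ x) 1 (4 * q) m : ℂ) with hp
  have hps : Summable fun m => ‖p m‖ := psi_summable ψ (q := 1) (L := 4 * (q:ℝ)) one_pos (by push_cast; linarith)
  have hpf := fun ξ => psi_ft ψ hψ (q := 1) (L := 4 * (q:ℝ)) one_pos (by push_cast; linarith) ξ
  have hlt : ∀ i, ((v i % (q:ℤ)).toNat) < q := by
    intro i
    have h1 := Int.emod_lt_of_pos (v i) (show (0:ℤ) < q by exact_mod_cast hq0)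
    have h2 := Int.emod_nonneg (v i) (show (q:ℤ) ≠ 0 by exact_mod_cast NeZero.ne q)
    omega
  set l0 : Fin d → Fin q := fun i => ⟨(v i % (q:ℤ)).toNat, hlt i⟩ with hl0
  have hl0v : ∀ i, ((l0 i : ℕ) : ℤ) = v i % (q:ℤ) := by
    intro i
    have h2 := Int.emod_nonneg (v i) (show (q:ℤ) ≠ 0 by exact_mod_cast NeZero.ne q)
    simp [hl0]; omega
  have e1 : ∀ m, Rk ψ q a m * ec (dotp m ξ) = ∑ l : Fin d → Fin q, (∏ i, (q:ℂ)⁻¹ * Gs q a (l i : ℕ)) * (p m * ec (dotp m fun i => ξ i + (l i : ℕ) / q)) := by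
    intro m
    have h1 : ∏ i, ec (a * (m i) ^ 2 / q) = ∑ l : Fin d → Fin q, ∏ i, ((q:ℂ)⁻¹ * (Gs q a (l i : ℕ) * ec ((m i) * (l i : ℕ) / q))) := by
      rw [Finset.prod_congr rfl fun i _ => (finFourier q a (m i)).trans (Finset.mul_sum _ _ _)]
      rw [Finset.prod_univ_sum, Fintype.piFinset_univ]
    rw [Rk, h1, Finset.sum_mul, Finset.sum_mul]
    refine Finset.sum_congr rfl fun l _ => ?_
    have h2 : ec (dotp m fun i => ξ i + (l i : ℕ) / q) = (∏ i, ec ((m i) * (l i : ℕ) / q)) * ec (dotp m ξ) := by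
      rw [← ec_sum, ← ec_add]; congr 1
      rw [dotp, dotp, ← Finset.sum_add_distrib]
      refine Finset.sum_congr rfl fun i _ => ?_
      ring
    rw [h2]
    simp only [← mul_assoc]
    rw [Finset.prod_mul_distrib]
    ring
  have e2 : ftZ (Rk ψ q a) ξ = ∑ l : Fin d → Fin q, (∏ i, (q:ℂ)⁻¹ * Gs q a (l i : ℕ)) * ftZ p (fun i => ξ i + (l i : ℕ) / q) := by
    rw [ftZ, tsum_congr e1, Summable.tsum_finsetSum fun l _ => ((summable_ec hps _).of_norm).mul_left _]
    exact Finset.sum_congr rfl fun l _ => by rw [tsum_mul_left, ftZ]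
  have hdiv : ∀ i, (q:ℤ) ∣ ((l0 i : ℕ) : ℤ) - v i := by
    intro i; rw [hl0v, Int.emod_def]; exact ⟨-(v i / q), by ring⟩
  rw [Finset.sum_eq_single l0] at e2
  · refine ⟨ftZ p (fun i => ξ i + (l0 i : ℕ) / q), ?_, (hpf _).1, fun h8 => (hpf _).2.1 ⟨fun i => (((l0 i : ℕ) : ℤ) - v i) / q, fun i => ?_⟩⟩
    · rw [e2]; congr 1
      exact Finset.prod_congr rfl fun i _ => by rw [Gs_periodic q a _ _ (hdiv i)]
    · obtain ⟨w, hw⟩ := hdiv i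
      beta_reduce
      rw [hw, Int.mul_ediv_cancel_left _ (by exact_mod_cast NeZero.ne q)]
      have hw' : ((l0 i : ℕ) : ℝ) = q * w + v i := by
        have : (((l0 i : ℕ) : ℤ) : ℝ) = ((q * w + v i : ℤ) : ℝ) := by congr 1; linarith
        push_cast at this; exact this
      have : ((1:ℕ):ℝ) * (ξ i + (l0 i : ℕ) / q) - w = y i / q := by
        rw [hw', hy]; push_cast; field_simp; ring
      rw [this, abs_div, abs_of_pos hq0]
      rw [div_le_div_iff₀ hq0 (by positivity)]
      have := h8 i
      push_cast
      nlinarith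
  · intro l _ hl
    obtain ⟨i, hi⟩ := Function.ne_iff.1 hl
    rw [(hpf _).2.2 i, mul_zero]
    intro w
    have hne : ((l i : ℕ) : ℤ) - v i - q * w ≠ 0 := by
      intro h
      apply hi
      apply Fin.ext
      have h1 : ((l i : ℕ) : ℤ) % q = v i % q := by
        rw [show ((l i : ℕ) : ℤ) = v i + q * w by linarith, Int.add_mul_emod_self_left]
      rw [Int.emod_eq_of_lt (by positivity) (by exact_mod_cast (l i).2), ← hl0v] at h1
      exact_mod_cast h1
    have h5 : (1:ℝ) ≤ |((((l i : ℕ) : ℤ) - v i - q * w : ℤ):ℝ)| := by rw [← Int.cast_abs]; exact_mod_cast Int.one_le_abs hne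
    have h3 : ((1:ℕ):ℝ) * (ξ i + (l i : ℕ) / q) - w = (((((l i : ℕ) : ℤ) - v i - q * w : ℤ):ℝ) - (- y i)) / q := by
      rw [hy]; push_cast; field_simp; ring
    have h6 := abs_sub_abs_le_abs_sub ((((l i : ℕ) : ℤ) - v i - q * w : ℤ):ℝ) (- y i)
    rw [abs_neg] at h6
    rw [h3, abs_div, abs_of_pos hq0, div_lt_div_iff₀ (by positivity) hq0]
    have := hy2 i
    push_cast
    push_cast at h5 h6
    nlinarith
  · simp

theorem Rk_ft_norm {d : ℕ} (hd : 0 < d) (ψ : SchwartzMap (Fin d → ℝ) ℝ) (hψ : HPsi ψ) (q : ℕ) [NeZero q] (a : ℤ) (hco : IsCoprime a (q:ℤ)) (ξ : Fin d → ℝ) :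
    ‖ftZ (Rk ψ q a) ξ‖ ^ 2 ≤ (2 / q) ^ d := by
  have hq0 : (0:ℝ) < q := by exact_mod_cast Nat.pos_of_ne_zero (NeZero.ne q)
  obtain ⟨v, y, i0, hy, hy2, -⟩ := exY hd q ξ
  obtain ⟨c, hc, hc1, -⟩ := Rk_ft ψ hψ q a ξ v y hy hy2
  rw [hc, norm_mul, norm_prod, mul_pow, ← Finset.prod_pow]
  calc _ ≤ (∏ i : Fin d, (2 / q : ℝ)) * 1 ^ 2 := by
        gcongr with i
        rw [norm_mul, mul_pow, norm_inv, Complex.norm_natCast]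
        have := Gs_norm q a (v i) hco
        calc _ ≤ ((q:ℝ)⁻¹) ^ 2 * (2 * q) := by gcongr
          _ = _ := by field_simp
    _ = _ := by simp [div_pow]

/-- error kernel -/
def Ek {d : ℕ} (ψ : SchwartzMap (Fin d → ℝ) ℝ) (q : ℕ) (a : ℤ) (τ : ℝ) (k : ℕ) (m : Fin d → ℤ) : ℂ :=
  Kk (2 ^ k) q a τ m - gam (2 ^ k) τ ^ d * cv (Rk ψ q a) (fun m => (psiQL (fun x => ψ x) q (2 ^ k) m : ℂ)) m

theorem Ek_summable {d : ℕ} (ψ : SchwartzMap (Fin d → ℝ) ℝ) (q : ℕ) [NeZero q] (a : ℤ) (τ : ℝ) (k : ℕ) (h8 : 8 * (q:ℝ) ≤ 2 ^ k) :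
    Summable fun m => ‖Ek ψ q a τ k m‖ := by
  have hq0 : (0:ℝ) < q := by exact_mod_cast Nat.pos_of_ne_zero (NeZero.ne q)
  have h1 := (Kk_ft (d := d) (show (0:ℝ) < 2 ^ k by positivity) q a τ).1
  have h2 := psi_summable ψ (L := (2:ℝ) ^ k) (show 0 < q by exact_mod_cast hq0) (by linarith)
  have h3 := cv_summable (Rk_summable ψ q a) h2
  have h4 := (h3.mul_left ‖gam (2 ^ k) τ ^ d‖)
  refine Summable.of_nonneg_of_le (fun _ => norm_nonneg _) (fun m => ?_) (h1.add h4)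
  unfold Ek
  refine (norm_sub_le _ _).trans ?_
  rw [norm_mul]

theorem Ek_ft {d : ℕ} (ψ : SchwartzMap (Fin d → ℝ) ℝ) (hψ : HPsi ψ) (q : ℕ) [NeZero q] (a : ℤ) (τ : ℝ) (k : ℕ) (h8 : 8 * (q:ℝ) ≤ 2 ^ k) (ξ : Fin d → ℝ)
    (v : Fin d → ℤ) (y : Fin d → ℝ) (hy : ∀ i, y i = v i + q * ξ i) (hy2 : ∀ i, |y i| ≤ 1 / 2) :
    ftZ (Ek ψ q a τ k) ξ = ∏ i, th (2 ^ k) q a τ (ξ i) - (∏ i, (q:ℂ)⁻¹ * gam (2 ^ k) τ * Gs q a (v i)) *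
        ftZ (fun m => (psiQL (fun x => ψ x) q (2 ^ k) m : ℂ)) ξ := by
  have hq0 : (0:ℝ) < q := by exact_mod_cast Nat.pos_of_ne_zero (NeZero.ne q)
  have hs0 : (0:ℝ) < 2 ^ k := by positivity
  obtain ⟨h1, h1'⟩ := (Kk_ft (d := d) (show (0:ℝ) < 2 ^ k by positivity) q a τ)
  have h2 := psi_summable ψ (L := (2:ℝ) ^ k) (show 0 < q by exact_mod_cast hq0) (by linarith)
  have h3 := cv_summable (Rk_summable ψ q a) h2
  obtain ⟨c, hc, -, hc1⟩ := Rk_ft ψ hψ q a ξ v y hy hy2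
  have e : ftZ (Ek ψ q a τ k) ξ = ftZ (Kk (2 ^ k) q a τ) ξ - gam (2 ^ k) τ ^ d * ftZ (cv (Rk ψ q a) (fun m => (psiQL (fun x => ψ x) q (2 ^ k) m : ℂ))) ξ := by
    unfold ftZ
    rw [← tsum_mul_left, ← Summable.tsum_sub (summable_ec h1 ξ).of_norm ((summable_ec h3 ξ).of_norm.mul_left _)]
    refine tsum_congr fun m => ?_
    unfold Ek; ring
  rw [e, h1', ftZ_cv (Rk_summable ψ q a) h2, hc]
  congr 1
  have hP : ∏ i, (q:ℂ)⁻¹ * gam (2 ^ k) τ * Gs q a (v i) = gam (2 ^ k) τ ^ d * ∏ i, (q:ℂ)⁻¹ * Gs q a (v i) := by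
    rw [show gam (2 ^ k) τ ^ d = ∏ i : Fin d, gam (2 ^ k) τ by simp, ← Finset.prod_mul_distrib]
    exact Finset.prod_congr rfl fun i _ => by ring
  rw [hP]
  by_cases h : ∀ i, |y i| ≤ 1 / 8
  · rw [hc1 h]; ring
  · push Not at h
    obtain ⟨i, hi⟩ := h
    rw [(psi_ft ψ hψ (show 0 < q by exact_mod_cast hq0) (show 2 * (q:ℝ) < 2 ^ k by linarith) ξ).2.2 i]
    · ring
    intro w
    have h2 : (q:ℝ) / 2 ^ k < |y i| := by
      refine lt_of_le_of_lt ?_ hi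
      rw [div_le_div_iff₀ hs0 (by norm_num)]; linarith
    refine h2.trans_le ?_
    have h3 : (q:ℝ) * ξ i - w = y i - ((v i + w : ℤ):ℝ) := by rw [hy]; push_cast; ring
    rw [h3]
    rcases eq_or_ne (v i + w) 0 with h4 | h4
    · rw [h4]; simp
    · have h5 : (1:ℝ) ≤ |((v i + w : ℤ):ℝ)| := by rw [← Int.cast_abs]; exact_mod_cast Int.one_le_abs h4
      have h6 := abs_sub_abs_le_abs_sub ((v i + w : ℤ):ℝ) (y i)
      rw [abs_sub_comm] at h6
      linarith [hy2 i]

theorem sq_add_le (x y : ℝ≥0∞) : (x + y) ^ 2 ≤ 2 * x ^ 2 + 2 * y ^ 2 := by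
  rcases eq_or_ne x ∞ with rfl | hx
  · simp
  rcases eq_or_ne y ∞ with rfl | hy
  · simp
  lift x to NNReal using hx
  lift y to NNReal using hy
  norm_cast
  rw [← NNReal.coe_le_coe]
  push_cast
  nlinarith [sq_nonneg ((x:ℝ)-y)]

theorem sup_sq_le {ι : Type*} (x : ι → ℝ≥0∞) : (⨆ k, x k) ^ 2 ≤ ∑' k, x k ^ 2 := by
  rw [ENNReal.iSup_pow_of_ne_zero (by norm_num)]
  exact iSup_le fun k => ENNReal.le_tsum (f := fun k => x k ^ 2) k

theorem supplan {d : ℕ} {ι : Type*} (K : ι → (Fin d → ℤ) → ℂ) (hK : ∀ k, Summable fun n => ‖K k n‖) (B : ℝ)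
    (hB : ∀ ξ, ∀ s : Finset ι, ∑ k ∈ s, ‖ftZ (K k) ξ‖ ^ 2 ≤ B) (a : (Fin d → ℤ) → ℂ) {M : ℝ} (ha : ∀ n, ‖a n‖ ≤ M) :
    ∑' n, (⨆ k, ‖cv a (K k) n‖ₑ) ^ 2 ≤ ENNReal.ofReal B * ∑' n, ‖a n‖ₑ ^ 2 := by
  have h := planch K hK (ENNReal.ofReal B) (fun ξ s => by
    have : ∀ k, ‖ftZ (K k) ξ‖ₑ ^ 2 = ENNReal.ofReal (‖ftZ (K k) ξ‖ ^ 2) := fun k => by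
      rw [ENNReal.ofReal_pow (norm_nonneg _), ofReal_norm]
    rw [Finset.sum_congr rfl fun k _ => this k, ← ENNReal.ofReal_sum_of_nonneg fun _ _ => by positivity]
    exact ENNReal.ofReal_le_ofReal (hB ξ s)) a ha
  exact (ENNReal.tsum_le_tsum fun n => sup_sq_le _).trans h

theorem cv_enorm_le {d : ℕ} (h p : (Fin d → ℤ) → ℂ) (n) : ‖cv h p n‖ₑ ≤ ∑' m, ‖p m‖ₑ * ‖h (n - m)‖ₑ := by
  unfold cv
  refine (enorm_tsum_le_tsum_enorm).trans (ENNReal.tsum_le_tsum fun m => ?_)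
  rw [enorm_mul, mul_comm]

theorem cv_comm {d : ℕ} (h p : (Fin d → ℤ) → ℂ) : cv h p = cv p h := by
  funext n
  unfold cv
  rw [← (Equiv.subLeft n).tsum_eq]
  refine tsum_congr fun m => ?_
  simp [mul_comm]

theorem mainB {d : ℕ} (ψ : SchwartzMap (Fin d → ℝ) ℝ) : ∃ C : ℝ≥0∞, C ≠ ∞ ∧ ∀ (q : ℕ) [NeZero q] (τ : ℝ) (j : ℕ) (g : (Fin d → ℤ) → ℂ),
    ∑' n, (⨆ k : {k // Vld q τ j k}, ‖cv (cv g (DPc ψ j k)) (fun m => (psiQL (fun x => ψ x) q (2 ^ (k:ℕ)) m : ℂ)) n‖ₑ) ^ 2 ≤ C * ∑' n, ‖g n‖ₑ ^ 2 := by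
  obtain ⟨C, hC, hψ⟩ := psi_HK ψ
  set c := ENNReal.ofReal C with hc
  set D : ℝ≥0∞ := 4 * (12 ^ d) ^ 2 with hD
  refine ⟨(c * c) ^ 2 * (D * (2 * D + 2 * D)), ?_, ?_⟩
  · have : c ≠ ∞ := ENNReal.ofReal_ne_top
    have hD' : D ≠ ∞ := by rw [hD]; finiteness
    finiteness
  intro q _ τ j g
  have hq : 0 < q := Nat.pos_of_ne_zero (NeZero.ne q)
  have hq0 : (0:ℝ) < q := by exact_mod_cast hq
  set Hf : ℕ → (ℕ → ℝ) → ((Fin d → ℤ) → ℝ≥0∞) → (Fin d → ℤ) → ℝ≥0∞ := fun Q a G n => ⨆ i : ℕ, ∑' m, HK Q (a i) m * G (n - m) with hHf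
  set a1 : ℕ → ℝ := fun k => max 1 ((2:ℝ) ^ ((k:ℤ) - ((j + 1 : ℕ):ℤ)) / qlcm (j + 1)) with ha1
  set a2 : ℕ → ℝ := fun k => max 1 ((2:ℝ) ^ ((k:ℤ) - (j:ℤ)) / qlcm j) with ha2
  set a3 : ℕ → ℝ := fun k => max 1 ((2:ℝ) ^ k / q) with ha3
  set G : (Fin d → ℤ) → ℝ≥0∞ := fun n => ‖g n‖ₑ with hG
  set H1 := Hf (qlcm (j + 1)) a1 G with hH1
  set H2 := Hf (qlcm j) a2 G with hH2
  set H : (Fin d → ℤ) → ℝ≥0∞ := fun n => H1 n + H2 n with hH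
  have hDk : ∀ k, Vld q τ j k → ∀ n, ‖cv g (DPc ψ j k) n‖ₑ ≤ c * H n := by
    intro k hk n
    obtain ⟨b1, b2⟩ := qL_bound hk.h3
    have p1 : (0:ℝ) < qlcm (j+1) := by exact_mod_cast qlcm_pos (j+1)
    have p2 : (0:ℝ) < qlcm j := by exact_mod_cast qlcm_pos j
    have e1 : a1 k = (2:ℝ) ^ ((k:ℤ) - ((j + 1 : ℕ):ℤ)) / qlcm (j + 1) := max_eq_right (by rw [le_div_iff₀ p1]; linarith)
    have e2 : a2 k = (2:ℝ) ^ ((k:ℤ) - (j:ℤ)) / qlcm j := max_eq_right (by rw [le_div_iff₀ p2]; linarith)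
    have hm : ∀ m, ‖DPc ψ j k m‖ₑ ≤ c * HK (qlcm (j+1)) (a1 k) m + c * HK (qlcm j) (a2 k) m := by
      intro m
      have : DPc ψ j k m = (psiQL (fun x => ψ x) (qlcm (j+1)) ((2:ℝ) ^ ((k:ℤ) - ((j + 1 : ℕ):ℤ))) m : ℂ) - (psiQL (fun x => ψ x) (qlcm j) ((2:ℝ) ^ ((k:ℤ) - (j:ℤ))) m : ℂ) := by
        unfold DPc DeltaPsiJK PsiJK; push_cast; rfl
      rw [this, e1, e2]
      refine (enorm_sub_le).trans (add_le_add ?_ ?_)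
      · exact hψ _ _ (qlcm_pos _) (by positivity) m
      · exact hψ _ _ (qlcm_pos _) (by positivity) m
    calc _ ≤ ∑' m, ‖DPc ψ j k m‖ₑ * G (n - m) := cv_enorm_le _ _ _
      _ ≤ ∑' m, (c * HK (qlcm (j+1)) (a1 k) m + c * HK (qlcm j) (a2 k) m) * G (n - m) := ENNReal.tsum_le_tsum fun m => by gcongr; exact hm m
      _ = c * (∑' m, HK (qlcm (j+1)) (a1 k) m * G (n - m)) + c * ∑' m, HK (qlcm j) (a2 k) m * G (n - m) := by
          rw [← ENNReal.tsum_mul_left, ← ENNReal.tsum_mul_left, ← ENNReal.tsum_add]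
          exact tsum_congr fun m => by ring
      _ ≤ c * H1 n + c * H2 n := by
          gcongr
          · exact le_iSup (fun i => ∑' m, HK (qlcm (j+1)) (a1 i) m * G (n - m)) k
          · exact le_iSup (fun i => ∑' m, HK (qlcm j) (a2 i) m * G (n - m)) k
      _ = _ := by rw [hH]; ring
  have hk2 : ∀ n, (⨆ k : {k // Vld q τ j k}, ‖cv (cv g (DPc ψ j k)) (fun m => (psiQL (fun x => ψ x) q (2 ^ (k:ℕ)) m : ℂ)) n‖ₑ) ≤ c * c * Hf q a3 H n := by
    intro n
    refine iSup_le fun k => ?_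
    have e3 : a3 k = (2:ℝ) ^ (k:ℕ) / q := max_eq_right (by rw [le_div_iff₀ hq0]; linarith [k.2.h1])
    calc _ ≤ ∑' m, ‖(psiQL (fun x => ψ x) q (2 ^ (k:ℕ)) m : ℂ)‖ₑ * ‖cv g (DPc ψ j k) (n - m)‖ₑ := cv_enorm_le _ _ _
      _ ≤ ∑' m, (c * HK q (a3 k) m) * (c * H (n - m)) := ENNReal.tsum_le_tsum fun m => by
          refine mul_le_mul' ?_ (hDk k k.2 _)
          rw [e3]; exact hψ _ _ hq (by positivity) m
      _ = c * c * ∑' m, HK q (a3 k) m * H (n - m) := by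
          rw [← ENNReal.tsum_mul_left]; exact tsum_congr fun m => by ring
      _ ≤ _ := by gcongr; exact le_iSup (fun i => ∑' m, HK q (a3 i) m * H (n - m)) (k:ℕ)
  calc _ ≤ ∑' n, (c * c * Hf q a3 H n) ^ 2 := ENNReal.tsum_le_tsum fun n => by gcongr; exact hk2 n
    _ = (c * c) ^ 2 * ∑' n, (Hf q a3 H n) ^ 2 := by rw [← ENNReal.tsum_mul_left]; exact tsum_congr fun m => by ring
    _ ≤ (c * c) ^ 2 * (D * ∑' n, (H n) ^ 2) := by gcongr; exact HL hq a3 (fun i => le_max_left _ _) H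
    _ ≤ (c * c) ^ 2 * (D * ∑' n, (2 * H1 n ^ 2 + 2 * H2 n ^ 2)) := by gcongr; exact sq_add_le _ _
    _ = (c * c) ^ 2 * (D * (2 * ∑' n, H1 n ^ 2 + 2 * ∑' n, H2 n ^ 2)) := by
        rw [ENNReal.tsum_add, ENNReal.tsum_mul_left, ENNReal.tsum_mul_left]
    _ ≤ (c * c) ^ 2 * (D * (2 * (D * ∑' n, G n ^ 2) + 2 * (D * ∑' n, G n ^ 2))) := by
        gcongr
        · exact HL (qlcm_pos _) a1 (fun i => le_max_left _ _) G
        · exact HL (qlcm_pos _) a2 (fun i => le_max_left _ _) G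
    _ = _ := by ring

theorem keyA {d : ℕ} (hd : 0 < d) (ψ : SchwartzMap (Fin d → ℝ) ℝ) (hψ : HPsi ψ) :
    ∃ C : ℝ, 0 < C ∧ ∀ (q : ℕ) [NeZero q] (a : ℤ), IsCoprime a (q:ℤ) → ∀ (τ : ℝ) (j : ℕ), q ≤ 2 ^ j → ∀ (f : (Fin d → ℤ) → ℂ) (M : ℝ),
      (∀ n, ‖f n‖ ≤ M) → 
      ∑' n, (⨆ k : {k // Vld q τ j k}, ‖cv (cv f (DPc ψ j k)) (Kk (2 ^ (k:ℕ)) q a τ) n‖ₑ) ^ 2 ≤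
        ENNReal.ofReal (C * ((Bq q τ ^ d) ^ 2 * (1 + τ ^ 2) / 4 ^ j)) * ∑' n, ‖f n‖ₑ ^ 2 := by
  obtain ⟨C, hC, h⟩ := caseA hd ψ hψ
  refine ⟨C, hC, fun q _ a hco τ j hqj f M hf => ?_⟩
  have hD : ∀ k : {k // Vld q τ j k}, Summable fun m => ‖DPc ψ j k m‖ := fun k => DPc_summable ψ k.2.h3
  have hKs : ∀ k : ℕ, Summable fun m => ‖Kk (d := d) (2 ^ (k:ℕ)) q a τ m‖ := fun k => (Kk_ft (by positivity) q a τ).1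
  have := supplan (fun k : {k // Vld q τ j k} => cv (DPc ψ j k) (Kk (2 ^ (k:ℕ)) q a τ)) (fun k => cv_summable (hD k) (hKs k))
    (C * ((Bq q τ ^ d) ^ 2 * (1 + τ ^ 2) / 4 ^ j)) (fun ξ s => ?_) f hf
  · refine le_trans (le_of_eq ?_) this
    refine tsum_congr fun n => ?_
    congr 1
    refine iSup_congr fun k => ?_
    rw [cv_assoc hf (hD k) (hKs k)]
  · have h2 := h q a hco τ j hqj ξ (s.map (Function.Embedding.subtype _)) (by
      intro k hk
      rw [Finset.mem_map] at hk
      obtain ⟨k', -, rfl⟩ := hk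
      exact k'.2)
    rw [Finset.sum_map] at h2
    refine le_trans (le_of_eq (Finset.sum_congr rfl fun k _ => ?_)) h2
    rw [ftZ_cv (hD k) (hKs k), norm_mul, (Kk_ft (by positivity) q a τ).2]
    rfl

theorem Bq_sq (q : ℕ) [NeZero q] (τ : ℝ) (d : ℕ) : (Bq q τ ^ d) ^ 2 = (1 / (q * Real.sqrt (1 + τ ^ 2))) ^ d := by
  rw [← pow_mul, mul_comm, pow_mul, Bq, Real.sq_sqrt (by positivity)]

theorem cv_Ek {d : ℕ} (ψ : SchwartzMap (Fin d → ℝ) ℝ) (q : ℕ) [NeZero q] (a : ℤ) (τ : ℝ) (k : ℕ) (h8 : 8 * (q:ℝ) ≤ 2 ^ k)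
    (g : (Fin d → ℤ) → ℂ) (M : ℝ) (hg : ∀ n, ‖g n‖ ≤ M) (n) :
    cv g (Kk (2 ^ k) q a τ) n = cv g (Ek ψ q a τ k) n + gam (2 ^ k) τ ^ d * cv g (cv (Rk ψ q a) (fun m => (psiQL (fun x => ψ x) q (2 ^ k) m : ℂ))) n := by
  have hq0 : (0:ℝ) < q := by exact_mod_cast Nat.pos_of_ne_zero (NeZero.ne q)
  have h2 := psi_summable ψ (L := (2:ℝ) ^ k) (show 0 < q by exact_mod_cast hq0) (by linarith)
  have h3 := cv_summable (Rk_summable ψ q a) h2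
  have e1 := (cv_pt_summable hg (Ek_summable ψ q a τ k h8) n).of_norm
  have e2 := (cv_pt_summable hg h3 n).of_norm
  unfold cv at *
  rw [← tsum_mul_left, ← e1.tsum_add (e2.mul_left _)]
  refine tsum_congr fun m => ?_
  unfold Ek cv
  ring

theorem keyB {d : ℕ} (hd : 0 < d) (ψ : SchwartzMap (Fin d → ℝ) ℝ) (hψ : HPsi ψ) :
    ∃ C : ℝ, 0 < C ∧ ∀ (q : ℕ) [NeZero q] (a : ℤ), IsCoprime a (q:ℤ) → ∀ (τ : ℝ) (j : ℕ) (f : (Fin d → ℤ) → ℂ) (M : ℝ),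
      (∀ n, ‖f n‖ ≤ M) → 
      ∑' n, (⨆ k : {k // Vld q τ j k}, ‖cv (cv f (DPc ψ j k)) (Kk (2 ^ (k:ℕ)) q a τ) n‖ₑ) ^ 2 ≤
        ENNReal.ofReal (C * ((Bq q τ ^ d) ^ 2 * (1 + τ ^ 2))) * ∑' n, ‖f n‖ₑ ^ 2 := by
  obtain ⟨C, hC, h⟩ := caseB hd ψ hψ
  obtain ⟨C2, hC2, hmain⟩ := mainB ψ
  refine ⟨8 * C + 2 * C2.toReal, by positivity, fun q _ a hco τ j f M hf => ?_⟩
  have hq0 : (0:ℝ) < q := by exact_mod_cast Nat.pos_of_ne_zero (NeZero.ne q)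
  have hD : ∀ k : {k // Vld q τ j k}, Summable fun m => ‖DPc ψ j k m‖ := fun k => DPc_summable ψ k.2.h3
  have hE : ∀ k : {k // Vld q τ j k}, Summable fun m => ‖Ek ψ q a τ k m‖ := fun k => Ek_summable ψ q a τ k k.2.h1
  have hR := Rk_summable ψ q a
  have hP : ∀ k : {k // Vld q τ j k}, Summable fun m => ‖(psiQL (fun x => ψ x) q (2 ^ (k:ℕ)) m : ℂ)‖ := fun k =>
    psi_summable ψ (L := (2:ℝ) ^ (k:ℕ)) (show 0 < q by exact_mod_cast hq0) (by linarith [k.2.h1])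
  set b := (Bq q τ ^ d) ^ 2 * (1 + τ ^ 2) with hb
  have hb0 : 0 ≤ b := by positivity
  -- error term
  have herr : ∑' n, (⨆ k : {k // Vld q τ j k}, ‖cv (cv f (DPc ψ j k)) (Ek ψ q a τ k) n‖ₑ) ^ 2 ≤ ENNReal.ofReal (4 * (C * b)) * ∑' n, ‖f n‖ₑ ^ 2 := by
    have := supplan (fun k : {k // Vld q τ j k} => cv (DPc ψ j k) (Ek ψ q a τ k)) (fun k => cv_summable (hD k) (hE k))
      (4 * (C * b)) (fun ξ s => ?_) f hf
    · refine le_trans (le_of_eq ?_) this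
      refine tsum_congr fun n => ?_
      congr 1
      refine iSup_congr fun k => ?_
      rw [cv_assoc hf (hD k) (hE k)]
    · obtain ⟨v, y, -, hy, hy2, -⟩ := exY hd q ξ
      have h2 := h q a hco τ j ξ (s.map (Function.Embedding.subtype _)) v y hy hy2 (by
        intro k hk
        rw [Finset.mem_map] at hk
        obtain ⟨k', -, rfl⟩ := hk
        exact k'.2)
      rw [Finset.sum_map] at h2
      refine le_trans ?_ (mul_le_mul_of_nonneg_left h2 (by norm_num : (0:ℝ) ≤ 4))
      rw [Finset.mul_sum]
      refine Finset.sum_le_sum fun k _ => ?_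
      rw [ftZ_cv (hD k) (hE k), norm_mul, mul_pow, Ek_ft ψ hψ q a τ k k.2.h1 ξ v y hy hy2]
      have h4 : ‖ftZ (DPc ψ j k) ξ‖ ^ 2 ≤ 4 := by
        have := (DPc_ft ψ hψ k.2.h3 ξ).1
        calc _ ≤ (2:ℝ) ^ 2 := by gcongr
          _ = _ := by norm_num
      exact mul_le_mul_of_nonneg_right h4 (by positivity)
  -- main term
  have hfR : ∑' n, ‖cv f (Rk ψ q a) n‖ₑ ^ 2 ≤ ENNReal.ofReal ((2 / q) ^ d) * ∑' n, ‖f n‖ₑ ^ 2 := by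
    have := supplan (fun _ : Unit => Rk ψ q a) (fun _ => hR) ((2 / q) ^ d) (fun ξ s => ?_) f hf
    · simpa using this
    · calc _ ≤ ∑ k : Unit, ‖ftZ (Rk ψ q a) ξ‖ ^ 2 := Finset.sum_le_univ_sum_of_nonneg fun _ => by positivity
        _ = ‖ftZ (Rk ψ q a) ξ‖ ^ 2 := by simp
        _ ≤ _ := Rk_ft_norm hd ψ hψ q a hco ξ
  have hgam : ∀ k : ℕ, ‖gam (2 ^ k) τ ^ d‖ₑ ^ 2 = ENNReal.ofReal ((1 / (2 * Real.sqrt (1 + τ ^ 2))) ^ d) := by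
    intro k
    rw [← ofReal_norm, ← ENNReal.ofReal_pow (norm_nonneg _), norm_pow, ← pow_mul, mul_comm d 2, pow_mul, gam_norm τ (by positivity)]
  have hgam' : ∀ k : ℕ, ‖gam (2 ^ k) τ ^ d‖ₑ = (ENNReal.ofReal ((1 / (2 * Real.sqrt (1 + τ ^ 2))) ^ d)) ^ (1 / 2 : ℝ) := by
    intro k
    rw [← hgam k, ← ENNReal.rpow_natCast, ← ENNReal.rpow_mul]; norm_num
  set γ : ℝ≥0∞ := (ENNReal.ofReal ((1 / (2 * Real.sqrt (1 + τ ^ 2))) ^ d)) ^ (1 / 2 : ℝ) with hγ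
  have hmn : ∑' n, (γ * ⨆ k : {k // Vld q τ j k}, ‖cv (cv (cv f (Rk ψ q a)) (DPc ψ j k)) (fun m => (psiQL (fun x => ψ x) q (2 ^ (k:ℕ)) m : ℂ)) n‖ₑ) ^ 2 ≤
      ENNReal.ofReal (C2.toReal * b) * ∑' n, ‖f n‖ₑ ^ 2 := by
    simp only [mul_pow]
    rw [ENNReal.tsum_mul_left]
    calc _ ≤ γ ^ 2 * (C2 * (ENNReal.ofReal ((2 / q) ^ d) * ∑' n, ‖f n‖ₑ ^ 2)) := by
          gcongr
          exact (hmain q τ j _).trans (by gcongr)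
      _ = (C2 * (γ ^ 2 * ENNReal.ofReal ((2 / q) ^ d))) * ∑' n, ‖f n‖ₑ ^ 2 := by ring
      _ ≤ _ := by
          gcongr
          rw [← hgam' 0, hgam 0, ← ENNReal.ofReal_mul (by positivity), ENNReal.ofReal_mul (p := C2.toReal) (by positivity), ENNReal.ofReal_toReal hC2]
          gcongr
          rw [hb, Bq_sq, ← mul_pow]
          calc _ = (1 / (q * Real.sqrt (1 + τ ^ 2))) ^ d := by congr 1; field_simp
            _ ≤ _ := le_mul_of_one_le_right (by positivity) (by nlinarith [sq_nonneg τ])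
  have hpt : ∀ n, (⨆ k : {k // Vld q τ j k}, ‖cv (cv f (DPc ψ j k)) (Kk (2 ^ (k:ℕ)) q a τ) n‖ₑ) ≤
      (⨆ k : {k // Vld q τ j k}, ‖cv (cv f (DPc ψ j k)) (Ek ψ q a τ k) n‖ₑ) + γ * ⨆ k : {k // Vld q τ j k}, ‖cv (cv (cv f (Rk ψ q a)) (DPc ψ j k)) (fun m => (psiQL (fun x => ψ x) q (2 ^ (k:ℕ)) m : ℂ)) n‖ₑ := by
    intro n
    refine iSup_le fun k => ?_
    have hg := cv_bdd hf (hD k)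
    rw [cv_Ek ψ q a τ k k.2.h1 _ _ hg]
    refine (enorm_add_le _ _).trans (add_le_add (le_iSup (fun k : {k // Vld q τ j k} => ‖cv (cv f (DPc ψ j k)) (Ek ψ q a τ k) n‖ₑ) k) ?_)
    rw [enorm_mul, hgam']
    gcongr
    have e : cv (cv f (DPc ψ j k)) (cv (Rk ψ q a) fun m => (psiQL (fun x => ψ x) q (2 ^ (k:ℕ)) m : ℂ)) n
        = cv (cv (cv f (Rk ψ q a)) (DPc ψ j k)) (fun m => (psiQL (fun x => ψ x) q (2 ^ (k:ℕ)) m : ℂ)) n := by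
      rw [← cv_assoc hg hR (hP k)]
      have : cv (cv f (DPc ψ j k)) (Rk ψ q a) = cv (cv f (Rk ψ q a)) (DPc ψ j k) := by
        funext n
        rw [cv_assoc hf (hD k) hR, cv_assoc hf hR (hD k), cv_comm (DPc ψ j k)]
      rw [this]
    rw [e]
    exact le_iSup (fun k : {k // Vld q τ j k} => ‖cv (cv (cv f (Rk ψ q a)) (DPc ψ j k)) (fun m => (psiQL (fun x => ψ x) q (2 ^ (k:ℕ)) m : ℂ)) n‖ₑ) k
  calc _ ≤ ∑' n, (2 * (⨆ k : {k // Vld q τ j k}, ‖cv (cv f (DPc ψ j k)) (Ek ψ q a τ k) n‖ₑ) ^ 2 + 2 * (γ * ⨆ k : {k // Vld q τ j k}, ‖cv (cv (cv f (Rk ψ q a)) (DPc ψ j k)) (fun m => (psiQL (fun x => ψ x) q (2 ^ (k:ℕ)) m : ℂ)) n‖ₑ) ^ 2) := by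
        refine ENNReal.tsum_le_tsum fun n => le_trans ?_ (sq_add_le _ _)
        gcongr
        exact hpt n
    _ ≤ 2 * (ENNReal.ofReal (4 * (C * b)) * ∑' n, ‖f n‖ₑ ^ 2) + 2 * (ENNReal.ofReal (C2.toReal * b) * ∑' n, ‖f n‖ₑ ^ 2) := by
        rw [ENNReal.tsum_add, ENNReal.tsum_mul_left, ENNReal.tsum_mul_left]
        gcongr
    _ = _ := by
        have : (2:ℝ≥0∞) = ENNReal.ofReal 2 := by norm_num
        rw [this, ← mul_assoc (ENNReal.ofReal 2), ← mul_assoc (ENNReal.ofReal 2), ← add_mul, ← ENNReal.ofReal_mul (by norm_num), ← ENNReal.ofReal_mul (by norm_num), ← ENNReal.ofReal_add (by positivity) (by positivity)]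
        congr 2; ring

/-- the final bound for one `(q,a,τ,j)` -/
def bnd (q : ℕ) (τ : ℝ) (j : ℕ) : ℝ := (q:ℝ) ^ (-(9/4) : ℝ) * ((2:ℝ) ^ (-(1/4) : ℝ)) ^ j * (1 + τ ^ 2) ^ (-(3/4) : ℝ)

theorem KEY {d : ℕ} (hd : 5 ≤ d) (ψ : SchwartzMap (Fin d → ℝ) ℝ) (hψ : HPsi ψ) :
    ∃ C : ℝ, 0 < C ∧ ∀ (q : ℕ) [NeZero q] (a : ℤ), IsCoprime a (q:ℤ) → ∀ (τ : ℝ) (j : ℕ) (f : (Fin d → ℤ) → ℂ) (M : ℝ),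
      (∀ n, ‖f n‖ ≤ M) → 
      ∑' n, (⨆ k : {k // Vld q τ j k}, ‖cv (cv f (DPc ψ j k)) (Kk (2 ^ (k:ℕ)) q a τ) n‖ₑ) ^ 2 ≤
        ENNReal.ofReal (C * bnd q τ j) ^ 2 * ∑' n, ‖f n‖ₑ ^ 2 := by
  obtain ⟨CA, hCA, hA⟩ := keyA (by omega) ψ hψ
  obtain ⟨CB, hCB, hB⟩ := keyB (by omega) ψ hψ
  refine ⟨CA + CB + 1, by positivity, fun q _ a hco τ j f M hf => ?_⟩
  have hq : (1:ℝ) ≤ q := by exact_mod_cast Nat.pos_of_ne_zero (NeZero.ne q)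
  have hq0 : (0:ℝ) < q := by linarith
  have hT : 1 ≤ 1 + τ ^ 2 := by nlinarith [sq_nonneg τ]
  have hT0 : 0 < 1 + τ ^ 2 := by linarith
  set C := CA + CB + 1 with hC
  have hC1 : 1 ≤ C := by rw [hC]; linarith
  have hbase : (Bq q τ ^ d) ^ 2 * (1 + τ ^ 2) ≤ (q:ℝ) ^ (-5:ℝ) * (1 + τ ^ 2) ^ (-(3/2):ℝ) := by
    rw [Bq_sq]
    have hs : 1 ≤ Real.sqrt (1 + τ ^ 2) := by rw [Real.one_le_sqrt]; exact hT
    calc _ ≤ (1 / (q * Real.sqrt (1 + τ ^ 2))) ^ 5 * (1 + τ ^ 2) := by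
          gcongr ?_ * _
          apply pow_le_pow_of_le_one (by positivity) _ hd
          rw [div_le_one (by positivity)]
          nlinarith
      _ = _ := by
          rw [Real.sqrt_eq_rpow, one_div, inv_pow, mul_pow, mul_inv]
          have e3 : ∀ T : ℝ, 0 < T → T ^ (-(3/2):ℝ) = ((T ^ (1/2:ℝ)) ^ 5)⁻¹ * T := by
            intro T hT0
            rw [← Real.rpow_natCast, ← Real.rpow_mul hT0.le, ← Real.rpow_neg hT0.le]
            nth_rw 3 [← Real.rpow_one T]
            rw [← Real.rpow_add hT0]; norm_num
          rw [e3 _ hT0]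
          rw [Real.rpow_neg hq0.le, show (5:ℝ) = (5:ℕ) by norm_num, Real.rpow_natCast]
          ring
  have hbsq : bnd q τ j ^ 2 = (q:ℝ) ^ (-5:ℝ) * (1 + τ ^ 2) ^ (-(3/2):ℝ) * ((q:ℝ) ^ (1/2:ℝ) * (((2:ℝ) ^ j) ^ (1/2:ℝ))⁻¹) := by
    unfold bnd
    rw [mul_pow, mul_pow, ← Real.rpow_natCast ((q:ℝ) ^ _), ← Real.rpow_natCast ((1 + τ ^ 2) ^ _), ← Real.rpow_mul hq0.le, ← Real.rpow_mul hT0.le]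
    have e1 : (q:ℝ) ^ (-5:ℝ) * (q:ℝ) ^ (1/2:ℝ) = (q:ℝ) ^ (-(9/4) * (2:ℕ) : ℝ) := by
      rw [← Real.rpow_add hq0]; norm_num
    have e2 : (((2:ℝ) ^ (-(1/4) : ℝ)) ^ j) ^ 2 = (((2:ℝ) ^ j) ^ (1/2:ℝ))⁻¹ := by
      rw [← Real.rpow_natCast, ← Real.rpow_natCast, ← Real.rpow_natCast, ← Real.rpow_mul (by positivity), ← Real.rpow_mul (by positivity), ← Real.rpow_mul (by positivity), ← Real.rpow_neg (by positivity)]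
      congr 1; push_cast; ring
    rw [e2, ← e1]
    have : (-(3/4) * (2:ℕ) : ℝ) = -(3/2) := by norm_num
    rw [this]; ring
  have hp : 0 ≤ bnd q τ j := by unfold bnd; positivity
  rw [← ENNReal.ofReal_pow (by positivity), mul_pow, hbsq]
  set b0 := (q:ℝ) ^ (-5:ℝ) * (1 + τ ^ 2) ^ (-(3/2):ℝ) with hb0
  have hb00 : 0 ≤ b0 := by positivity
  have hCC : C ≤ C ^ 2 := by nlinarith
  have h2j : (0:ℝ) < 2 ^ j := by positivity
  by_cases hqj : q ≤ 2 ^ j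
  · refine (hA q a hco τ j hqj f M hf).trans ?_
    refine mul_le_mul' (ENNReal.ofReal_le_ofReal ?_) le_rfl
    have : (((4:ℝ) ^ j))⁻¹ ≤ (q:ℝ) ^ (1/2:ℝ) * (((2:ℝ) ^ j) ^ (1/2:ℝ))⁻¹ := by
      calc ((4:ℝ) ^ j)⁻¹ ≤ (((2:ℝ) ^ j) ^ (1/2:ℝ))⁻¹ := by
            gcongr
            calc ((2:ℝ) ^ j) ^ (1/2:ℝ) ≤ ((2:ℝ) ^ j) ^ (1:ℝ) := by
                  gcongr
                  · exact one_le_pow₀ (by norm_num)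
                  · norm_num
              _ = 2 ^ j := by simp
              _ ≤ _ := by gcongr; norm_num
        _ ≤ _ := le_mul_of_one_le_left (by positivity) (Real.one_le_rpow hq (by norm_num))
    calc _ = CA * ((Bq q τ ^ d) ^ 2 * (1 + τ ^ 2) * ((4:ℝ) ^ j)⁻¹) := by ring
      _ ≤ C ^ 2 * (b0 * ((q:ℝ) ^ (1/2:ℝ) * (((2:ℝ) ^ j) ^ (1/2:ℝ))⁻¹)) := by
          gcongr
          linarith
  · refine (hB q a hco τ j f M hf).trans ?_
    refine mul_le_mul' (ENNReal.ofReal_le_ofReal ?_) le_rfl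
    have : 1 ≤ (q:ℝ) ^ (1/2:ℝ) * (((2:ℝ) ^ j) ^ (1/2:ℝ))⁻¹ := by
      rw [← div_eq_mul_inv, one_le_div (by positivity)]
      gcongr
      exact_mod_cast (not_le.1 hqj).le
    calc _ ≤ C ^ 2 * b0 := by
          gcongr
          linarith
      _ ≤ _ := by gcongr; exact le_mul_of_one_le_right hb00 this

def Wk {d : ℕ} (k : ℕ) (t : ℝ) (m : Fin d → ℤ) : ℂ := ec (t * nsq m) * (Real.exp (-(2 * π * nsq m / 4 ^ k)) : ℂ)

theorem ec_cont : Continuous ec := by unfold ec; fun_prop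

theorem Wk_Kk {d : ℕ} (k q : ℕ) [NeZero q] (a : ℤ) (τ : ℝ) (m : Fin d → ℤ) :
    Kk (2 ^ k) q a τ m = (((2:ℂ) ^ k) ^ d)⁻¹ * Wk k ((a:ℝ) / q + τ / 4 ^ k) m := by
  have h1 : ∀ x : ℤ, k1 (2 ^ k) q a τ x = ((2:ℂ) ^ k)⁻¹ * (ec (((a:ℝ) / q + τ / 4 ^ k) * (x:ℝ) ^ 2) * Complex.exp (-(2 * π * (x:ℂ) ^ 2 / 4 ^ k))) := by
    intro x
    unfold k1
    rw [mul_assoc]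
    congr 1
    · push_cast; rfl
    rw [add_mul, ec_add, mul_assoc (ec _) (ec _)]
    congr 1
    · congr 1; ring
    rw [ec, ← Complex.exp_add]
    congr 1
    have h4 : (4:ℂ) ^ k = (2 ^ k) ^ 2 := by rw [← pow_mul, mul_comm, pow_mul]; norm_num
    simp only [AA, zz]
    push_cast
    rw [h4]
    have : (2:ℂ) ^ k ≠ 0 := pow_ne_zero _ two_ne_zero
    field_simp
    ring
  unfold Kk Wk nsq
  rw [Finset.prod_congr rfl fun i _ => h1 (m i), Finset.prod_mul_distrib, Finset.prod_mul_distrib]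
  rw [Finset.prod_const, Finset.card_univ, Fintype.card_fin, inv_pow, Finset.mul_sum, ec_sum, ← Complex.exp_sum]
  congr 2
  push_cast
  rw [Finset.sum_neg_distrib, Finset.mul_sum, Finset.sum_div]

theorem Wk_norm {d : ℕ} (k : ℕ) (t : ℝ) (m : Fin d → ℤ) : ‖Wk k t m‖ = ‖Wk k 0 m‖ := by
  unfold Wk; rw [norm_mul, norm_mul, norm_ec, norm_ec]

theorem Wk_summable {d : ℕ} (k : ℕ) (t : ℝ) : Summable fun m : Fin d → ℤ => ‖Wk k t m‖ := by
  have h := (Kk_ft (d := d) (show (0:ℝ) < 2 ^ k by positivity) 1 0 0).1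
  have h2 := h.mul_left ‖((2:ℂ) ^ k) ^ d‖
  refine h2.congr fun m => ?_
  rw [Wk_Kk, norm_mul, ← mul_assoc, ← norm_mul, mul_inv_cancel₀ (pow_ne_zero _ (pow_ne_zero _ two_ne_zero)), norm_one, one_mul, Wk_norm, ← Wk_norm k t]

theorem cvW_cont {d : ℕ} (k : ℕ) (g : (Fin d → ℤ) → ℂ) (M : ℝ) (hg : ∀ n, ‖g n‖ ≤ M) (n) : Continuous fun t => cv g (Wk k t) n := by
  unfold cv
  refine continuous_tsum (u := fun m => M * ‖Wk k 0 m‖) (fun m => ?_) ((Wk_summable k 0).mul_left M) (fun m t => ?_)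
  · unfold Wk
    have := ec_cont
    fun_prop
  · rw [norm_mul, Wk_norm]; gcongr; exact hg _

theorem int_ec (z : ℤ) : ∫ t in Set.Ioc (0:ℝ) 1, ec (t * z) = if z = 0 then 1 else 0 := by
  split_ifs with h
  · subst h
    simp [ec_zero]
  · rw [← intervalIntegral.integral_of_le zero_le_one]
    have hc : (2 * π * Complex.I * z : ℂ) ≠ 0 := by
      have := Real.pi_ne_zero
      simp [h, this]
    have := integral_exp_mul_complex (a := 0) (b := 1) hc
    have e : ∀ t : ℝ, ec (t * z) = Complex.exp (2 * π * Complex.I * z * t) := by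
      intro t; rw [ec]; congr 1; push_cast; ring
    simp only [e]
    rw [this]
    have h1 := ec_int z
    rw [ec] at h1
    push_cast at h1 ⊢
    rw [mul_one, h1]
    simp

theorem orth {d : ℕ} (k N : ℕ) (g : (Fin d → ℤ) → ℂ) (M : ℝ) (hg : ∀ n, ‖g n‖ ≤ M) (n) :
    ∫ t in Set.Ioc (0:ℝ) 1, cv g (Wk k t) n * ec (-(t * N)) = (Real.exp (-(2 * π * N / 4 ^ k)) : ℂ) * ∑ m ∈ rS d N, g (n - m) := by
  set F : (Fin d → ℤ) → ℝ → ℂ := fun m t => g (n - m) * Wk k t m * ec (-(t * N)) with hF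
  have hec := ec_cont
  have hFc : ∀ m, Continuous (F m) := by
    intro m; simp only [hF]; unfold Wk; fun_prop
  have hFn : ∀ m t, ‖F m t‖ = ‖g (n - m) * Wk k 0 m‖ := by
    intro m t; simp only [hF]; rw [norm_mul, norm_mul, norm_ec, norm_mul, Wk_norm, mul_one]
  have hs := MeasureTheory.hasSum_integral_of_summable_integral_norm (μ := MeasureTheory.volume.restrict (Set.Ioc (0:ℝ) 1)) (F := F)
    (fun m => ((hFc m).integrableOn_Icc (a := 0) (b := 1)).mono_set Set.Ioc_subset_Icc_self) (by
      have := cv_pt_summable hg (Wk_summable k 0) n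
      refine this.congr fun m => ?_
      simp only [hFn]
      simp)
  have h1 : ∀ t, cv g (Wk k t) n * ec (-(t * N)) = ∑' m, F m t := by
    intro t; rw [cv, ← tsum_mul_right]
  simp only [h1]
  rw [← hs.tsum_eq]
  have h2 : ∀ m, ∫ t in Set.Ioc (0:ℝ) 1, F m t = if m ∈ rS d N then g (n - m) * (Real.exp (-(2 * π * N / 4 ^ k)) : ℂ) else 0 := by
    intro m
    have e : ∀ t, F m t = (g (n - m) * (Real.exp (-(2 * π * nsq m / 4 ^ k)) : ℂ)) * ec (t * ((∑ i, (m i) ^ 2 - (N:ℤ) : ℤ):ℝ)) := by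
      intro t
      simp only [hF]
      unfold Wk
      have : ec (t * ((∑ i, (m i) ^ 2 - (N:ℤ) : ℤ):ℝ)) = ec (t * nsq m) * ec (-(t * N)) := by
        rw [← ec_add]; congr 1; unfold nsq; push_cast; ring
      rw [this]; ring
    simp only [e]
    rw [MeasureTheory.integral_const_mul, int_ec]
    by_cases hm : m ∈ rS d N
    · have hm' := mem_rS.1 hm
      have : nsq m = N := by unfold nsq; exact_mod_cast hm'
      rw [if_pos hm, if_pos (by omega), this, mul_one]
    · rw [if_neg hm, if_neg (fun h => hm (mem_rS.2 (by omega))), mul_zero]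
  rw [tsum_congr h2, tsum_eq_sum (s := rS d N) (fun m hm => if_neg hm), Finset.mul_sum]
  exact Finset.sum_congr rfl fun m hm => by rw [if_pos hm, mul_comm]

theorem sph_le {d : ℕ} (k N : ℕ) (g : (Fin d → ℤ) → ℂ) (M : ℝ) (hg : ∀ n, ‖g n‖ ≤ M) (n) :
    ‖∑ m ∈ rS d N, g (n - m)‖ₑ ≤ ENNReal.ofReal (Real.exp (2 * π * N / 4 ^ k)) * ∫⁻ t in Set.Ioc (0:ℝ) 1, ‖cv g (Wk k t) n‖ₑ := by
  have h := orth k N g M hg n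
  have h1 : ∑ m ∈ rS d N, g (n - m) = (Real.exp (2 * π * N / 4 ^ k) : ℂ) * ∫ t in Set.Ioc (0:ℝ) 1, cv g (Wk k t) n * ec (-(t * N)) := by
    rw [h, ← mul_assoc, ← Complex.ofReal_mul, ← Real.exp_add]; simp
  rw [h1, enorm_mul]
  refine mul_le_mul' ?_ ((MeasureTheory.enorm_integral_le_lintegral_enorm _).trans ?_)
  · rw [← ofReal_norm, Complex.norm_real, Real.norm_of_nonneg (by positivity)]
  · refine MeasureTheory.lintegral_mono fun t => ?_
    rw [enorm_mul, ← ofReal_norm (ec _), norm_ec]; simp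

def Okp (p : ℕ × ℕ) : Prop := 0 < p.1 ∧ p.2 ≤ p.1 ∧ IsCoprime (p.2 : ℤ) (p.1 : ℤ)

theorem chvar (F : ℝ → ℝ≥0∞) (hF : Measurable F) (b c : ℝ) (hc : 0 < c) :
    ∫⁻ t, F t = ENNReal.ofReal c * ∫⁻ τ, F (b + c * τ) := by
  rw [← MeasureTheory.lintegral_add_left_eq_self F b]
  have hm : Measurable fun x => F (b + x) := hF.comp (measurable_const_add b)
  nth_rw 1 [← Real.smul_map_volume_mul_left hc.ne']
  rw [MeasureTheory.lintegral_smul_measure, MeasureTheory.lintegral_map hm (measurable_const_mul c), abs_of_pos hc]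
  rfl

theorem arcs (k : ℕ) (hk : 3 ≤ k) (F : ℝ → ℝ≥0∞) (hF : Measurable F) :
    ∫⁻ t in Set.Ioc (0:ℝ) 1, F t ≤ ∑' p : ℕ × ℕ, ∫⁻ τ, ENNReal.ofReal (1 / 4 ^ k) * 
      Set.indicator {τ : ℝ | Okp p ∧ 8 * (p.1:ℝ) ≤ 2 ^ k ∧ p.1 * |τ| ≤ 2 ^ (k + 3)} (fun τ => F ((p.2:ℝ) / p.1 + τ / 4 ^ k)) τ := by
  set A : ℕ × ℕ → Set ℝ := fun p => {t : ℝ | Okp p ∧ 8 * (p.1:ℝ) ≤ 2 ^ k ∧ p.1 * (4 ^ k * |t - (p.2:ℝ) / p.1|) ≤ 2 ^ (k + 3)} with hA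
  have hAm : ∀ p, MeasurableSet (A p) := by
    intro p
    by_cases h : Okp p ∧ 8 * (p.1:ℝ) ≤ 2 ^ k
    · have : A p = {t : ℝ | p.1 * (4 ^ k * |t - (p.2:ℝ) / p.1|) ≤ 2 ^ (k + 3)} := by
        ext t; simp only [hA, Set.mem_ofPred_eq]; tauto
      rw [this]
      exact (isClosed_le (by fun_prop) (by fun_prop)).measurableSet
    · have : A p = ∅ := by
        ext t; simp only [hA, Set.mem_ofPred_eq, Set.mem_empty_iff_false]; tauto
      rw [this]; exact MeasurableSet.empty
  have hcov : Set.Ioc (0:ℝ) 1 ⊆ ⋃ p, A p := by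
    intro t ht
    obtain ⟨r, hr, hrd⟩ := Real.exists_rat_abs_sub_le_and_den_le t (n := 2 ^ (k - 3)) (by positivity)
    have hd0 : (0:ℝ) < r.den := by exact_mod_cast r.den_pos
    have hrr : (r:ℝ) = (r.num:ℝ) / r.den := by exact_mod_cast (Rat.num_div_den r).symm
    have h2k : (2:ℝ) ^ k = 2 ^ (k - 3) * 8 := by
      conv_lhs => rw [show k = (k - 3) + 3 by omega, pow_add]
      norm_num
    set n : ℝ := 2 ^ (k - 3) with hn
    have hn0 : 1 ≤ n := one_le_pow₀ (by norm_num)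
    have hr' : r.den * |t - r| ≤ 1 / (n + 1) := by
      push_cast at hr
      calc _ ≤ (r.den:ℝ) * (1 / ((n + 1) * r.den)) := by gcongr
        _ = _ := by field_simp
    have hlt : |r.den * t - r.num| < 1 := by
      have : (r.den:ℝ) * t - r.num = r.den * (t - r) := by rw [hrr]; field_simp
      rw [this, abs_mul, abs_of_pos hd0]
      refine hr'.trans_lt ?_
      rw [div_lt_one (by linarith)]; linarith
    rw [abs_lt] at hlt
    have hnum0 : 0 ≤ r.num := by
      have h1 : (-1:ℝ) < r.num := by nlinarith [ht.1, mul_pos hd0 ht.1]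
      have h2 : (-1:ℤ) < r.num := by exact_mod_cast h1
      omega
    have hnumle : r.num ≤ r.den := by
      have : (r.num:ℝ) < r.den + 1 := by nlinarith [ht.2]
      have h2 : r.num < r.den + 1 := by exact_mod_cast this
      omega
    have hcast : ((r.num.natAbs : ℕ) : ℤ) = r.num := Int.natAbs_of_nonneg hnum0
    have hcastR : ((r.num.natAbs : ℕ) : ℝ) = r.num := by
      have := congrArg (Int.cast : ℤ → ℝ) hcast
      rwa [Int.cast_natCast] at this
    refine Set.mem_iUnion.2 ⟨(r.den, r.num.natAbs) |> fun x => x, ?_⟩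
    simp only [hA, Set.mem_ofPred_eq, Okp]
    refine ⟨⟨r.den_pos, by omega, ?_⟩, ?_, ?_⟩
    · rw [Nat.isCoprime_iff_coprime]; exact r.reduced
    · have : (r.den:ℝ) ≤ n := by
        rw [hn]; exact_mod_cast hrd
      rw [h2k]; linarith
    · rw [hcastR, ← hrr, mul_left_comm]
      have h4 : (4:ℝ) ^ k = (2 ^ k) ^ 2 := by rw [← pow_mul, mul_comm, pow_mul]; norm_num
      calc (4:ℝ) ^ k * (r.den * |t - r|) ≤ 4 ^ k * (1 / (n + 1)) := by gcongr
        _ ≤ 4 ^ k * (1 / n) := by gcongr; linarith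
        _ = _ := by rw [h4, pow_add, h2k]; field_simp; norm_num
  calc _ ≤ ∫⁻ t in ⋃ p, A p, F t := MeasureTheory.lintegral_mono_set hcov
    _ ≤ ∑' p, ∫⁻ t in A p, F t := MeasureTheory.lintegral_iUnion_le _ _
    _ = _ := by
      refine tsum_congr fun p => ?_
      rw [← MeasureTheory.lintegral_indicator (hAm p), chvar _ (hF.indicator (hAm p)) ((p.2:ℝ) / p.1) (1 / 4 ^ k) (by positivity), MeasureTheory.lintegral_const_mul' _ _ ENNReal.ofReal_ne_top]
      congr 1
      refine MeasureTheory.lintegral_congr fun τ => ?_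
      have e : (p.2:ℝ) / p.1 + 1 / 4 ^ k * τ = (p.2:ℝ) / p.1 + τ / 4 ^ k := by ring
      rw [e]
      by_cases h : τ ∈ {τ : ℝ | Okp p ∧ 8 * (p.1:ℝ) ≤ 2 ^ k ∧ p.1 * |τ| ≤ 2 ^ (k + 3)}
      · rw [Set.indicator_of_mem h, Set.indicator_of_mem]
        simp only [hA, Set.mem_ofPred_eq] at h ⊢
        rw [add_sub_cancel_left, abs_div, abs_of_pos (by positivity : (0:ℝ) < 4 ^ k), mul_div_cancel₀ _ (by positivity)]
        exact h
      · rw [Set.indicator_of_notMem h, Set.indicator_of_notMem]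
        simp only [hA, Set.mem_ofPred_eq] at h ⊢
        rw [add_sub_cancel_left, abs_div, abs_of_pos (by positivity : (0:ℝ) < 4 ^ k), mul_div_cancel₀ _ (by positivity)]
        exact h

open Classical in
def Phi {d : ℕ} (ψ : SchwartzMap (Fin d → ℝ) ℝ) (f : (Fin d → ℤ) → ℂ) (j : ℕ) (p : ℕ × ℕ) (τ : ℝ) (n : Fin d → ℤ) : ℝ≥0∞ :=
  if Okp p then ⨆ k : {k // Vld p.1 τ j k}, ‖cv (cv f (DPc ψ j k)) (Kk (2 ^ (k:ℕ)) p.1 (p.2:ℤ) τ) n‖ₑ else 0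

theorem cv_Kk {d : ℕ} (g : (Fin d → ℤ) → ℂ) (k q : ℕ) [NeZero q] (a : ℤ) (τ : ℝ) (n : Fin d → ℤ) :
    cv g (Kk (2 ^ k) q a τ) n = (((2:ℂ) ^ k) ^ d)⁻¹ * cv g (Wk k ((a:ℝ) / q + τ / 4 ^ k)) n := by
  unfold cv
  rw [← tsum_mul_left]
  refine tsum_congr fun m => ?_
  rw [Wk_Kk]; ring

theorem enorm_W {d : ℕ} (g : (Fin d → ℤ) → ℂ) (k q : ℕ) [NeZero q] (a : ℤ) (τ : ℝ) (n : Fin d → ℤ) :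
    ‖cv g (Wk k ((a:ℝ) / q + τ / 4 ^ k)) n‖ₑ = ENNReal.ofReal ((2 ^ k) ^ d) * ‖cv g (Kk (2 ^ k) q a τ) n‖ₑ := by
  rw [cv_Kk, enorm_mul, ← mul_assoc, ← ofReal_norm (_⁻¹), ← ENNReal.ofReal_mul (by positivity), norm_inv, norm_pow, norm_pow]
  rw [show ‖(2:ℂ)‖ = 2 by simp, mul_inv_cancel₀ (by positivity)]; simp

theorem Mk_le {d : ℕ} (hd : 5 ≤ d) (ψ : SchwartzMap (Fin d → ℝ) ℝ) : ∃ C : ℝ, 0 < C ∧ ∀ (f : (Fin d → ℤ) → ℝ) (M : ℝ), (∀ n, ‖(f n : ℂ)‖ ≤ M) →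
    ∀ j k : ℕ, 2 ^ (j + 3) ≤ k → ∀ n, Mk k (conv f (DeltaPsiJK (fun x => ψ x) j k)) n ≤ ENNReal.ofReal C * ∑' p : ℕ × ℕ, ∫⁻ τ, Phi ψ (fun n => (f n : ℂ)) j p τ n := by
  obtain ⟨c, hc, hN⟩ := Nlam_lb d hd
  refine ⟨c⁻¹ * Real.exp (8 * π), by positivity, fun f M hf j k hjk n => ?_⟩
  have hk3 : 3 ≤ k := by
    have : 2 ^ 3 ≤ 2 ^ (j + 3) := Nat.pow_le_pow_right (by norm_num) (by omega)
    omega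
  set g : (Fin d → ℤ) → ℂ := cv (fun n => (f n : ℂ)) (DPc ψ j k) with hg
  have hgc : ∀ n, g n = ((conv f (DeltaPsiJK (fun x => ψ x) j k) n : ℝ) : ℂ) := by
    intro n
    rw [hg, cv, conv, Complex.ofReal_tsum]
    refine tsum_congr fun m => ?_
    rw [DPc]; push_cast; rfl
  have hgb := cv_bdd hf (DPc_summable ψ hjk)
  refine iSup_le fun lam => iSup_le fun ⟨hl1, hl2, N, hNl⟩ => ?_
  have hl0 : 0 < lam := lt_of_lt_of_le (by positivity) hl1
  have hNlam := hN lam N hl0 hNl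
  have hpos : 0 < c * lam ^ (d - 2) := by positivity
  have h2d : (2:ℝ) ^ k ^ 1 = 2 ^ k := by simp
  have hAvg : (‖Avg lam (conv f (DeltaPsiJK (fun x => ψ x) j k)) n‖₊ : ℝ≥0∞) = ENNReal.ofReal ((Nlam d lam : ℝ)⁻¹) * ‖∑ m ∈ rS d N, g (n - m)‖ₑ := by
    have e1 : ∑' m : sph d lam, conv f (DeltaPsiJK (fun x => ψ x) j k) (n - (m : Fin d → ℤ)) = ∑ m ∈ rS d N, conv f (DeltaPsiJK (fun x => ψ x) j k) (n - m) := by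
      rw [sph_eq d N lam hNl]
      exact Finset.tsum_subtype (rS d N) (fun m => conv f (DeltaPsiJK (fun x => ψ x) j k) (n - m))
    rw [Avg, e1]
    change ‖(Nlam d lam:ℝ)⁻¹ * ∑ m ∈ rS d N, conv f (DeltaPsiJK (fun x => ψ x) j k) (n - m)‖ₑ = _
    rw [enorm_mul]
    congr 1
    · rw [← ofReal_norm, Real.norm_of_nonneg (by positivity)]
    · simp only [hgc]
      rw [← Complex.ofReal_sum, ← ofReal_norm, ← ofReal_norm, Complex.norm_real]
  rw [hAvg]
  have hs := (sph_le k N g _ hgb n).trans (mul_le_mul' le_rfl (arcs k hk3 _ (cvW_cont k g _ hgb n).enorm.measurable))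
  refine (mul_le_mul' le_rfl hs).trans ?_
  rw [← mul_assoc, ← ENNReal.ofReal_mul (by positivity)]
  have hconst : (Nlam d lam : ℝ)⁻¹ * Real.exp (2 * π * N / 4 ^ k) * (1 / 4 ^ k) * (2 ^ k) ^ d ≤ c⁻¹ * Real.exp (8 * π) := by
    have hx : Real.exp (2 * π * N / 4 ^ k) ≤ Real.exp (8 * π) := by
      apply Real.exp_le_exp.2
      rw [div_le_iff₀ (by positivity), hNl]
      have : lam ^ 2 ≤ 4 * 4 ^ k := by
        calc lam ^ 2 ≤ (2 ^ (k + 1)) ^ 2 := by gcongr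
          _ = _ := by rw [← pow_mul, mul_comm, pow_mul]; norm_num [pow_succ, mul_comm]
      nlinarith [Real.pi_pos]
    have h4 : (4:ℝ) ^ k = (2 ^ k) ^ 2 := by rw [← pow_mul, mul_comm, pow_mul]; norm_num
    have hinv : (Nlam d lam : ℝ)⁻¹ ≤ c⁻¹ * ((2 ^ k) ^ (d - 2))⁻¹ := by
      rw [← mul_inv]
      apply inv_anti₀ (by positivity)
      refine le_trans ?_ hNlam
      gcongr
    have hdd : ((2:ℝ) ^ k) ^ d = (2 ^ k) ^ (d - 2) * (2 ^ k) ^ 2 := by rw [← pow_add]; congr 1; omega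
    calc _ ≤ (c⁻¹ * ((2 ^ k) ^ (d - 2))⁻¹) * Real.exp (8 * π) * (1 / 4 ^ k) * (2 ^ k) ^ d := by gcongr
      _ = _ := by rw [hdd, h4]; field_simp
  rw [← ENNReal.tsum_mul_left, ← ENNReal.tsum_mul_left]
  refine ENNReal.tsum_le_tsum fun p => ?_
  rw [← MeasureTheory.lintegral_const_mul' _ _ ENNReal.ofReal_ne_top, ← MeasureTheory.lintegral_const_mul' _ _ ENNReal.ofReal_ne_top]
  refine MeasureTheory.lintegral_mono fun τ => ?_
  by_cases h : τ ∈ {τ : ℝ | Okp p ∧ 8 * (p.1:ℝ) ≤ 2 ^ k ∧ p.1 * |τ| ≤ 2 ^ (k + 3)}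
  · rw [Set.indicator_of_mem h]
    obtain ⟨h1, h2, h3⟩ := h
    haveI : NeZero p.1 := ⟨h1.1.ne'⟩
    have e := enorm_W g k p.1 (p.2:ℤ) τ n
    rw [Int.cast_natCast] at e
    rw [e, ← mul_assoc, ← mul_assoc, ← ENNReal.ofReal_mul (by positivity), ← ENNReal.ofReal_mul (by positivity)]
    refine mul_le_mul' (ENNReal.ofReal_le_ofReal hconst) ?_
    rw [Phi, if_pos h1]
    exact le_iSup (fun k : {k // Vld p.1 τ j k} => ‖cv (cv (fun n => (f n : ℂ)) (DPc ψ j k)) (Kk (2 ^ (k:ℕ)) p.1 (p.2:ℤ) τ) n‖ₑ) ⟨k, ⟨h2, h3, hjk⟩⟩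
  · rw [Set.indicator_of_notMem h]; simp

theorem Phi_meas {d : ℕ} (ψ : SchwartzMap (Fin d → ℝ) ℝ) (f : (Fin d → ℤ) → ℂ) (M : ℝ) (hf : ∀ n, ‖f n‖ ≤ M) (j : ℕ) (p : ℕ × ℕ) (n : Fin d → ℤ) :
    Measurable fun τ => Phi ψ f j p τ n := by
  by_cases hp : Okp p
  · haveI : NeZero p.1 := ⟨hp.1.ne'⟩
    have e : (fun τ => Phi ψ f j p τ n) = fun τ => ⨆ k : ℕ, Set.indicator {τ | Vld p.1 τ j k}
        (fun τ => ‖cv (cv f (DPc ψ j k)) (Kk (2 ^ (k:ℕ)) p.1 (p.2:ℤ) τ) n‖ₑ) τ := by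
      funext τ
      rw [Phi, if_pos hp]
      apply le_antisymm
      · refine iSup_le fun k => ?_
        refine le_trans ?_ (le_iSup _ (k:ℕ))
        rw [Set.indicator_of_mem]
        exact k.2
      · refine iSup_le fun k => ?_
        by_cases h : τ ∈ {τ | Vld p.1 τ j k}
        · rw [Set.indicator_of_mem h]
          exact le_iSup (fun k : {k // Vld p.1 τ j k} => ‖cv (cv f (DPc ψ j k)) (Kk (2 ^ (k:ℕ)) p.1 (p.2:ℤ) τ) n‖ₑ) ⟨k, h⟩
        · rw [Set.indicator_of_notMem h]; exact zero_le
    rw [e]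
    refine Measurable.iSup fun k => ?_
    by_cases h : 2 ^ (j + 3) ≤ k
    · refine Measurable.indicator ?_ ?_
      · have hb := cv_bdd hf (DPc_summable ψ h)
        have hc := cvW_cont k _ _ hb n
        simp only [cv_Kk]
        refine (Continuous.enorm ?_).measurable
        refine continuous_const.mul (hc.comp ?_)
        fun_prop
      · by_cases h8 : 8 * (p.1:ℝ) ≤ 2 ^ k
        · have : {τ | Vld p.1 τ j k} = {τ : ℝ | p.1 * |τ| ≤ 2 ^ (k + 3)} := by
            ext τ; exact ⟨fun h => h.h2, fun h2 => ⟨h8, h2, h⟩⟩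
          rw [this]
          exact (isClosed_le (by fun_prop) (by fun_prop)).measurableSet
        · have : {τ | Vld p.1 τ j k} = ∅ := by
            ext τ; exact ⟨fun h => (h8 h.h1).elim, fun h => h.elim⟩
          rw [this]; exact MeasurableSet.empty
    · have : {τ | Vld p.1 τ j k} = ∅ := by
        ext τ; exact ⟨fun h' => (h h'.h3).elim, fun h => h.elim⟩
      rw [this]; simp
  · have : (fun τ => Phi ψ f j p τ n) = fun _ => 0 := by
      funext τ; rw [Phi, if_neg hp]
    rw [this]; exact measurable_const

def betP (p : ℕ × ℕ) : ℝ≥0∞ := if p.2 ≤ p.1 then ENNReal.ofReal ((p.1:ℝ) ^ (-(9/4) : ℝ)) else 0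
def gamJ (j : ℕ) : ℝ≥0∞ := ENNReal.ofReal (((2:ℝ) ^ (-(1/4) : ℝ)) ^ j)
def delT (τ : ℝ) : ℝ≥0∞ := ENNReal.ofReal ((1 + τ ^ 2) ^ (-(3/4) : ℝ))

theorem bet_sum : ∑' p, betP p ≠ ∞ := by
  rw [ENNReal.tsum_prod']
  have h1 : ∀ q : ℕ, ∑' a : ℕ, betP (q, a) ≤ ENNReal.ofReal (2 * (q:ℝ) ^ (-(5/4) : ℝ)) := by
    intro q
    rw [tsum_eq_sum (s := Finset.range (q + 1))]
    · refine (Finset.sum_le_card_nsmul _ _ (ENNReal.ofReal ((q:ℝ) ^ (-(9/4) : ℝ))) ?_).trans ?_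
      · intro a _
        unfold betP; split_ifs
        · exact le_rfl
        · exact zero_le
      · rw [Finset.card_range, nsmul_eq_mul, ← ENNReal.ofReal_natCast, ← ENNReal.ofReal_mul (by positivity)]
        apply ENNReal.ofReal_le_ofReal
        rcases Nat.eq_zero_or_pos q with h | h
        · subst h
          rw [Nat.cast_zero, Real.zero_rpow (by norm_num), Real.zero_rpow (by norm_num)]; simp
        · have hq : (1:ℝ) ≤ q := by exact_mod_cast h
          have : (q:ℝ) ^ (-(5/4) : ℝ) = q * (q:ℝ) ^ (-(9/4) : ℝ) := by
            rw [← Real.rpow_one_add' (by linarith) (by norm_num)]; norm_num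
          rw [this, ← mul_assoc]
          gcongr
          push_cast; linarith
    · intro a ha
      rw [Finset.mem_range] at ha
      unfold betP
      rw [if_neg]; simp only; omega
  refine ne_top_of_le_ne_top ?_ (ENNReal.tsum_le_tsum h1)
  refine (Summable.tsum_ofReal_ne_top ?_)
  exact (Real.summable_nat_rpow.2 (by norm_num)).mul_left 2

theorem gamJ_sum : ∑' j, gamJ j ≠ ∞ := by
  refine Summable.tsum_ofReal_ne_top ?_
  exact summable_geometric_of_lt_one (by positivity) (Real.rpow_lt_one_of_one_lt_of_neg (by norm_num) (by norm_num))

theorem del_meas : Measurable delT := by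
  unfold delT; fun_prop

theorem del_int : ∫⁻ τ, delT τ ≠ ∞ := by
  have h := integrable_rpow_neg_one_add_norm_sq (E := ℝ) (μ := MeasureTheory.volume) (r := 3/2) (by simp; norm_num)
  have h2 := h.lintegral_lt_top.ne
  convert h2 using 4 with τ
  unfold delT
  congr 2
  · simp
  · norm_num

theorem total {d : ℕ} (hd : 5 ≤ d) (ψ : SchwartzMap (Fin d → ℝ) ℝ) (hψ : HPsi ψ) :
    ∃ C : ℝ≥0∞, C ≠ ∞ ∧ ∀ (f : (Fin d → ℤ) → ℂ) (M : ℝ), (∀ n, ‖f n‖ ≤ M) → ∑' n, ‖f n‖ₑ ^ 2 ≠ ∞ →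
      ∑' n, (∑' j, ∑' p, ∫⁻ τ, Phi ψ f j p τ n) ^ 2 ≤ C ^ 2 * ∑' n, ‖f n‖ₑ ^ 2 := by
  obtain ⟨C, hC, hK⟩ := KEY hd ψ hψ
  set D := ENNReal.ofReal C with hD
  have hDt : D ≠ ∞ := ENNReal.ofReal_ne_top
  have e1 : ∀ j p, ∫⁻ τ, D * betP p * gamJ j * delT τ = D * betP p * gamJ j * ∫⁻ τ, delT τ := fun j p =>
    MeasureTheory.lintegral_const_mul _ del_meas
  have e2 : ∀ j, ∑' p, ∫⁻ τ, D * betP p * gamJ j * delT τ = D * (∑' p, betP p) * gamJ j * ∫⁻ τ, delT τ := by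
    intro j
    simp only [e1]
    rw [ENNReal.tsum_mul_right, ENNReal.tsum_mul_right, ENNReal.tsum_mul_left]
  have e3 : ∑' j, ∑' p, ∫⁻ τ, D * betP p * gamJ j * delT τ = D * (∑' p, betP p) * (∑' j, gamJ j) * ∫⁻ τ, delT τ := by
    simp only [e2]
    rw [ENNReal.tsum_mul_right, ENNReal.tsum_mul_left]
  have e3t : ∑' j, ∑' p, ∫⁻ τ, D * betP p * gamJ j * delT τ ≠ ∞ := by
    rw [e3]
    exact ENNReal.mul_ne_top (ENNReal.mul_ne_top (ENNReal.mul_ne_top hDt bet_sum) gamJ_sum) del_int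
  have e2t : ∀ j, ∑' p, ∫⁻ τ, D * betP p * gamJ j * delT τ ≠ ∞ := fun j => ENNReal.ne_top_of_tsum_ne_top e3t j
  have e1t : ∀ j p, ∫⁻ τ, D * betP p * gamJ j * delT τ ≠ ∞ := fun j p => ENNReal.ne_top_of_tsum_ne_top (e2t j) p
  refine ⟨_, e3t, fun f M hf hA => ?_⟩
  refine mink_tsum (fun j n => ∑' p, ∫⁻ τ, Phi ψ f j p τ n) _ e2t _ hA fun j => ?_
  refine mink_tsum (fun p n => ∫⁻ τ, Phi ψ f j p τ n) _ (e1t j) _ hA fun p => ?_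
  refine mink _ (fun τ n => Phi ψ f j p τ n) _ (Phi_meas ψ f M hf j p) (del_meas.const_mul _) (fun τ => ?_) _ hA fun τ => ?_
  · have : betP p ≠ ∞ := ENNReal.ne_top_of_tsum_ne_top bet_sum p
    exact ENNReal.mul_ne_top (ENNReal.mul_ne_top (ENNReal.mul_ne_top hDt this) ENNReal.ofReal_ne_top) ENNReal.ofReal_ne_top
  · by_cases hp : Okp p
    · haveI : NeZero p.1 := ⟨hp.1.ne'⟩
      simp only [Phi, if_pos hp]
      refine (hK p.1 p.2 hp.2.2 τ j f M hf).trans (le_of_eq ?_)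
      congr 2
      rw [bnd, betP, if_pos hp.2.1, gamJ, delT, ENNReal.ofReal_mul hC.le, ENNReal.ofReal_mul (by positivity), ENNReal.ofReal_mul (by positivity)]
      ring
    · simp [Phi, if_neg hp]

theorem main_aux (d : ℕ) (hd : 5 ≤ d) (ψ : SchwartzMap (Fin d → ℝ) ℝ)
    (hψ : HPsi ψ) :
    ∃ C : ℝ, 0 < C ∧ ∀ f : (Fin d → ℤ) → ℝ,
      (∑' n : Fin d → ℤ,
          (⨆ (k : ℕ) (_ : 8 ≤ k),
            ∑ j ∈ Finset.range (Nat.log 2 k - 2),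
              Mk k (conv f (DeltaPsiJK (fun x => ψ x) j k)) n) ^ 2) ^ ((1 : ℝ) / 2)
        ≤ ENNReal.ofReal C * l2norm f := by
  obtain ⟨C1, hC1, h1⟩ := Mk_le hd ψ
  obtain ⟨C2, hC2, h2⟩ := total hd ψ hψ
  refine ⟨C1 * C2.toReal + 1, by positivity, fun f => ?_⟩
  by_cases hA : ∑' n, (‖f n‖₊ : ℝ≥0∞) ^ 2 = ∞
  · rw [l2norm, hA, ENNReal.top_rpow_of_pos (by norm_num), ENNReal.mul_top]
    · exact le_top
    · simp only [ne_eq, ENNReal.ofReal_eq_zero, not_le]; positivity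
  have hen : ∀ n, ‖(f n : ℂ)‖ₑ = (‖f n‖₊ : ℝ≥0∞) := by
    intro n
    change _ = ‖f n‖ₑ
    rw [← ofReal_norm, ← ofReal_norm, Complex.norm_real]
  have hA2 : ∑' n, ‖(f n : ℂ)‖ₑ ^ 2 ≠ ∞ := by simpa only [hen] using hA
  have hbd : ∃ M : ℝ, ∀ n, ‖(f n : ℂ)‖ ≤ M := by
    refine ⟨Real.sqrt (∑' n, ‖(f n : ℂ)‖ₑ ^ 2).toReal, fun n => ?_⟩
    apply Real.le_sqrt_of_sq_le
    have := ENNReal.toReal_mono hA2 (ENNReal.le_tsum (f := fun n => ‖(f n : ℂ)‖ₑ ^ 2) n)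
    simpa using this
  obtain ⟨M, hM⟩ := hbd
  have h3 := h2 _ M hM hA2
  have hpt : ∀ n, (⨆ (k : ℕ) (_ : 8 ≤ k), ∑ j ∈ Finset.range (Nat.log 2 k - 2),
              Mk k (conv f (DeltaPsiJK (fun x => ψ x) j k)) n) ≤
      ENNReal.ofReal C1 * ∑' j, ∑' p, ∫⁻ τ, Phi ψ (fun n => (f n : ℂ)) j p τ n := by
    intro n
    refine iSup_le fun k => iSup_le fun hk => ?_
    rw [← ENNReal.tsum_mul_left]
    refine le_trans (Finset.sum_le_sum fun j hj => ?_) (ENNReal.sum_le_tsum _)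
    refine h1 f M hM j k ?_ n
    rw [Finset.mem_range] at hj
    exact (Nat.pow_le_pow_right (by norm_num) (by omega)).trans (Nat.pow_log_le_self 2 (by omega))
  have h4 : ∑' n, (⨆ (k : ℕ) (_ : 8 ≤ k), ∑ j ∈ Finset.range (Nat.log 2 k - 2),
              Mk k (conv f (DeltaPsiJK (fun x => ψ x) j k)) n) ^ 2 ≤
      (ENNReal.ofReal C1 * C2) ^ 2 * ∑' n, (‖f n‖₊ : ℝ≥0∞) ^ 2 := by
    refine (ENNReal.tsum_le_tsum fun n => pow_le_pow_left' (hpt n) 2).trans ?_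
    simp only [mul_pow]
    rw [ENNReal.tsum_mul_left, mul_assoc]
    refine mul_le_mul' le_rfl (h3.trans ?_)
    simp only [hen]; exact le_rfl
  refine (ENNReal.rpow_le_rpow h4 (by norm_num)).trans ?_
  rw [ENNReal.mul_rpow_of_nonneg _ _ (by norm_num), l2norm]
  refine mul_le_mul' ?_ le_rfl
  rw [← ENNReal.rpow_natCast, ← ENNReal.rpow_mul]
  norm_num
  nth_rw 1 [← ENNReal.ofReal_toReal hC2]
  rw [← ENNReal.ofReal_mul hC1.le]
  exact ENNReal.ofReal_le_ofReal (by linarith)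

/-- **Middle terms in the proof of Theorem 1**: with `J_k = ⌊log₂ k⌋ - 2`,
`‖sup_{k ≥ 8} ∑_{j=0}^{J_k-1} M_k(f * ΔΨ_{j,k})‖₂ ≤ C ‖f‖₂`. -/
theorem middle_terms_bound (d : ℕ) (hd : 5 ≤ d) (ψ : SchwartzMap (Fin d → ℝ) ℝ)
    (hψ : ∀ ξ : Fin d → ℝ, (ftR (fun x => ψ x) ξ).im = 0 ∧
      Set.indicator (cubeQ d) (fun _ => (1 : ℝ)) ξ ≤ (ftR (fun x => ψ x) ξ).re ∧
      (ftR (fun x => ψ x) ξ).re ≤ Set.indicator (cube2Q d) (fun _ => (1 : ℝ)) ξ) :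
    ∃ C : ℝ, 0 < C ∧ ∀ f : (Fin d → ℤ) → ℝ,
      (∑' n : Fin d → ℤ,
          (⨆ (k : ℕ) (_ : 8 ≤ k),
            ∑ j ∈ Finset.range (Nat.log 2 k - 2),
              Mk k (conv f (DeltaPsiJK (fun x => ψ x) j k)) n) ^ 2) ^ ((1 : ℝ) / 2)
        ≤ ENNReal.ofReal C * l2norm f := by
  exact main_aux d hd ψ hψ
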